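/- For every dimension d ≥ 1, every integer m with 0 ≤ m ≤ d−1, and every ε > 0 there exists N₀ such that: for any finite point sets P₀, …, P_m in ℝ^d, each of cardinality at least N₀, there exists an m-dimensional affine subspace L of ℝ^d such that for every i = 0, …, m, the number of (d−m+1)-element subsets T ⊆ P_i whose convex hull intersects L is at least (2(d−m)/((d−m+1)!·(d−m+1)) − ε) · C(|P_i|, d−m+1). -/

import Mathlib

/-! ### Mod 2 cochains on lists -/

namespace ListCochain

variable {α β γ : Type*}

/-- The codimension one faces of a list, regarded as an ordered simplex. -/
def faces : List α → List (List α)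
  | [] => []
  | a :: l => l :: (faces l).map (List.cons a)

/-- The value of a mod 2 cochain on a mod 2 chain, given as a list of ordered simplices. -/
def eval (c : List (List α)) (f : List α → ZMod 2) : ZMod 2 := (c.map f).sum

/-- The coboundary of a mod 2 cochain. -/
def cobd (f : List α → ZMod 2) (l : List α) : ZMod 2 := eval (faces l) f

@[simp] lemma eval_nil (f : List α → ZMod 2) : eval [] f = 0 := rfl

@[simp] lemma eval_cons (l : List α) (c : List (List α)) (f : List α → ZMod 2) :
    eval (l :: c) f = f l + eval c f := by simp [eval]

@[simp] lemma eval_append (c c' : List (List α)) (f : List α → ZMod 2) :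
    eval (c ++ c') f = eval c f + eval c' f := by simp [eval]

lemma eval_map (g : List α → List β) (c : List (List α)) (f : List β → ZMod 2) :
    eval (c.map g) f = eval c (fun l => f (g l)) := by
  simp [eval, Function.comp_def]

lemma eval_flatMap (g : List α → List (List β)) (c : List (List α)) (f : List β → ZMod 2) :
    eval (c.flatMap g) f = eval c (fun l => eval (g l) f) := by
  induction c with
  | nil => rfl
  | cons l c ih => simp [ih]

lemma eval_add (c : List (List α)) (f g : List α → ZMod 2) :
    eval c (fun l => f l + g l) = eval c f + eval c g := by
  simp [eval, List.sum_map_add]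

@[simp] lemma eval_zero (c : List (List α)) : eval c (fun _ => 0) = 0 := by simp [eval]

lemma eval_mul_left (c : List (List α)) (r : ZMod 2) (f : List α → ZMod 2) :
    eval c (fun l => r * f l) = r * eval c f := by
  simp [eval, List.sum_map_mul_left]

lemma eval_congr {c : List (List α)} {f g : List α → ZMod 2} (h : ∀ l ∈ c, f l = g l) :
    eval c f = eval c g := by
  unfold eval
  rw [List.map_congr_left h]

lemma eval_eq_zero {c : List (List α)} {f : List α → ZMod 2} (h : ∀ l ∈ c, f l = 0) :
    eval c f = 0 := by
  rw [eval_congr h, eval_zero]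

lemma exists_ne_zero_of_eval_ne_zero {c : List (List α)} {f : List α → ZMod 2}
    (h : eval c f ≠ 0) : ∃ l ∈ c, f l ≠ 0 := by
  by_contra! H
  exact h (eval_eq_zero H)

lemma eval_comm (c : List (List α)) (c' : List (List β)) (F : List α → List β → ZMod 2) :
    eval c (fun l => eval c' (F l)) = eval c' (fun l' => eval c (fun l => F l l')) := by
  induction c with
  | nil => simp
  | cons l c ih => simp [ih, eval_add]

@[simp] lemma cobd_nil (f : List α → ZMod 2) : cobd f [] = 0 := rfl

lemma cobd_cons (f : List α → ZMod 2) (a : α) (l : List α) :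
    cobd f (a :: l) = f l + cobd (fun l' => f (a :: l')) l := by
  simp [cobd, faces, eval_map]

lemma cobd_singleton (f : List α → ZMod 2) (a : α) : cobd f [a] = f [] := by
  simp [cobd_cons]

lemma cobd_pair (f : List α → ZMod 2) (a b : α) : cobd f [a, b] = f [b] + f [a] := by
  simp [cobd_cons]

lemma cobd_add (f g : List α → ZMod 2) (l : List α) :
    cobd (fun l' => f l' + g l') l = cobd f l + cobd g l := eval_add _ _ _

@[simp] lemma cobd_zero (l : List α) : cobd (fun _ => 0) l = 0 := eval_zero _

lemma cobd_mul_left (r : ZMod 2) (f : List α → ZMod 2) (l : List α) :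
    cobd (fun l' => r * f l') l = r * cobd f l := eval_mul_left _ _ _

lemma cobd_congr {l : List α} {f g : List α → ZMod 2} (h : ∀ l' ∈ faces l, f l' = g l') :
    cobd f l = cobd g l := eval_congr h

lemma cobd_comm (F : List α → List β → ZMod 2) (l : List α) (l' : List β) :
    cobd (fun s => cobd (F s) l') l = cobd (fun t => cobd (fun s => F s t) l) l' :=
  eval_comm _ _ _

lemma cobd_cobd (f : List α → ZMod 2) (l : List α) : cobd (cobd f) l = 0 := by
  induction l generalizing f with
  | nil => rfl
  | cons a l ih =>
    simp only [cobd_cons, cobd_add, ih, add_zero]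
    exact CharTwo.add_self_eq_zero _

lemma sublist_of_mem_faces {l l' : List α} (h : l' ∈ faces l) : l'.Sublist l := by
  induction l generalizing l' with
  | nil => simp [faces] at h
  | cons a l ih =>
    simp only [faces, List.mem_cons, List.mem_map] at h
    rcases h with rfl | ⟨s, hs, rfl⟩
    · exact List.sublist_cons_self _ _
    · exact (ih hs).cons_cons a

lemma length_of_mem_faces {l l' : List α} (h : l' ∈ faces l) : l'.length + 1 = l.length := by
  induction l generalizing l' with
  | nil => simp [faces] at h
  | cons a l ih =>
    simp only [faces, List.mem_cons, List.mem_map] at h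
    rcases h with rfl | ⟨s, hs, rfl⟩
    · simp
    · simp [ih hs]

lemma length_faces (l : List α) : (faces l).length = l.length := by
  induction l with
  | nil => rfl
  | cons a l ih => simp [faces, ih]

lemma faces_map (g : α → β) (l : List α) : faces (l.map g) = (faces l).map (List.map g) := by
  induction l with
  | nil => rfl
  | cons a l ih => simp [faces, ih, Function.comp_def]

lemma cobd_map (g : α → β) (f : List β → ZMod 2) (l : List α) :
    cobd f (l.map g) = cobd (fun l' => f (l'.map g)) l := by
  simp [cobd, faces_map, eval_map]

/-- The cup product of an `r`-cochain `h` with a cochain `f`. -/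
def cup : ℕ → (List α → ZMod 2) → (List α → ZMod 2) → List α → ZMod 2
  | _, _, _, [] => 0
  | 0, h, f, a :: l => h [a] * f (a :: l)
  | r + 1, h, f, a :: l => cup r (fun l' => h (a :: l')) f l

@[simp] lemma cup_nil (r : ℕ) (h f : List α → ZMod 2) : cup r h f [] = 0 := by
  cases r <;> simp [cup]

lemma cup_add_left (r : ℕ) (h h' f : List α → ZMod 2) (l : List α) :
    cup r (fun l' => h l' + h' l') f l = cup r h f l + cup r h' f l := by
  induction r generalizing h h' l with
  | zero => cases l <;> simp [cup, add_mul]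
  | succ r ih => cases l <;> simp [cup, ih]

lemma cup_map (g : α → β) (r : ℕ) (h f : List β → ZMod 2) (l : List α) :
    cup r h f (l.map g) = cup r (fun l' => h (l'.map g)) (fun l' => f (l'.map g)) l := by
  induction r generalizing h l with
  | zero => cases l <;> simp [cup]
  | succ r ih => cases l <;> simp [cup, ih]

lemma cup_congr {r : ℕ} {h h' f f' : List α → ZMod 2} {l : List α}
    (hh : ∀ l', l'.Sublist l → l'.length = r + 1 → h l' = h' l')
    (hf : ∀ l', l'.Sublist l → l'.length + r = l.length → f l' = f' l') :
    cup r h f l = cup r h' f' l := by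
  induction r generalizing h h' l with
  | zero =>
    cases l with
    | nil => simp
    | cons a l => simp [cup, hh [a] (by simp) rfl, hf (a :: l) (List.Sublist.refl _) rfl]
  | succ r ih =>
    cases l with
    | nil => simp
    | cons a l =>
      simp only [cup]
      refine ih (fun s hs hl => hh _ (hs.cons_cons a) (by simp [hl])) (fun s hs hl => ?_)
      exact hf s (hs.cons a) (by simp; omega)

lemma exists_of_cup_ne_zero {r : ℕ} {h f : List α → ZMod 2} {l : List α} (H : cup r h f l ≠ 0) :
    (∃ l', l'.Sublist l ∧ l'.length = r + 1 ∧ h l' ≠ 0) ∧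
      ∃ l', l'.Sublist l ∧ l'.length + r = l.length ∧ f l' ≠ 0 := by
  constructor
  · by_contra! H'
    refine H ((cup_congr (h' := fun _ => 0) (f' := f) H' fun _ _ _ => rfl).trans ?_)
    clear H H'
    induction r generalizing l with
    | zero => cases l <;> simp [cup]
    | succ r ih => cases l <;> simp [cup, ih]
  · by_contra! H'
    refine H ((cup_congr (h' := h) (f' := fun _ => 0) (fun _ _ _ => rfl) H').trans ?_)
    clear H H'
    induction r generalizing h l with
    | zero => cases l <;> simp [cup]
    | succ r ih => cases l <;> simp [cup, ih]

lemma cobd_cup (r : ℕ) (h f : List α → ZMod 2) (l : List α) (hl : r + 2 ≤ l.length) :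
    cobd (cup r h f) l = cup (r + 1) (cobd h) f l + cup r h (cobd f) l := by
  induction r generalizing h l with
  | zero =>
    match l, hl with
    | a :: b :: l, _ =>
      rw [cobd_cons]
      have : cobd (fun l' => cup 0 h f (a :: l')) (b :: l)
          = h [a] * cobd (fun l' => f (a :: l')) (b :: l) := by
        simp only [cup]
        exact cobd_mul_left _ _ _
      rw [this]
      simp only [cup, cobd_pair, cobd_cons f a]
      linear_combination (- h [a] * f (b :: l)) * (CharTwo.two_eq_zero : (2 : ZMod 2) = 0)
  | succ r ih =>
    match l, hl with
    | a :: l, hl =>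
      rw [cobd_cons]
      have e : (fun l' => cup (r + 1) h f (a :: l')) = cup r (fun l' => h (a :: l')) f := by
        funext l'; simp [cup]
      rw [e, ih _ _ (by simpa using hl)]
      have e' : cup (r + 1 + 1) (cobd h) f (a :: l)
          = cup (r + 1) h f l + cup (r + 1) (cobd fun l' => h (a :: l')) f l := by
        rw [← cup_add_left]
        simp only [cup, cobd_cons h a]
      rw [e']
      simp only [cup]
      ring

/-- The staircase paths from the first to the last cell of the grid spanned by two lists: the
simplices of the standard triangulation of a product of two simplices. -/
def staircases : List α → List β → List (List (α × β))
  | [], _ => []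
  | _ :: _, [] => []
  | [a], [b] => [[(a, b)]]
  | [a], b :: b' :: t => (staircases [a] (b' :: t)).map (List.cons (a, b))
  | a :: a' :: s, [b] => (staircases (a' :: s) [b]).map (List.cons (a, b))
  | a :: a' :: s, b :: b' :: t =>
    (staircases (a' :: s) (b :: b' :: t) ++ staircases (a :: a' :: s) (b' :: t)).map
      (List.cons (a, b))
termination_by s t => s.length + t.length

/-- The pullback of a cochain on pairs to a two-variable cochain. -/
def shuffle (f : List (α × β) → ZMod 2) (s : List α) (t : List β) : ZMod 2 :=
  eval (staircases s t) f

@[simp] lemma shuffle_nil_left (f : List (α × β) → ZMod 2) (t : List β) : shuffle f [] t = 0 := by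
  simp [shuffle, staircases]

@[simp] lemma shuffle_nil_right (f : List (α × β) → ZMod 2) (s : List α) :
    shuffle f s [] = 0 := by
  cases s <;> simp [shuffle, staircases]

lemma shuffle_singleton (f : List (α × β) → ZMod 2) (a : α) (b : β) :
    shuffle f [a] [b] = f [(a, b)] := by
  simp [shuffle, staircases]

lemma shuffle_cons_cons (f : List (α × β) → ZMod 2) (a : α) (s : List α) (b : β) (t : List β)
    (h : s ≠ [] ∨ t ≠ []) :
    shuffle f (a :: s) (b :: t) = shuffle (fun l => f ((a, b) :: l)) s (b :: t)
      + shuffle (fun l => f ((a, b) :: l)) (a :: s) t := by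
  match s, t with
  | [], [] => simp at h
  | [], b' :: t => simp [shuffle, staircases, eval_map]
  | a' :: s, [] => simp [shuffle, staircases, eval_map]
  | a' :: s, b' :: t => simp only [shuffle, staircases, eval_map, eval_append]

lemma shuffle_add (f g : List (α × β) → ZMod 2) (s : List α) (t : List β) :
    shuffle (fun l => f l + g l) s t = shuffle f s t + shuffle g s t := eval_add _ _ _

lemma mem_staircases {s : List α} {t : List β} {l : List (α × β)} (h : l ∈ staircases s t) :
    l.length + 1 = s.length + t.length ∧ ∀ x ∈ l, x.1 ∈ s ∧ x.2 ∈ t := by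
  fun_induction staircases s t generalizing l with
  | case1 => simp at h
  | case2 => simp at h
  | case3 a b => simp at h; subst h; simp
  | case4 a b b' t ih =>
    simp only [List.mem_map] at h
    obtain ⟨l', hl', rfl⟩ := h
    obtain ⟨h1, h2⟩ := ih hl'
    refine ⟨by simp at h1 ⊢; omega, ?_⟩
    intro x hx
    rcases List.mem_cons.1 hx with rfl | hx
    · simp
    · exact ⟨(h2 x hx).1, List.mem_cons_of_mem _ (h2 x hx).2⟩
  | case5 a a' s b ih =>
    simp only [List.mem_map] at h
    obtain ⟨l', hl', rfl⟩ := h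
    obtain ⟨h1, h2⟩ := ih hl'
    refine ⟨by simp at h1 ⊢; omega, ?_⟩
    intro x hx
    rcases List.mem_cons.1 hx with rfl | hx
    · simp
    · exact ⟨List.mem_cons_of_mem _ (h2 x hx).1, (h2 x hx).2⟩
  | case6 a a' s b b' t ih1 ih2 =>
    simp only [List.mem_map, List.mem_append] at h
    obtain ⟨l', hl' | hl', rfl⟩ := h
    · obtain ⟨h1, h2⟩ := ih1 hl'
      refine ⟨by simp at h1 ⊢; omega, ?_⟩
      intro x hx
      rcases List.mem_cons.1 hx with rfl | hx
      · simp
      · exact ⟨List.mem_cons_of_mem _ (h2 x hx).1, (h2 x hx).2⟩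
    · obtain ⟨h1, h2⟩ := ih2 hl'
      refine ⟨by simp at h1 ⊢; omega, ?_⟩
      intro x hx
      rcases List.mem_cons.1 hx with rfl | hx
      · simp
      · exact ⟨(h2 x hx).1, List.mem_cons_of_mem _ (h2 x hx).2⟩

lemma shuffle_singleton_left (f : List (α × β) → ZMod 2) (a : α) (t : List β) (ht : t ≠ []) :
    shuffle f [a] t = f (t.map (Prod.mk a)) := by
  induction t generalizing f with
  | nil => simp at ht
  | cons b t ih =>
    cases t with
    | nil => simp [shuffle_singleton]
    | cons b' t => rw [shuffle_cons_cons _ _ _ _ _ (by simp), ih _ (by simp)]; simp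

lemma shuffle_singleton_right (f : List (α × β) → ZMod 2) (s : List α) (b : β) (hs : s ≠ []) :
    shuffle f s [b] = f (s.map (fun a => (a, b))) := by
  induction s generalizing f with
  | nil => simp at hs
  | cons a s ih =>
    cases s with
    | nil => simp [shuffle_singleton]
    | cons a' s => rw [shuffle_cons_cons _ _ _ _ _ (by simp), ih _ (by simp)]; simp

lemma staircases_map {α' β' : Type*} (g : α → α') (h : β → β') (s : List α) (t : List β) :
    staircases (s.map g) (t.map h) = (staircases s t).map (List.map (Prod.map g h)) := by
  fun_induction staircases s t <;> simp_all [staircases, Function.comp_def]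

lemma shuffle_map_left (f : List (γ × β) → ZMod 2) (g : α → γ) (s : List α) (t : List β) :
    shuffle f (s.map g) t = shuffle (fun l => f (l.map (Prod.map g id))) s t := by
  have := staircases_map g id s t
  rw [List.map_id] at this
  rw [shuffle, this, eval_map, shuffle]

lemma shuffle_cobd_aux (f : List (α × β) → ZMod 2) (s : List α) (t : List β) (hs : s ≠ [])
    (ht : t ≠ []) :
    shuffle (cobd f) s t = cobd (fun s' => shuffle f s' t) s + cobd (shuffle f s) t
      + if s.length = 1 ∧ t.length = 1 then f [] else 0 := by
  have two : (2 : ZMod 2) = 0 := CharTwo.two_eq_zero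
  match s, t, hs, ht with
  | [a], [b], _, _ => simp [shuffle_singleton, cobd_singleton]
  | [a], b :: b' :: t, _, _ =>
    rw [shuffle_singleton_left _ _ _ (by simp), cobd_map, cobd_singleton]
    rw [cobd_congr (g := shuffle f [a])]
    · simp
    · intro l' hl'
      rw [shuffle_singleton_left]
      rintro rfl
      simpa using length_of_mem_faces hl'
  | a :: a' :: s, [b], _, _ =>
    rw [shuffle_singleton_right _ _ _ (by simp), cobd_map, cobd_singleton]
    rw [cobd_congr (g := fun s' => shuffle f s' [b])]
    · simp
    · intro l' hl'
      rw [shuffle_singleton_right]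
      rintro rfl
      simpa using length_of_mem_faces hl'
  | a :: a' :: s, b :: b' :: t, _, _ =>
    set vs := a' :: s with hvs
    set ps := b' :: t with hps
    have hvs0 : vs ≠ [] := by simp [vs]
    have hps0 : ps ≠ [] := by simp [ps]
    set fa : List (α × β) → ZMod 2 := fun l => f ((a, b) :: l) with hfa
    have e1 : (fun l => cobd f ((a, b) :: l)) = fun l => f l + cobd fa l := by
      funext l; rw [cobd_cons]
    rw [shuffle_cons_cons _ _ _ _ _ (Or.inl hvs0), e1, shuffle_add, shuffle_add,
      shuffle_cobd_aux fa vs (b :: ps) hvs0 (by simp),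
      shuffle_cobd_aux fa (a :: vs) ps (by simp) hps0]
    have e2 : cobd (fun s' => shuffle f s' (b :: ps)) (a :: vs)
        = shuffle f vs (b :: ps) + (cobd (fun s' => shuffle fa s' (b :: ps)) vs
          + cobd (fun s' => shuffle fa (a :: s') ps) vs) := by
      rw [cobd_cons, ← cobd_add]
      congr 2
      funext s'
      rw [shuffle_cons_cons _ _ _ _ _ (Or.inr hps0)]
    have e3 : cobd (shuffle f (a :: vs)) (b :: ps)
        = shuffle f (a :: vs) ps + (cobd (fun t' => shuffle fa vs (b :: t')) ps
          + cobd (fun t' => shuffle fa (a :: vs) t') ps) := by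
      rw [cobd_cons, ← cobd_add]
      congr 2
      funext t'
      rw [shuffle_cons_cons _ _ _ _ _ (Or.inl hvs0)]
    rw [e2, e3, cobd_cons (shuffle fa vs) b ps, cobd_cons (fun s' => shuffle fa s' ps) a vs]
    have l1 : ¬ (vs.length = 1 ∧ (b :: ps).length = 1) := by simp [ps]
    have l2 : ¬ ((a :: vs).length = 1 ∧ ps.length = 1) := by simp [vs]
    have l3 : ¬ ((a :: vs).length = 1 ∧ (b :: ps).length = 1) := by simp [vs]
    rw [if_neg l1, if_neg l2, if_neg l3]
    linear_combination (shuffle fa vs ps) * two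
termination_by s.length + t.length

lemma shuffle_cobd (f : List (α × β) → ZMod 2) (s : List α) (t : List β) (hs : s ≠ [])
    (ht : t ≠ []) (h : s.length + t.length ≠ 2 ∨ f [] = 0) :
    shuffle (cobd f) s t = cobd (fun s' => shuffle f s' t) s + cobd (shuffle f s) t := by
  rw [shuffle_cobd_aux f s t hs ht]
  split_ifs with h'
  · rcases h with h | h
    · omega
    · rw [h, add_zero]
  · rw [add_zero]

end ListCochain

/-! ### Barycentric subdivision and fine antipodal chains on spheres -/

namespace ListCochain

section Subdivision

variable {E : Type*} [AddCommGroup E] [Module ℝ E]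

/-- The barycenter of a list of points. -/
noncomputable def barycenter (l : List E) : E := (l.length : ℝ)⁻¹ • l.sum

/-- The barycentric subdivision of an ordered `k`-simplex. -/
noncomputable def subdiv : ℕ → List E → List (List E)
  | 0, l => [l]
  | k + 1, l => (faces l).flatMap fun s => (subdiv k s).map (List.cons (barycenter l))

lemma eval_subdiv_succ (k : ℕ) (l : List E) (f : List E → ZMod 2) :
    eval (subdiv (k + 1) l) f
      = cobd (fun s => eval (subdiv k s) (fun t => f (barycenter l :: t))) l := by
  simp only [subdiv, eval_flatMap, eval_map, cobd]

lemma eval_subdiv_cobd (k : ℕ) (l : List E) (hl : l.length = k + 2) (f : List E → ZMod 2) :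
    eval (subdiv (k + 1) l) (cobd f) = cobd (fun s => eval (subdiv k s) f) l := by
  induction k generalizing l f with
  | zero =>
    match l, hl with
    | [a, b], _ =>
      rw [eval_subdiv_succ]
      simp only [subdiv, eval_cons, eval_nil, cobd_cons, cobd_nil, add_zero]
      linear_combination (f [barycenter [a, b]]) * (CharTwo.two_eq_zero : (2 : ZMod 2) = 0)
  | succ k ih =>
    rw [eval_subdiv_succ]
    simp only [cobd_cons, eval_add, cobd_add]
    rw [cobd_congr (f := fun s => eval (subdiv (k + 1) s)
      (fun t => cobd (fun l' => f (barycenter l :: l')) t))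
      (g := cobd fun s => eval (subdiv k s) (fun l' => f (barycenter l :: l'))),
      cobd_cobd, add_zero]
    intro s hs
    have := length_of_mem_faces hs
    exact ih s (by omega) _

lemma length_of_mem_subdiv {k : ℕ} {l l' : List E} (hl : l.length = k + 1)
    (h : l' ∈ subdiv k l) : l'.length = k + 1 := by
  induction k generalizing l l' with
  | zero => simp [subdiv] at h; simp [h, hl]
  | succ k ih =>
    simp only [subdiv, List.mem_flatMap, List.mem_map] at h
    obtain ⟨s, hs, t, ht, rfl⟩ := h
    have := length_of_mem_faces hs
    simp [ih (by omega) ht]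

lemma barycenter_map (g : E →ₗ[ℝ] E) (l : List E) :
    barycenter (l.map g) = g (barycenter l) := by
  simp [barycenter, List.sum_hom]

lemma subdiv_map (g : E →ₗ[ℝ] E) (k : ℕ) (l : List E) :
    subdiv k (l.map g) = (subdiv k l).map (List.map g) := by
  induction k generalizing l with
  | zero => rfl
  | succ k ih =>
    simp [subdiv, faces_map, barycenter_map, List.flatMap_map, List.map_flatMap, ih,
      Function.comp_def]

lemma barycenter_mem {C : Set E} (hC : Convex ℝ C) {l : List E} (hl : l ≠ [])
    (h : ∀ x ∈ l, x ∈ C) : barycenter l ∈ C := by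
  have e : barycenter l = ∑ i : Fin l.length, (l.length : ℝ)⁻¹ • l.get i := by
    rw [barycenter, ← Finset.smul_sum]
    congr 1
    conv_lhs => rw [← List.ofFn_get l, List.sum_ofFn]
  rw [e]
  have hpos : 0 < l.length := List.length_pos_iff.2 hl
  refine hC.sum_mem (fun _ _ => by positivity) ?_ (fun i _ => h _ (List.get_mem _ _))
  simp only [Finset.sum_const, Finset.card_univ, Fintype.card_fin, nsmul_eq_mul]
  field_simp

lemma mem_of_mem_subdiv {C : Set E} (hC : Convex ℝ C) {k : ℕ} {l l' : List E}
    (hl : l.length = k + 1) (h : ∀ x ∈ l, x ∈ C) (hl' : l' ∈ subdiv k l) : ∀ x ∈ l', x ∈ C := by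
  induction k generalizing l l' with
  | zero => simp [subdiv] at hl'; simpa [hl'] using h
  | succ k ih =>
    simp only [subdiv, List.mem_flatMap, List.mem_map] at hl'
    obtain ⟨s, hs, t, ht, rfl⟩ := hl'
    have := length_of_mem_faces hs
    intro x hx
    rcases List.mem_cons.1 hx with rfl | hx
    · exact barycenter_mem hC (by rintro rfl; simp at hl) h
    · exact ih (by omega) (fun y hy => h y ((sublist_of_mem_faces hs).subset hy)) ht x hx

end Subdivision

lemma dist_barycenter_le {E : Type*} [NormedAddCommGroup E] [NormedSpace ℝ E] {l : List E}
    {k : ℕ} (hl : l.length = k + 1) {D : ℝ} (h : ∀ x ∈ l, ∀ y ∈ l, dist x y ≤ D) {v : E}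
    (hv : v ∈ l) : dist v (barycenter l) ≤ k / (k + 1) * D := by
  obtain ⟨i, rfl⟩ := List.mem_iff_get.1 hv
  have hsum : l.sum = ∑ j, l.get j := by
    conv_lhs => rw [← List.ofFn_get l, List.sum_ofFn]
  have hk : (l.length : ℝ) = k + 1 := by rw [hl]; push_cast; ring
  have e : l.get i - barycenter l
      = ∑ j ∈ Finset.univ.erase i, (l.length : ℝ)⁻¹ • (l.get i - l.get j) := by
    rw [Finset.sum_erase _ (by simp), ← Finset.smul_sum, Finset.sum_sub_distrib, ← hsum,
      Finset.sum_const, Finset.card_univ, Fintype.card_fin, smul_sub, barycenter,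
      ← Nat.cast_smul_eq_nsmul ℝ, inv_smul_smul₀]
    rw [hk]; positivity
  rw [dist_eq_norm, e]
  refine (norm_sum_le_of_le (n := fun _ => (l.length : ℝ)⁻¹ * D) _ fun j _ => ?_).trans_eq ?_
  · rw [norm_smul, norm_inv, Real.norm_natCast, ← dist_eq_norm]
    exact mul_le_mul_of_nonneg_left (h _ (List.get_mem _ _) _ (List.get_mem _ _)) (by positivity)
  · rw [Finset.sum_const, Finset.card_erase_of_mem (Finset.mem_univ _), Finset.card_univ,
      Fintype.card_fin, nsmul_eq_mul, hk, hl, Nat.add_sub_cancel]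
    ring

lemma dist_le_of_mem_subdiv {E : Type*} [NormedAddCommGroup E] [NormedSpace ℝ E] {k : ℕ}
    {l l' : List E} (hl : l.length = k + 1) {D : ℝ} (h : ∀ x ∈ l, ∀ y ∈ l, dist x y ≤ D)
    (hl' : l' ∈ subdiv k l) : ∀ x ∈ l', ∀ y ∈ l', dist x y ≤ k / (k + 1) * D := by
  induction k generalizing l l' with
  | zero =>
    match l, hl with
    | [a], _ =>
      simp [subdiv] at hl'
      simp [hl']
  | succ k ih =>
    have hD : 0 ≤ D := by
      match l, hl with
      | a :: l, _ => simpa using h a (by simp) a (by simp)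
    have hl0 := hl'
    simp only [subdiv, List.mem_flatMap, List.mem_map] at hl'
    obtain ⟨s, hs, t, ht, rfl⟩ := hl'
    have hlen := length_of_mem_faces hs
    have hsub := (sublist_of_mem_faces hs).subset
    have hb : ∀ x ∈ t, dist x (barycenter l) ≤ ((k + 1 : ℕ) : ℝ) / ((k + 1 : ℕ) + 1) * D := by
      intro x hx
      exact mem_of_mem_subdiv (convex_closedBall (barycenter l) _) (k := k) (by omega)
        (fun y hy => dist_barycenter_le hl h (hsub hy)) ht x hx
    have hmono : (k : ℝ) / (k + 1) * D ≤ ((k + 1 : ℕ) : ℝ) / ((k + 1 : ℕ) + 1) * D := by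
      refine mul_le_mul_of_nonneg_right ?_ hD
      push_cast
      rw [div_le_div_iff₀ (by positivity) (by positivity)]
      nlinarith
    intro x hx y hy
    rcases List.mem_cons.1 hx with rfl | hx <;> rcases List.mem_cons.1 hy with rfl | hy
    · rw [dist_self]; positivity
    · rw [dist_comm]; exact hb _ hy
    · exact hb _ hx
    · exact (ih (by omega) (fun u hu w hw => h u (hsub hu) w (hsub hw)) ht x hx y hy).trans hmono

section Spheres

variable {E : Type*} [AddCommGroup E]

/-- The simplices of the boundary of the cross-polytope with vertices `± e i`, `i < k`. -/
def crossPolytope (e : ℕ → E) : ℕ → List (List E)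
  | 0 => [[]]
  | k + 1 => (crossPolytope e k).map (List.cons (e k)) ++
      (crossPolytope e k).map (List.cons (-e k))

lemma eval_crossPolytope_succ (e : ℕ → E) (k : ℕ) (f : List E → ZMod 2) :
    eval (crossPolytope e (k + 1)) f = eval (crossPolytope e k) (fun l => f (e k :: l))
      + eval (crossPolytope e k) (fun l => f (-e k :: l)) := by
  simp [crossPolytope, eval_map]

lemma eval_crossPolytope_cobd (e : ℕ → E) (k : ℕ) (f : List E → ZMod 2) :
    eval (crossPolytope e k) (cobd f) = 0 := by
  induction k generalizing f with
  | zero => simp [crossPolytope]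
  | succ k ih =>
    simp only [eval_crossPolytope_succ, cobd_cons, eval_add, ih, add_zero]
    exact CharTwo.add_self_eq_zero _

lemma eval_crossPolytope_neg (e : ℕ → E) (k : ℕ) (f : List E → ZMod 2) :
    eval (crossPolytope e k) (fun l => f (l.map Neg.neg)) = eval (crossPolytope e k) f := by
  induction k generalizing f with
  | zero => simp [crossPolytope]
  | succ k ih =>
    simp only [eval_crossPolytope_succ, List.map_cons, neg_neg]
    rw [ih (fun l => f (-e k :: l)), ih (fun l => f (e k :: l)), add_comm]

/-- The simplices of a hemisphere of the boundary of the cross-polytope. -/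
def hemisphere (e : ℕ → E) (k : ℕ) : List (List E) :=
  (crossPolytope e k).map (List.cons (e k))

lemma eval_hemisphere_cobd (e : ℕ → E) (k : ℕ) (f : List E → ZMod 2) :
    eval (hemisphere e (k + 1)) (cobd f)
      = eval (hemisphere e k) (fun l => f l + f (l.map Neg.neg)) := by
  simp only [hemisphere, eval_map, cobd_cons, eval_add, List.map_cons]
  rw [eval_crossPolytope_cobd, add_zero, eval_crossPolytope_succ,
    eval_crossPolytope_neg e k (fun l => f (-e k :: l))]

lemma exists_sign_of_mem_crossPolytope {e : ℕ → E} {k : ℕ} {l : List E}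
    (h : l ∈ crossPolytope e k) :
    l.length = k ∧ ∃ s : ℕ → ℤˣ, ∀ x ∈ l, ∃ i < k, x = (s i : ℤ) • e i := by
  induction k generalizing l with
  | zero => simp [crossPolytope] at h; simp [h]
  | succ k ih =>
    have key : ∀ (u : ℤˣ) (t : List E), t ∈ crossPolytope e k → l = ((u : ℤ) • e k) :: t →
        l.length = k + 1 ∧ ∃ s : ℕ → ℤˣ, ∀ x ∈ l, ∃ i < k + 1, x = (s i : ℤ) • e i := by
      rintro u t ht rfl
      obtain ⟨h1, s, hs⟩ := ih ht
      refine ⟨by simp [h1], Function.update s k u, fun x hx => ?_⟩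
      rcases List.mem_cons.1 hx with rfl | hx
      · exact ⟨k, by simp, by simp⟩
      · obtain ⟨i, hi, rfl⟩ := hs x hx
        exact ⟨i, by omega, by rw [Function.update_of_ne hi.ne]⟩
    simp only [crossPolytope, List.mem_append, List.mem_map] at h
    rcases h with ⟨t, ht, rfl⟩ | ⟨t, ht, rfl⟩
    · exact key 1 t ht (by simp)
    · exact key (-1) t ht (by simp)

end Spheres

/-- Arbitrarily fine chains on the unit sphere of the `ℓ¹` norm on `ℝ^(d+1)` whose `k`-th
member triangulates a hemisphere of dimension `k`. -/
theorem exists_fine_hemispheres (d : ℕ) {δ : ℝ} (hδ : 0 < δ) :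
    ∃ C : ℕ → List (List (Fin (d + 1) → ℝ)),
      (∃ w, C 0 = [[w]]) ∧
      (∀ k ≤ d, ∀ l ∈ C k, l.length = k + 1 ∧ (∀ x ∈ l, ∑ i, |x i| = 1) ∧
        ∀ x ∈ l, ∀ y ∈ l, dist x y < δ) ∧
      ∀ k < d, ∀ f, eval (C (k + 1)) (cobd f)
        = eval (C k) (fun l => f l + f (l.map Neg.neg)) := by
  let cell : (Fin (d + 1) → ℤˣ) → Set (Fin (d + 1) → ℝ) := fun s =>
    {x | ∑ i, ((s i : ℤ) : ℝ) * x i = 1 ∧ ∀ i, 0 ≤ ((s i : ℤ) : ℝ) * x i}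
  have hcell : ∀ s, Convex ℝ (cell s) := by
    intro s x hx y hy a b ha hb hab
    refine ⟨?_, fun i => ?_⟩
    · have : ∑ i, ((s i : ℤ) : ℝ) * (a • x + b • y) i
          = a * ∑ i, ((s i : ℤ) : ℝ) * x i + b * ∑ i, ((s i : ℤ) : ℝ) * y i := by
        rw [Finset.mul_sum, Finset.mul_sum, ← Finset.sum_add_distrib]
        refine Finset.sum_congr rfl fun i _ => ?_
        simp; ring
      rw [this, hx.1, hy.1]; linarith
    · have := mul_nonneg ha (hx.2 i)
      have := mul_nonneg hb (hy.2 i)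
      simp; nlinarith
  have hcell' : ∀ s, ∀ x ∈ cell s, ∑ i, |x i| = 1 := by
    intro s x hx
    rw [← hx.1]
    refine Finset.sum_congr rfl fun i _ => ?_
    have h0 := hx.2 i
    rcases Int.units_eq_one_or (s i) with h | h <;> simp only [h] at h0 ⊢ <;> simp at h0 ⊢
    · exact h0
    · exact h0
  have main : ∀ N : ℕ, ∃ C : ℕ → List (List (Fin (d + 1) → ℝ)), (∃ w, C 0 = [[w]]) ∧
      (∀ k ≤ d, ∀ l ∈ C k, l.length = k + 1 ∧ (∃ s, ∀ x ∈ l, x ∈ cell s) ∧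
        ∀ x ∈ l, ∀ y ∈ l, dist x y ≤ ((d : ℝ) / (d + 1)) ^ N * 2) ∧
      ∀ k < d, ∀ f, eval (C (k + 1)) (cobd f)
        = eval (C k) (fun l => f l + f (l.map Neg.neg)) := by
    intro N
    induction N with
    | zero =>
      let e : ℕ → Fin (d + 1) → ℝ := fun k i => if (i : ℕ) = k then 1 else 0
      refine ⟨hemisphere e, ⟨e 0, by simp [hemisphere, crossPolytope]⟩, ?_,
        fun k _ f => eval_hemisphere_cobd e k f⟩
      intro k hk l hl
      have hl' : l ∈ crossPolytope e (k + 1) := by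
        simp only [crossPolytope, List.mem_append]
        exact Or.inl hl
      obtain ⟨h1, s, hs⟩ := exists_sign_of_mem_crossPolytope hl'
      have hmem : ∀ x ∈ l, x ∈ cell fun i => s i := by
        intro x hx
        obtain ⟨i, hi, rfl⟩ := hs x hx
        have hterm : ∀ j : Fin (d + 1), ((s j : ℤ) : ℝ) * ((s i : ℤ) • e i) j
            = if j = (⟨i, by omega⟩ : Fin (d + 1)) then 1 else 0 := by
          intro j
          have : (j = (⟨i, by omega⟩ : Fin (d + 1))) ↔ (j : ℕ) = i := by
            rw [Fin.ext_iff]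
          by_cases hj : (j : ℕ) = i
          · rw [if_pos (this.2 hj), hj]
            simp only [Pi.smul_apply, e, if_pos hj]
            rcases Int.units_eq_one_or (s i) with h | h <;> simp [h]
          · rw [if_neg (fun h => hj (this.1 h))]
            simp [e, hj]
        refine ⟨?_, fun j => ?_⟩
        · simp only [hterm]; simp
        · rw [hterm]; split_ifs <;> norm_num
      refine ⟨h1, ⟨_, hmem⟩, ?_⟩
      intro x hx y hy
      have hb : ∀ z ∈ l, ‖z‖ ≤ 1 := by
        intro z hz
        rw [pi_norm_le_iff_of_nonneg zero_le_one]
        intro i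
        rw [← hcell' _ z (hmem z hz), Real.norm_eq_abs]
        exact Finset.single_le_sum (f := fun i => |z i|) (fun i _ => abs_nonneg _)
          (Finset.mem_univ i)
      have := dist_le_norm_add_norm x y
      have := hb x hx
      have := hb y hy
      simp; linarith
    | succ N ih =>
      obtain ⟨C, ⟨w, hw⟩, hC, hbd⟩ := ih
      refine ⟨fun k => (C k).flatMap (subdiv k), ⟨w, by simp [hw, subdiv]⟩, ?_, ?_⟩
      · intro k hk l hl
        obtain ⟨t, ht, hl⟩ := List.mem_flatMap.1 hl
        obtain ⟨h1, ⟨s, hs⟩, h3⟩ := hC k hk t ht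
        refine ⟨length_of_mem_subdiv h1 hl, ⟨s, mem_of_mem_subdiv (hcell s) h1 hs hl⟩, ?_⟩
        intro x hx y hy
        refine (dist_le_of_mem_subdiv h1 h3 hl x hx y hy).trans ?_
        rw [pow_succ', mul_assoc]
        refine mul_le_mul_of_nonneg_right ?_ (by positivity)
        rw [div_le_div_iff₀ (by positivity) (by positivity)]
        have : (k : ℝ) ≤ d := by exact_mod_cast hk
        nlinarith
      · intro k hk f
        simp only [eval_flatMap]
        rw [eval_congr (g := cobd fun s => eval (subdiv k s) f)
          (fun l hl => eval_subdiv_cobd k l (hC (k + 1) hk l hl).1 f), hbd k hk]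
        refine eval_congr fun l _ => ?_
        have := subdiv_map (-LinearMap.id : (Fin (d + 1) → ℝ) →ₗ[ℝ] (Fin (d + 1) → ℝ)) k l
        rw [eval_add]
        congr 1
        have e : (⇑(-LinearMap.id : (Fin (d + 1) → ℝ) →ₗ[ℝ] (Fin (d + 1) → ℝ))) = Neg.neg := by
          ext x; simp
        rw [e] at this
        rw [this, eval_map]
  have hlim : Filter.Tendsto (fun N : ℕ => ((d : ℝ) / (d + 1)) ^ N * 2) Filter.atTop (nhds 0) := by
    have := tendsto_pow_atTop_nhds_zero_of_lt_one (r := (d : ℝ) / (d + 1)) (by positivity)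
      (by rw [div_lt_one (by positivity)]; linarith)
    simpa using this.mul_const 2
  obtain ⟨N, hN⟩ := (hlim.eventually (gt_mem_nhds hδ)).exists
  obtain ⟨C, h1, h2, h3⟩ := main N
  refine ⟨C, h1, fun k hk l hl => ?_, h3⟩
  obtain ⟨a, ⟨s, hs⟩, c⟩ := h2 k hk l hl
  exact ⟨a, fun x hx => hcell' s x (hs x hx), fun x hx y hy => (c x hx y hy).trans_lt hN⟩

end ListCochain

/-! ### Products of chains -/

namespace ListCochain

variable {α β γ : Type*}

lemma shuffle_map_right (f : List (α × γ) → ZMod 2) (g : β → γ) (s : List α) (t : List β) :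
    shuffle f s (t.map g) = shuffle (fun l => f (l.map (Prod.map id g))) s t := by
  have := staircases_map id g s t
  rw [List.map_id] at this
  rw [shuffle, this, eval_map, shuffle]

/-- The product of the chains `C (b 0), …, C (b (n - 1))`, triangulated by staircases. -/
def prodChain (C : ℕ → List (List α)) : (n : ℕ) → (Fin n → ℕ) → List (List (Fin n → α))
  | 0, _ => [[Fin.elim0]]
  | n + 1, b => (C (b 0)).flatMap fun s => (prodChain C n (Fin.tail b)).flatMap fun t =>
      (staircases s t).map (List.map fun p => (Fin.cons p.1 p.2 : Fin (n + 1) → α))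

variable {C : ℕ → List (List α)} {n : ℕ}

lemma eval_prodChain_succ (b : Fin (n + 1) → ℕ) (f : List (Fin (n + 1) → α) → ZMod 2) :
    eval (prodChain C (n + 1) b) f = eval (C (b 0)) fun s => eval (prodChain C n (Fin.tail b))
      (shuffle (fun l => f (l.map fun p => (Fin.cons p.1 p.2 : Fin (n + 1) → α))) s) := by
  simp only [prodChain, eval_flatMap, eval_map]
  rfl

lemma exists_of_mem_prodChain {b : Fin n → ℕ} {l : List (Fin n → α)}
    (h : l ∈ prodChain C n b) :
    ∃ s : Fin n → List α, (∀ j, s j ∈ C (b j)) ∧ (∀ v ∈ l, ∀ j, v j ∈ s j) ∧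
      l.length + n = 1 + ∑ j, (s j).length := by
  induction n with
  | zero =>
    simp only [prodChain, List.mem_singleton] at h
    exact ⟨Fin.elim0, fun j => j.elim0, fun _ _ j => j.elim0, by simp [h]⟩
  | succ n ih =>
    simp only [prodChain, List.mem_flatMap, List.mem_map] at h
    obtain ⟨s, hs, t, ht, r, hr, rfl⟩ := h
    obtain ⟨s', h1, h2, h3⟩ := ih ht
    obtain ⟨h4, h5⟩ := mem_staircases hr
    refine ⟨Fin.cons s s', fun j => ?_, fun v hv j => ?_, ?_⟩
    · refine Fin.cases hs (fun j => ?_) j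
      exact h1 j
    · obtain ⟨p, hp, rfl⟩ := List.mem_map.1 hv
      refine Fin.cases (h5 p hp).1 (fun j => ?_) j
      exact h2 _ (h5 p hp).2 j
    · rw [Fin.sum_univ_succ]
      simp only [Fin.cons_zero, Fin.cons_succ, List.length_map]
      omega

lemma prodChain_eq_nil (h0 : C 0 = []) {b : Fin n → ℕ} {j : Fin n} (hj : b j = 0) :
    prodChain C n b = [] := by
  rw [List.eq_nil_iff_forall_not_mem]
  intro l hl
  obtain ⟨s, hs, -⟩ := exists_of_mem_prodChain hl
  have := hs j
  rw [hj, h0] at this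
  simp at this

lemma prodChain_one {w : α} (h1 : C 1 = [[w]]) : prodChain C n (fun _ => 1) = [[fun _ => w]] := by
  induction n with
  | zero => simp [prodChain, funext_iff]
  | succ n ih =>
    have : Fin.tail (fun _ : Fin (n + 1) => 1) = fun _ => 1 := rfl
    simp only [prodChain, h1, this, ih, List.flatMap_cons, List.flatMap_nil, staircases,
      List.map_cons, List.map_nil, List.append_nil, List.cons.injEq, and_true]
    ext j
    refine Fin.cases rfl (fun j => rfl) j

/-- The map changing the `j`-th entry of a tuple by `ν`. -/
def mapEntry (ν : α → α) (j : Fin n) (v : Fin n → α) : Fin n → α := Function.update v j (ν (v j))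

/-- Decrease the `j`-th entry by one. -/
def lower (b : Fin n → ℕ) (j : Fin n) : Fin n → ℕ := Function.update b j (b j - 1)

theorem eval_prodChain_cobd {ν : α → α} {D : ℕ} (hlen : ∀ k ≤ D, ∀ l ∈ C k, l.length = k)
    (hC : ∀ k ≤ D, 1 ≤ k → ∀ f, f [] = 0 → eval (C k) (cobd f)
      = eval (C (k - 1)) (fun l => f l + f (l.map ν)))
    {b : Fin n → ℕ} (hb : ∀ j, 1 ≤ b j) (hb' : ∀ j, b j ≤ D)
    (f : List (Fin n → α) → ZMod 2) (hf : f [] = 0) :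
    eval (prodChain C n b) (cobd f) = ∑ j, eval (prodChain C n (lower b j))
      (fun l => f l + f (l.map (mapEntry ν j))) := by
  induction n with
  | zero => simp [prodChain, cobd_singleton, hf]
  | succ n ih =>
    set f' : List (α × (Fin n → α)) → ZMod 2 :=
      fun l => f (l.map fun p => (Fin.cons p.1 p.2 : Fin (n + 1) → α)) with hf'
    have step1 : eval (prodChain C (n + 1) b) (cobd f) = eval (C (b 0)) (fun s =>
        eval (prodChain C n (Fin.tail b)) (fun t => cobd (fun s' => shuffle f' s' t) s)
        + eval (prodChain C n (Fin.tail b)) (cobd (shuffle f' s))) := by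
      rw [eval_prodChain_succ]
      refine eval_congr fun s hs => ?_
      rw [← eval_add]
      refine eval_congr fun t ht => ?_
      simp only [cobd_map]
      refine shuffle_cobd f' s t ?_ ?_ (Or.inr (by simpa [hf'] using hf))
      · rintro rfl
        have := hlen _ (hb' 0) _ hs
        have := hb 0
        simp at *; omega
      · rintro rfl
        obtain ⟨s', h1, -, h3⟩ := exists_of_mem_prodChain ht
        have : ∀ j, 1 ≤ (s' j).length := fun j => by
          rw [hlen _ (hb' j.succ) _ (h1 j)]; exact hb j.succ
        have := Finset.sum_le_sum fun j (_ : j ∈ Finset.univ) => this j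
        simp at this h3
        omega
    rw [step1, eval_add, Fin.sum_univ_succ]
    congr 1
    · have e1 : lower b 0 0 = b 0 - 1 := by simp [lower]
      have e2 : Fin.tail (lower b 0) = Fin.tail b := by
        ext j; simp [lower, Fin.tail]
      rw [eval_prodChain_succ, e1, e2]
      have e3 : (fun s => eval (prodChain C n (Fin.tail b))
          (fun t => cobd (fun s' => shuffle f' s' t) s))
          = cobd fun s' => eval (prodChain C n (Fin.tail b)) (shuffle f' s') := by
        ext s
        exact eval_comm _ _ _
      rw [e3, hC _ (hb' 0) (hb 0)]
      · refine eval_congr fun s _ => ?_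
        rw [← eval_add]
        refine eval_congr fun t _ => ?_
        rw [shuffle_map_left, ← shuffle_add]
        congr 1
        ext l
        simp only [hf', List.map_map]
        congr 2
        refine List.map_congr_left fun p _ => ?_
        ext j
        refine Fin.cases ?_ (fun j => ?_) j <;> simp [mapEntry]
      · exact eval_eq_zero fun t _ => by simp
    · rw [eval_congr (fun s _ => ih (b := Fin.tail b) (fun j => hb _) (fun j => hb' _)
        (shuffle f' s) (by simp))]
      have : ∀ (ι : Finset (Fin n)) (H : Fin n → List α → ZMod 2),
          eval (C (b 0)) (fun s => ∑ j ∈ ι, H j s) = ∑ j ∈ ι, eval (C (b 0)) (H j) := by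
        intro ι H
        induction ι using Finset.induction_on with
        | empty => simp
        | insert j ι hj ih => simp [Finset.sum_insert hj, eval_add, ih]
      rw [this]
      refine Finset.sum_congr rfl fun j _ => ?_
      have e1 : lower b j.succ 0 = b 0 :=
        Function.update_of_ne (Fin.succ_ne_zero j).symm _ _
      have e2 : Fin.tail (lower b j.succ) = lower (Fin.tail b) j := by
        ext i
        by_cases h : i = j
        · subst h; simp [lower, Fin.tail]
        · simp [lower, Fin.tail, h]
      rw [eval_prodChain_succ, e1, e2]
      refine eval_congr fun s _ => ?_
      refine eval_congr fun t _ => ?_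
      rw [shuffle_map_right, ← shuffle_add]
      congr 1
      ext l
      simp only [hf', List.map_map]
      congr 2
      refine List.map_congr_left fun p _ => ?_
      ext i
      refine Fin.cases ?_ (fun i => ?_) i
      · simp [mapEntry, Function.update_of_ne (Fin.succ_ne_zero j).symm]
      · by_cases h : i = j
        · subst h; simp [mapEntry]
        · simp [mapEntry, h]

/-- The unit sphere of the `ℓ¹` norm on `ℝ^(d+1)`. -/
abbrev L1Sphere (d : ℕ) : Type := {w : Fin (d + 1) → ℝ // ∑ i, |w i| = 1}

namespace L1Sphere

/-- The antipodal map. -/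
def antipode {d : ℕ} (w : L1Sphere d) : L1Sphere d := ⟨-w.1, by simpa using w.2⟩

@[simp] lemma coe_antipode {d : ℕ} (w : L1Sphere d) : (antipode w).1 = -w.1 := rfl

lemma exists_fine_chains (d : ℕ) {δ : ℝ} (hδ : 0 < δ) :
    ∃ C : ℕ → List (List (L1Sphere d)), C 0 = [] ∧ (∃ w, C 1 = [[w]]) ∧
      (∀ k ≤ d + 1, ∀ l ∈ C k, l.length = k ∧ ∀ x ∈ l, ∀ y ∈ l, dist x y < δ) ∧
      ∀ k ≤ d + 1, 1 ≤ k → ∀ f, f [] = 0 → eval (C k) (cobd f)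
        = eval (C (k - 1)) (fun l => f l + f (l.map antipode)) := by
  classical
  obtain ⟨C, ⟨w, hw⟩, hC, hbd⟩ := exists_fine_hemispheres d hδ
  have hw1 : ∑ i, |w i| = 1 := (hC 0 (Nat.zero_le _) [w] (by simp [hw])).2.1 w (by simp)
  let r : (Fin (d + 1) → ℝ) → L1Sphere d := fun x => if h : ∑ i, |x i| = 1 then ⟨x, h⟩ else ⟨w, hw1⟩
  have hr : ∀ x, ∑ i, |x i| = 1 → (r x).1 = x := fun x hx => by simp [r, dif_pos hx]
  have hneg : ∀ x, ∑ i, |x i| = 1 → r (-x) = antipode (r x) := fun x hx => by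
    apply Subtype.ext
    rw [hr _ (by simpa using hx), coe_antipode, hr _ hx]
  refine ⟨fun k => match k with
    | 0 => []
    | k + 1 => (C k).map (List.map r), rfl, ⟨r w, by simp [hw]⟩, ?_, ?_⟩
  · intro k hk l hl
    match k with
    | 0 => simp at hl
    | k + 1 =>
      obtain ⟨t, ht, rfl⟩ := List.mem_map.1 hl
      obtain ⟨h1, h2, h3⟩ := hC k (by omega) t ht
      refine ⟨by simp [h1], ?_⟩
      simp only [List.mem_map]
      rintro _ ⟨x, hx, rfl⟩ _ ⟨y, hy, rfl⟩
      rw [Subtype.dist_eq, hr x (h2 x hx), hr y (h2 y hy)]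
      exact h3 x hx y hy
  · intro k hk hk1 f hf
    match k with
    | 1 => simp [hw, cobd_singleton, hf]
    | k + 2 =>
      have := hbd k (by omega) (fun l => f (l.map r))
      simp only [Nat.succ_sub_one, eval_map, cobd_map]
      rw [this]
      refine eval_congr fun l hl => ?_
      rw [List.map_map, List.map_map]
      congr 2
      refine List.map_congr_left fun x hx => ?_
      exact hneg x ((hC k (by omega) l hl).2.1 x hx)

end L1Sphere

/-- A tuple of `n` vectors in the unit sphere of the `ℓ¹` norm on `ℝ^(d+1)`. -/
abbrev Frame (n d : ℕ) : Type := Fin n → L1Sphere d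

namespace Frame

variable {n d : ℕ}

/-- Change the sign of the `j`-th vector. -/
def flip (j : Fin n) : Frame n d → Frame n d := mapEntry L1Sphere.antipode j

theorem exists_fine_chains (n d : ℕ) {δ : ℝ} (hδ : 0 < δ) :
    ∃ c : (Fin n → ℕ) → List (List (Frame n d)),
      (∃ v, c (fun _ => 1) = [[v]]) ∧
      (∀ b j, b j = 0 → c b = []) ∧
      (∀ b, (∀ j, b j ≤ d + 1) → ∀ l ∈ c b, l.length + n = 1 + ∑ j, b j ∧
        ∀ x ∈ l, ∀ y ∈ l, dist x y < δ) ∧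
      ∀ b, (∀ j, 1 ≤ b j) → (∀ j, b j ≤ d + 1) → ∀ f, f [] = 0 → eval (c b) (cobd f)
        = ∑ j, eval (c (lower b j)) (fun l => f l + f (l.map (flip j))) := by
  obtain ⟨C, h0, ⟨w, h1⟩, h2, h3⟩ := L1Sphere.exists_fine_chains d hδ
  refine ⟨prodChain C n, ⟨_, prodChain_one h1⟩, fun b j hj => prodChain_eq_nil h0 hj, ?_,
    fun b hb hb' f hf => eval_prodChain_cobd (fun k hk l hl => (h2 k hk l hl).1) h3 hb hb' f hf⟩
  intro b hb l hl
  obtain ⟨s, hs, hs', hs''⟩ := exists_of_mem_prodChain hl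
  refine ⟨?_, fun x hx y hy => ?_⟩
  · rw [hs'']
    congr 1
    exact Finset.sum_congr rfl fun j _ => (h2 _ (hb j) _ (hs j)).1
  · rw [dist_pi_lt_iff hδ]
    exact fun j => (h2 _ (hb j) _ (hs j)).2 _ (hs' x hx j) _ (hs' y hy j)

end Frame

end ListCochain

/-! ### Norms of cochains and fillings -/

namespace ListCochain

variable {X V : Type*}

/-- The fraction of the lists of length `k` with entries in `P` on which `α` is nonzero. -/
noncomputable def nrm (P : Finset X) : ℕ → (List X → ZMod 2) → ℝ
  | 0, α => if α [] = 0 then 0 else 1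
  | k + 1, α => (∑ x ∈ P, nrm P k fun l => α (x :: l)) / P.card

variable {P : Finset X}

lemma nrm_nonneg (k : ℕ) (α : List X → ZMod 2) : 0 ≤ nrm P k α := by
  induction k generalizing α with
  | zero => unfold nrm; split_ifs <;> norm_num
  | succ k ih => exact div_nonneg (Finset.sum_nonneg fun x _ => ih _) (Nat.cast_nonneg _)

lemma nrm_le_add (k : ℕ) {α β γ : List X → ZMod 2}
    (h : ∀ l : List X, l.length = k → (∀ x ∈ l, x ∈ P) → α l ≠ 0 → β l ≠ 0 ∨ γ l ≠ 0) :
    nrm P k α ≤ nrm P k β + nrm P k γ := by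
  induction k generalizing α β γ with
  | zero =>
    have := h [] rfl (by simp)
    unfold nrm
    split_ifs <;> simp_all
  | succ k ih =>
    unfold nrm
    rw [← add_div, ← Finset.sum_add_distrib]
    refine div_le_div_of_nonneg_right (Finset.sum_le_sum fun x hx => ?_) (Nat.cast_nonneg _)
    exact ih fun l hl hlP => h (x :: l) (by simp [hl]) (by simpa [hx] using hlP)

lemma nrm_zero (k : ℕ) : nrm P k (fun _ => 0) = 0 := by
  induction k with
  | zero => simp [nrm]
  | succ k ih => simp [nrm, ih]

lemma nrm_mono (k : ℕ) {α β : List X → ZMod 2}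
    (h : ∀ l : List X, l.length = k → (∀ x ∈ l, x ∈ P) → α l ≠ 0 → β l ≠ 0) :
    nrm P k α ≤ nrm P k β := by
  have := nrm_le_add (P := P) k (α := α) (β := β) (γ := fun _ => 0)
    fun l h1 h2 h3 => Or.inl (h l h1 h2 h3)
  rwa [nrm_zero, add_zero] at this

lemma nrm_add_le (k : ℕ) (α β : List X → ZMod 2) :
    nrm P k (fun l => α l + β l) ≤ nrm P k α + nrm P k β := by
  refine nrm_le_add k fun l _ _ h => ?_
  by_contra! H
  exact h (by simp [H])

lemma nrm_eval_le (k : ℕ) (c : List (List V)) (G : List V → List X → ZMod 2) {B : ℝ}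
    (h : ∀ s ∈ c, nrm P k (G s) ≤ B) : nrm P k (fun l => eval c fun s => G s l) ≤ c.length * B := by
  induction c with
  | nil => simp [nrm_zero]
  | cons s c ih =>
    simp only [eval_cons]
    refine (nrm_add_le _ _ _).trans ?_
    have h1 := h s (by simp)
    have h2 := ih fun t ht => h t (by simp [ht])
    push_cast [List.length_cons]
    linarith

lemma exists_nrm_cons_le (hP : P.Nonempty) (k : ℕ) (α : List X → ZMod 2) :
    ∃ x ∈ P, nrm P k (fun l => α (x :: l)) ≤ nrm P (k + 1) α := by
  by_contra! H
  have hpos : (0 : ℝ) < P.card := by exact_mod_cast hP.card_pos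
  have := Finset.sum_lt_sum_of_nonempty hP H
  rw [Finset.sum_const, nsmul_eq_mul, nrm, mul_div_cancel₀ _ hpos.ne'] at this
  exact lt_irrefl _ this

lemma nrm_one (α : List X → ZMod 2) :
    nrm P 1 α = (P.filter fun x => α [x] ≠ 0).card / P.card := by
  simp only [nrm, Finset.card_filter]
  push_cast
  congr 1
  exact Finset.sum_congr rfl fun x _ => by split_ifs <;> simp_all

lemma nrm_one_compl (hP : P.Nonempty) (α : List X → ZMod 2) :
    nrm P 1 (fun l => α l + 1) = 1 - nrm P 1 α := by
  have hpos : (P.card : ℝ) ≠ 0 := by exact_mod_cast hP.card_pos.ne'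
  rw [nrm_one, nrm_one, eq_sub_iff_add_eq, ← add_div, div_eq_one_iff_eq hpos]
  have : (P.filter fun x => α [x] + 1 ≠ 0) = P.filter fun x => ¬ α [x] ≠ 0 := by
    refine Finset.filter_congr fun x _ => ?_
    generalize α [x] = a
    revert a; decide
  rw [this, add_comm]
  exact_mod_cast Finset.card_filter_add_card_filter_not (s := P) (fun x => α [x] ≠ 0)

lemma nrm_two_of_cobd (hP : P.Nonempty) {α β : List X → ZMod 2}
    (h : ∀ x ∈ P, ∀ y ∈ P, α [x, y] = β [y] + β [x]) :
    nrm P 2 α = 2 * nrm P 1 β * (1 - nrm P 1 β) := by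
  have hpos : (P.card : ℝ) ≠ 0 := by exact_mod_cast hP.card_pos.ne'
  have hx : ∀ x ∈ P, nrm P 1 (fun l => α (x :: l))
      = nrm P 1 β + nrm P 0 (fun l => β (x :: l)) * (1 - 2 * nrm P 1 β) := by
    intro x hx
    by_cases hb : β [x] = 0
    · have : nrm P 0 (fun l => β (x :: l)) = 0 := by simp [nrm, hb]
      rw [this, zero_mul, add_zero]
      apply le_antisymm <;> refine nrm_mono 1 fun l hl hlP => ?_
      all_goals
        obtain ⟨y, rfl⟩ := List.length_eq_one_iff.1 hl
        simp [h x hx y (by simpa using hlP), hb]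
    · have h1 : nrm P 0 (fun l => β (x :: l)) = 1 := by simp [nrm, hb]
      have hb1 : β [x] = 1 := by
        revert hb; generalize β [x] = b; revert b; decide
      rw [h1, show nrm P 1 β + 1 * (1 - 2 * nrm P 1 β) = 1 - nrm P 1 β by ring,
        ← nrm_one_compl hP]
      apply le_antisymm <;> refine nrm_mono 1 fun l hl hlP => ?_
      all_goals
        obtain ⟨y, rfl⟩ := List.length_eq_one_iff.1 hl
        simp [h x hx y (by simpa using hlP), hb1]
  have e1 : nrm P 1 β = (∑ x ∈ P, nrm P 0 fun l => β (x :: l)) / P.card := rfl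
  change (∑ x ∈ P, nrm P 1 fun l => α (x :: l)) / P.card = _
  rw [Finset.sum_congr rfl hx, Finset.sum_add_distrib, ← Finset.sum_mul, add_div,
    mul_div_right_comm, ← e1, Finset.sum_const, nsmul_eq_mul, mul_div_cancel_left₀ _ hpos]
  ring

/-- Cocycles on a full simplex are coboundaries, with good control of the norm. -/
lemma exists_filling (hP : P.Nonempty) (q : ℕ) (hq : 1 ≤ q) (α : List X → ZMod 2) :
    ∃ β : List X → ZMod 2, (2 ≤ q → nrm P q β ≤ nrm P (q + 1) α) ∧
      ((∀ T : List X, T.length = q + 2 → (∀ x ∈ T, x ∈ P) → cobd α T = 0) →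
        (∀ T : List X, T.length = q + 1 → (∀ x ∈ T, x ∈ P) → cobd β T = α T) ∧
        (q = 1 → nrm P 1 β ≤ 1 / 2 ∧
          2 * nrm P 1 β * (1 - nrm P 1 β) = nrm P 2 α)) := by
  obtain ⟨x, hx, hle⟩ := exists_nrm_cons_le hP q α
  have key : (∀ T : List X, T.length = q + 2 → (∀ x ∈ T, x ∈ P) → cobd α T = 0) →
      ∀ T : List X, T.length = q + 1 → (∀ x ∈ T, x ∈ P) →
        cobd (fun l => α (x :: l)) T = α T := by
    intro hα T hT hTP
    have := hα (x :: T) (by simp [hT]) (by simpa [hx] using hTP)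
    rw [cobd_cons] at this
    exact (CharTwo.add_eq_zero.1 this).symm
  by_cases hq2 : 2 ≤ q
  · exact ⟨_, fun _ => hle, fun hα => ⟨key hα, fun h => by omega⟩⟩
  obtain rfl : q = 1 := by omega
  by_cases hhalf : nrm P 1 (fun l => α (x :: l)) ≤ 1 / 2
  · refine ⟨_, fun h => by omega, fun hα => ⟨key hα, fun _ => ⟨hhalf, ?_⟩⟩⟩
    refine (nrm_two_of_cobd hP fun y hy z hz => ?_).symm
    rw [← key hα [y, z] rfl (by simp [hy, hz]), cobd_pair]
  · refine ⟨fun l => α (x :: l) + 1, fun h => by omega, fun hα => ?_⟩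
    have key' : ∀ T : List X, T.length = 2 → (∀ x ∈ T, x ∈ P) →
        cobd (fun l => α (x :: l) + 1) T = α T := by
      intro T hT hTP
      rw [← key hα T hT hTP, cobd_add]
      obtain ⟨y, z, rfl⟩ := List.length_eq_two.1 hT
      rw [cobd_pair (fun _ => 1), CharTwo.add_self_eq_zero, add_zero]
    refine ⟨key', fun _ => ⟨?_, ?_⟩⟩
    · rw [nrm_one_compl hP]; push Not at hhalf; linarith
    · refine (nrm_two_of_cobd hP fun y hy z hz => ?_).symm
      rw [← key' [y, z] rfl (by simp [hy, hz]), cobd_pair]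

/-- A family of cochains that is the coboundary of its restrictions to faces and is small
in norm can be filled equivariantly. -/
theorem exists_equivariant_filling (hP : P.Nonempty) {n : ℕ} (hn : 1 ≤ n)
    (F : List V → List X → ZMod 2) (Q : List V → Prop)
    (hQ : ∀ s, Q s → ∀ s' ∈ faces s, Q s') (hF0 : ∀ T, F [] T = 0)
    (hF : ∀ s T, Q s → s.length + T.length = n + 3 → (∀ x ∈ T, x ∈ P) →
      cobd (F s) T = cobd (fun s' => F s' T) s)
    {c κ : ℝ} (hκ0 : 0 ≤ κ)
    (hc : ∀ s, Q s → s.length = 1 → nrm P (n + 1) (F s) ≤ c)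
    (hκ : ∀ s, Q s → ∀ k, 1 ≤ k → k ≤ n → s.length = k + 1 → nrm P (n - k + 1) (F s) ≤ κ)
    (hnum : n.factorial * (c + (n - 1) * κ)
      < 2 * ((1 - κ) / (n + 1)) * (1 - (1 - κ) / (n + 1))) :
    ∃ G : List V → List X → ZMod 2,
      (∀ g : V → V, (∀ s, F (s.map g) = F s) → ∀ s, G (s.map g) = G s) ∧
      ∀ s, Q s → s.length = n + 1 → ∀ p ∈ P, F s [p] = cobd (fun s' => G s' [p]) s := by
  choose! fill hfill1 hfill2 using fun q (hq : 1 ≤ q) (α : List X → ZMod 2) =>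
    exists_filling hP q hq α
  let G : ℕ → List V → List X → ZMod 2 := fun k => Nat.rec (fun _ _ => 0)
    (fun k Gk s => fill (n - k) fun T => F s T + cobd (fun s' => Gk s' T) s) k
  let A : ℕ → List V → List X → ZMod 2 := fun k s T => F s T + cobd (fun s' => G k s' T) s
  have hG : ∀ k s, G (k + 1) s = fill (n - k) (A k s) := fun _ _ => rfl
  have hcoc : ∀ k ≤ n, ∀ s, Q s → s.length = k + 1 → ∀ T : List X, T.length = n - k + 2 →
      (∀ x ∈ T, x ∈ P) → cobd (A k s) T = 0 := by
    intro k
    induction k with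
    | zero =>
      intro _ s hs hsl T hT hTP
      obtain ⟨v, rfl⟩ := List.length_eq_one_iff.1 hsl
      have e : A 0 [v] = F [v] := by
        ext T
        simp [A, G]
      rw [e, hF _ _ hs (by simp; omega) hTP, cobd_singleton, hF0]
    | succ k ih =>
      intro hk s hs hsl T hT hTP
      have e1 : cobd (A (k + 1) s) T = cobd (F s) T
          + cobd (fun s' => cobd (G (k + 1) s') T) s := by
        rw [cobd_comm (fun s' T' => G (k + 1) s' T')]
        exact cobd_add _ _ _
      have e2 : cobd (fun s' => cobd (G (k + 1) s') T) s = cobd (fun s' => A k s' T) s := by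
        refine cobd_congr fun s' hs' => ?_
        have := length_of_mem_faces hs'
        rw [hG]
        refine ((hfill2 (n - k) (by omega) (A k s') ?_).1 T (by omega) hTP)
        exact ih (by omega) s' (hQ s hs s' hs') (by omega)
      have e3 : cobd (fun s' => A k s' T) s = cobd (fun s' => F s' T) s := by
        simp only [A]
        rw [cobd_add, cobd_cobd, add_zero]
      rw [e1, e2, e3, hF s T hs (by omega) hTP]
      exact CharTwo.add_self_eq_zero _
  have hnrm : ∀ k < n, ∀ s, Q s → s.length = k + 1 →
      nrm P (n - k + 1) (A k s) ≤ (k + 1).factorial * (c + k * κ) := by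
    intro k
    induction k with
    | zero =>
      intro _ s hs hsl
      obtain ⟨v, rfl⟩ := List.length_eq_one_iff.1 hsl
      have e : A 0 [v] = F [v] := by
        ext T
        simp [A, G]
      rw [e]
      simpa using hc _ hs hsl
    | succ k ih =>
      intro hk s hs hsl
      have h1 := hκ s hs (k + 1) (by omega) (by omega) hsl
      have h2 : nrm P (n - (k + 1) + 1) (fun T => cobd (fun s' => G (k + 1) s' T) s)
          ≤ (faces s).length * ((k + 1).factorial * (c + k * κ)) := by
        refine nrm_eval_le _ _ _ fun s' hs' => ?_
        have := length_of_mem_faces hs'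
        have hk' : n - (k + 1) + 1 = n - k := by omega
        rw [hG, hk']
        exact (hfill1 (n - k) (by omega) _ (by omega)).trans
          (ih (by omega) s' (hQ s hs s' hs') (by omega))
      rw [length_faces, hsl] at h2
      refine (nrm_add_le _ _ _).trans ((add_le_add h1 h2).trans ?_)
      rw [Nat.factorial_succ (k + 1)]
      push_cast
      have : κ ≤ (k + 1 + 1) * ((k + 1).factorial : ℝ) * κ := by
        refine le_mul_of_one_le_left hκ0 ?_
        have : (1 : ℝ) ≤ (k + 1).factorial := by exact_mod_cast (k + 1).factorial_pos
        nlinarith [(Nat.cast_nonneg k : (0 : ℝ) ≤ k)]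
      linarith
  have hsmall : ∀ s, Q s → s.length = n → nrm P 1 (G n s) < (1 - κ) / (n + 1) := by
    intro s hs hsl
    obtain ⟨k, rfl⟩ : ∃ k, n = k + 1 := ⟨n - 1, by omega⟩
    have hq : k + 1 - k = 1 := by omega
    have h1 := hnrm k (by omega) s hs hsl
    have h2 := (hfill2 (k + 1 - k) (by omega) (A k s)
      (fun T hT => hcoc k (by omega) s hs hsl T (by omega))).2 hq
    rw [← hG] at h2
    rw [hq] at h1
    have hk : (((k + 1 : ℕ) : ℝ) - 1) = k := by push_cast; ring
    rw [hk] at hnum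
    set a := nrm P 1 (G (k + 1) s)
    set a0 := (1 - κ) / (((k + 1 : ℕ) : ℝ) + 1)
    by_contra! H
    have ha0 : a0 ≤ 1 / 2 := by
      rw [div_le_div_iff₀ (by positivity) (by norm_num)]
      push_cast
      nlinarith [(Nat.cast_nonneg k : (0 : ℝ) ≤ k)]
    nlinarith [h2.1, h2.2]
  refine ⟨G n, ?_, ?_⟩
  · intro g hg s
    have : ∀ k s, G k (s.map g) = G k s := by
      intro k
      induction k with
      | zero => intro s; rfl
      | succ k ih =>
        intro s
        rw [hG, hG]
        congr 1
        ext T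
        simp only [A, hg, cobd_map, ih]
    exact this n s
  · intro s hs hsl p hp
    have h0 : nrm P 1 (A n s) < 1 := by
      have h1 : nrm P 1 (F s) ≤ κ := by
        simpa using hκ s hs n hn le_rfl hsl
      classical
      obtain ⟨s₀, hs₀, hmax⟩ := (faces s).toFinset.exists_max_image
          (fun s' => nrm P 1 (G n s')) <| by
        rw [List.toFinset_nonempty_iff, ← List.length_pos_iff, length_faces]; omega
      simp only [List.mem_toFinset] at hs₀ hmax
      have h2 := nrm_eval_le (P := P) 1 (faces s) (G n) hmax
      have := length_of_mem_faces hs₀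
      have h3 := hsmall s₀ (hQ s hs s₀ hs₀) (by omega)
      rw [length_faces, hsl] at h2
      rw [lt_div_iff₀ (by positivity)] at h3
      refine (nrm_add_le _ _ _).trans_lt ((add_le_add h1 h2).trans_lt ?_)
      push_cast
      linarith
    have hconst : ∀ q ∈ P, A n s [q] = A n s [p] := by
      intro q hq
      have := hcoc n le_rfl s hs hsl [p, q] (by simp) (by simp [hp, hq])
      rw [cobd_pair] at this
      exact CharTwo.add_eq_zero.1 this
    by_contra hne
    have hA : A n s [p] ≠ 0 := fun h => hne (CharTwo.add_eq_zero.1 h)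
    rw [nrm_one, Finset.filter_true_of_mem, div_self] at h0
    · exact lt_irrefl _ h0
    · exact_mod_cast hP.card_pos.ne'
    · intro q hq
      rw [hconst q hq]
      exact hA

end ListCochain

namespace ListCochain

variable {X : Type*} {P : Finset X}

/-! ### Counting -/

lemma nrm_mul_pow_le [DecidableEq X] (k : ℕ) {α : List X → ZMod 2} {S : Finset (Finset X)}
    (hS : ∀ T ∈ S, T.card = k)
    (hα : ∀ l : List X, l.length = k → (∀ x ∈ l, x ∈ P) → α l ≠ 0 → l.Nodup ∧ l.toFinset ∈ S) :
    nrm P k α * (P.card : ℝ) ^ k ≤ k.factorial * S.card := by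
  induction k generalizing α S with
  | zero =>
    by_cases h : α [] = 0
    · simp [nrm, h]
    · have := (hα [] rfl (by simp) h).2
      simp only [nrm, h, pow_zero]
      simpa using Finset.card_pos.2 ⟨_, this⟩
  | succ k ih =>
    rcases P.eq_empty_or_nonempty with rfl | hP
    · simp; positivity
    have hpos : (P.card : ℝ) ≠ 0 := by exact_mod_cast hP.card_pos.ne'
    have h1 : ∀ x ∈ P, nrm P k (fun l => α (x :: l)) * (P.card : ℝ) ^ k
        ≤ k.factorial * ((S.filter (x ∈ ·)).card : ℝ) := by
      intro x hx
      refine (ih (S := (S.filter (x ∈ ·)).image (Finset.erase · x)) ?_ ?_).trans ?_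
      · intro T hT
        obtain ⟨T', hT', rfl⟩ := Finset.mem_image.1 hT
        rw [Finset.mem_filter] at hT'
        rw [Finset.card_erase_of_mem hT'.2, hS _ hT'.1]; rfl
      · intro l hl hlP hne
        obtain ⟨h1, h2⟩ := hα (x :: l) (by simp [hl]) (by simpa [hx] using hlP) hne
        rw [List.nodup_cons] at h1
        refine ⟨h1.2, Finset.mem_image.2 ⟨_, Finset.mem_filter.2 ⟨h2, by simp⟩, ?_⟩⟩
        rw [List.toFinset_cons, Finset.erase_insert (by simpa using h1.1)]
      · refine mul_le_mul_of_nonneg_left ?_ (by positivity)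
        exact_mod_cast Finset.card_image_le
    have h2 : ∑ x ∈ P, ((S.filter (x ∈ ·)).card : ℝ) ≤ (k + 1) * S.card := by
      have : ∑ x ∈ P, (S.filter (x ∈ ·)).card = ∑ T ∈ S, (P.filter (· ∈ T)).card :=
        Finset.sum_card_bipartiteAbove_eq_sum_card_bipartiteBelow _
      have h3 : ∑ T ∈ S, (P.filter (· ∈ T)).card ≤ ∑ T ∈ S, (k + 1) := by
        refine Finset.sum_le_sum fun T hT => ?_
        rw [← hS T hT]
        exact Finset.card_le_card fun x hx => (Finset.mem_filter.1 hx).2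
      rw [← this, Finset.sum_const, smul_eq_mul, mul_comm] at h3
      exact_mod_cast h3
    calc nrm P (k + 1) α * (P.card : ℝ) ^ (k + 1)
        = ∑ x ∈ P, nrm P k (fun l => α (x :: l)) * (P.card : ℝ) ^ k := by
          rw [nrm, ← Finset.sum_mul]
          field_simp
          ring
      _ ≤ ∑ x ∈ P, k.factorial * ((S.filter (x ∈ ·)).card : ℝ) := Finset.sum_le_sum h1
      _ = k.factorial * ∑ x ∈ P, ((S.filter (x ∈ ·)).card : ℝ) := by rw [Finset.mul_sum]
      _ ≤ k.factorial * ((k + 1) * S.card) := by gcongr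
      _ = _ := by rw [Nat.factorial_succ]; push_cast; ring

lemma nrm_mul_choose_le [DecidableEq X] (k : ℕ) {α : List X → ZMod 2} {S : Finset (Finset X)}
    (hS : ∀ T ∈ S, T.card = k)
    (hα : ∀ l : List X, l.length = k → (∀ x ∈ l, x ∈ P) → α l ≠ 0 → l.Nodup ∧ l.toFinset ∈ S) :
    nrm P k α * P.card.choose k ≤ S.card := by
  have h1 := nrm_mul_pow_le k hS hα
  have h2 : (k.factorial : ℝ) * P.card.choose k ≤ (P.card : ℝ) ^ k := by
    rw [← Nat.cast_mul, ← Nat.descFactorial_eq_factorial_mul_choose]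
    exact_mod_cast Nat.descFactorial_le_pow _ _
  have h3 := mul_le_mul_of_nonneg_left h2 (nrm_nonneg (P := P) k α)
  have h4 : (0 : ℝ) < k.factorial := by exact_mod_cast k.factorial_pos
  refine le_of_mul_le_mul_left ?_ h4
  linarith

/-! ### Tuples that are dependent modulo a subspace -/

variable {W : Type*} [AddCommGroup W] [Module ℝ W]

/-- The images of the entries of a list are linearly dependent modulo a subspace. -/
def DepMod (pos : X → W) : Submodule ℝ W → List X → Prop
  | _, [] => False
  | U, x :: l => pos x ∈ U ∨ DepMod pos (U ⊔ Submodule.span ℝ {pos x}) l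

lemma depMod_of_sum_mem [DecidableEq X] {pos : X → W} {U : Submodule ℝ W} {l : List X} {a : X → ℝ}
    (h : ∑ x ∈ l.toFinset, a x • pos x ∈ U) (ha : ∃ x ∈ l, a x ≠ 0) : DepMod pos U l := by
  induction l generalizing U with
  | nil => simp at ha
  | cons x l ih =>
    by_cases hx : x ∈ l
    · right
      refine ih (Submodule.mem_sup_left ?_) ?_
      · rwa [List.toFinset_cons, Finset.insert_eq_of_mem (by simpa using hx)] at h
      · obtain ⟨y, hy, hy'⟩ := ha
        rcases List.mem_cons.1 hy with rfl | hy
        exacts [⟨y, hx, hy'⟩, ⟨y, hy, hy'⟩]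
    rw [List.toFinset_cons, Finset.sum_insert (by simpa using hx)] at h
    by_cases hl : ∃ y ∈ l, a y ≠ 0
    · right
      refine ih ?_ hl
      rw [show ∑ y ∈ l.toFinset, a y • pos y
        = (a x • pos x + ∑ y ∈ l.toFinset, a y • pos y) - a x • pos x by abel]
      exact Submodule.sub_mem _ (Submodule.mem_sup_left h) (Submodule.mem_sup_right
        (Submodule.smul_mem _ _ (Submodule.mem_span_singleton_self _)))
    · left
      push Not at hl
      rw [Finset.sum_eq_zero (fun y hy => by rw [hl y (by simpa using hy), zero_smul]),
        add_zero] at h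
      have hax : a x ≠ 0 := by
        obtain ⟨y, hy, hy'⟩ := ha
        rcases List.mem_cons.1 hy with rfl | hy
        exacts [hy', absurd (hl y hy) hy']
      exact (Submodule.smul_mem_iff _ hax).1 h

open Classical in
lemma nrm_le_of_depMod [FiniteDimensional ℝ W] {pos : X → W} {d : ℕ}
    (hpos : ∀ U : Submodule ℝ W, Module.finrank ℝ U ≤ d → (P.filter (pos · ∈ U)).card ≤ d)
    (k : ℕ) {U : Submodule ℝ W} (hU : Module.finrank ℝ U + k ≤ d + 1) {α : List X → ZMod 2}
    (hα : ∀ l : List X, l.length = k → (∀ x ∈ l, x ∈ P) → α l ≠ 0 → DepMod pos U l) :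
    nrm P k α ≤ k * d / P.card := by
  rcases P.eq_empty_or_nonempty with rfl | hP
  · cases k
    · have : α [] = 0 := by
        by_contra h
        exact hα [] rfl (by simp) h
      simp [nrm, this]
    · simp [nrm]
  have hpos' : (0 : ℝ) < P.card := by exact_mod_cast hP.card_pos
  induction k generalizing U α with
  | zero =>
    have : α [] = 0 := by
      by_contra h
      exact hα [] rfl (by simp) h
    simp [nrm, this]
  | succ k ih =>
    have key : ∀ x ∈ P, nrm P k (fun l => α (x :: l))
        ≤ (if pos x ∈ U then 1 else 0) + k * d / P.card := by
      intro x hx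
      split_ifs with hxU
      · have h1 : nrm P k (fun l => α (x :: l)) ≤ 1 := by
          have : ∀ (k : ℕ) (β : List X → ZMod 2), nrm P k β ≤ 1 := by
            intro k
            induction k with
            | zero => intro β; unfold nrm; split_ifs <;> norm_num
            | succ k ih =>
              intro β
              rw [nrm, div_le_one hpos']
              refine (Finset.sum_le_sum fun x _ => ih _).trans ?_
              simp
          exact this _ _
        have : (0 : ℝ) ≤ k * d / P.card := by positivity
        linarith
      · rw [zero_add]
        refine ih (U := U ⊔ Submodule.span ℝ {pos x}) ?_ ?_
        · have h1 := Submodule.finrank_add_le_finrank_add_finrank U (Submodule.span ℝ {pos x})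
          have h2 : Module.finrank ℝ (Submodule.span ℝ {pos x}) ≤ 1 :=
            (finrank_span_le_card _).trans (by simp)
          omega
        · intro l hl hlP hne
          exact (hα (x :: l) (by simp [hl]) (by simpa [hx] using hlP) hne).resolve_left hxU
    rw [nrm]
    refine div_le_div_of_nonneg_right ((Finset.sum_le_sum key).trans ?_) hpos'.le
    rw [Finset.sum_add_distrib, Finset.sum_boole, Finset.sum_const, nsmul_eq_mul,
      mul_div_cancel₀ _ hpos'.ne']
    have : ((P.filter (pos · ∈ U)).card : ℝ) ≤ d := by exact_mod_cast hpos U (by omega)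
    push_cast
    linarith

end ListCochain

/-! ### Counting facets of a simplex met by an affine line -/

namespace ListCochain

section Facets

variable {ι : Type*} [Fintype ι] {E : Type*} [AddCommGroup E] [Module ℝ E]

/-- Moving inside the standard simplex in a nonzero direction one reaches the boundary. -/
lemma exists_zero_of_move {a ν : ι → ℝ} (ha : ∀ i, 0 ≤ a i) (hν : ν ≠ 0) (hs : ∑ i, ν i = 0) :
    ∃ t : ℝ, ∃ i, ν i < 0 ∧ a i + t * ν i = 0 ∧ ∀ j, 0 ≤ a j + t * ν j := by
  classical
  have hneg : (Finset.univ.filter fun i => ν i < 0).Nonempty := by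
    by_contra h
    rw [Finset.not_nonempty_iff_eq_empty, Finset.filter_eq_empty_iff] at h
    have h' : ∀ i ∈ Finset.univ, 0 ≤ ν i := fun i hi => not_lt.1 (h hi)
    rw [Finset.sum_eq_zero_iff_of_nonneg h'] at hs
    exact hν (funext fun i => hs i (Finset.mem_univ i))
  obtain ⟨i, hi, hmin⟩ := Finset.exists_min_image _ (fun i => a i / (-ν i)) hneg
  rw [Finset.mem_filter] at hi
  refine ⟨a i / (-ν i), i, hi.2, ?_, fun j => ?_⟩
  · have := hi.2.ne
    field_simp
    ring
  · have ht : 0 ≤ a i / (-ν i) := div_nonneg (ha i) (by linarith [hi.2])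
    by_cases hj : ν j < 0
    · have := hmin j (Finset.mem_filter.2 ⟨Finset.mem_univ j, hj⟩)
      rw [le_div_iff₀ (by linarith)] at this
      linarith
    · have := mul_nonneg ht (not_lt.1 hj)
      linarith [ha j]

/-- Under general position, the number of facets of a simplex containing a point of the
line `B = 0` on which `f` is positive has the parity of the number of zeros of `f` on this line. -/
lemma card_facets_eq [DecidableEq ι] [Module.Finite ℝ E] (B : (ι → ℝ) →ₗ[ℝ] E)
    (f : (ι → ℝ) →ₗ[ℝ] ℝ)
    (hE : Module.finrank ℝ E + 1 < Fintype.card ι)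
    (h1 : ∀ a ∈ stdSimplex ℝ ι, B a = 0 → f a = 0 → ∀ i, a i ≠ 0)
    (h2 : ∀ a ∈ stdSimplex ℝ ι, B a = 0 → ∀ i j, i ≠ j → a i = 0 → a j ≠ 0)
    (T : ι → ZMod 2) (T' : ZMod 2)
    (hT : ∀ i, T i ≠ 0 ↔ ∃ a ∈ stdSimplex ℝ ι, B a = 0 ∧ a i = 0 ∧ 0 < f a)
    (hT' : T' ≠ 0 ↔ ∃ a ∈ stdSimplex ℝ ι, B a = 0 ∧ f a = 0) :
    ∑ i, T i = T' := by
  have dich : ∀ a : ZMod 2, a = 0 ∨ a = 1 := by decide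
  by_cases hS : ∃ a ∈ stdSimplex ℝ ι, B a = 0
  swap
  · have hT0 : ∀ i, T i = 0 := fun i => by
      by_contra h
      obtain ⟨a, ha, hBa, -⟩ := (hT i).1 h
      exact hS ⟨a, ha, hBa⟩
    have hT0' : T' = 0 := by
      by_contra h
      obtain ⟨a, ha, hBa, -⟩ := hT'.1 h
      exact hS ⟨a, ha, hBa⟩
    simp [hT0, hT0']
  obtain ⟨a, ha, hBa⟩ := hS
  -- a direction of the line
  obtain ⟨μ, hμ0, hBμ, hsμ⟩ : ∃ μ : ι → ℝ, μ ≠ 0 ∧ B μ = 0 ∧ ∑ i, μ i = 0 := by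
    let s : (ι → ℝ) →ₗ[ℝ] ℝ := ∑ i, LinearMap.proj i
    have : LinearMap.ker (B.prod s) ≠ ⊥ := by
      apply LinearMap.ker_ne_bot_of_finrank_lt
      simpa using hE
    obtain ⟨μ, hμ, hμ0⟩ := Submodule.exists_mem_ne_zero_of_ne_bot this
    obtain ⟨hμ1, hμ2⟩ := Prod.mk_eq_zero.1 (LinearMap.mem_ker.1 hμ : (B μ, s μ) = 0)
    exact ⟨μ, hμ0, hμ1, by simpa [s] using hμ2⟩
  have move : ∀ b ∈ stdSimplex ℝ ι, B b = 0 → ∀ ν : ι → ℝ, ν ≠ 0 → B ν = 0 → ∑ i, ν i = 0 →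
      ∃ b' ∈ stdSimplex ℝ ι, B b' = 0 ∧ ∃ i, ν i < 0 ∧ b' i = 0 ∧ ∀ j, ν j = 0 → b' j = b j := by
    intro b hb hBb ν hν hBν hsν
    obtain ⟨t, i, hi, hz, hnn⟩ := exists_zero_of_move hb.1 hν hsν
    refine ⟨b + t • ν, ⟨fun j => by simpa using hnn j, ?_⟩, by simp [hBb, hBν], i, hi,
      by simpa using hz, fun j hj => by simp [hj]⟩
    simp [Finset.sum_add_distrib, ← Finset.mul_sum, hsν, hb.2]
  obtain ⟨p, hp, hBp, i, hi, hpi, -⟩ := move a ha hBa μ hμ0 hBμ hsμ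
  obtain ⟨q, hq, hBq, j, hj, hqj, -⟩ := move a ha hBa (-μ) (neg_ne_zero.2 hμ0) (by simp [hBμ])
    (by simp [hsμ])
  have hij : i ≠ j := by
    rintro rfl
    simp at hj; linarith
  have hppos : ∀ k, k ≠ i → 0 < p k := fun k hk =>
    lt_of_le_of_ne (hp.1 k) (h2 p hp hBp i k hk.symm hpi).symm
  have hqpos : ∀ k, k ≠ j → 0 < q k := fun k hk =>
    lt_of_le_of_ne (hq.1 k) (h2 q hq hBq j k hk.symm hqj).symm
  -- every other solution lies on the segment from `p` to `q`
  have seg : ∀ b ∈ stdSimplex ℝ ι, B b = 0 → b ≠ p →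
      ∃ c : ℝ, 0 < c ∧ c ≤ 1 ∧ b = p + c • (q - p) := by
    intro b hb hBb hbp
    have hbi : 0 < b i := by
      refine lt_of_le_of_ne (hb.1 i) fun h => ?_
      obtain ⟨b', hb', hBb', k, hk, hk0, hsame⟩ := move p hp hBp (b - p) (sub_ne_zero.2 hbp)
        (by simp [hBb, hBp]) (by simp [hb.2, hp.2])
      have hki : k ≠ i := by
        rintro rfl
        simp [← h, hpi] at hk
      exact h2 b' hb' hBb' i k hki.symm (by rw [hsame i (by simp [← h, hpi]), hpi]) hk0
    have hqi : 0 < q i := hqpos i hij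
    have hprop : b i • (q - p) - q i • (b - p) = 0 := by
      by_contra hne
      obtain ⟨b', hb', hBb', k, hk, hk0, hsame⟩ := move p hp hBp _ hne
        (by simp [hBb, hBp, hBq]) (by
          simp only [Pi.sub_apply, Pi.smul_apply, smul_eq_mul, Finset.sum_sub_distrib,
            ← Finset.mul_sum, hb.2, hp.2, hq.2]
          ring)
      have hki : k ≠ i := by
        rintro rfl
        simp [hpi] at hk
        linarith
      refine h2 b' hb' hBb' i k hki.symm ?_ hk0
      rw [hsame i (by simp [hpi]; ring), hpi]
    have hb_eq : b = p + (b i / q i) • (q - p) := by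
      have : q i • (b - p) = b i • (q - p) := (sub_eq_zero.1 hprop).symm
      rw [div_eq_inv_mul, mul_smul, ← this, inv_smul_smul₀ hqi.ne']
      abel
    refine ⟨b i / q i, div_pos hbi hqi, ?_, hb_eq⟩
    by_contra! hc
    have hbj := hb.1 j
    rw [hb_eq] at hbj
    simp [hqj] at hbj
    have := hppos j hij.symm
    nlinarith
  have hfp : f p ≠ 0 := fun h => h1 p hp hBp h i hpi
  have hfq : f q ≠ 0 := fun h => h1 q hq hBq h j hqj
  have facet : ∀ k, ∀ b ∈ stdSimplex ℝ ι, B b = 0 → b k = 0 →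
      (k = i ∧ b = p) ∨ (k = j ∧ b = q) := by
    intro k b hb hBb hbk
    by_cases hbp : b = p
    · left
      refine ⟨?_, hbp⟩
      by_contra hk
      exact (hppos k hk).ne' (hbp ▸ hbk)
    · right
      obtain ⟨c, hc0, hc1, hbc⟩ := seg b hb hBb hbp
      rcases hc1.eq_or_lt with rfl | hc1
      · have : b = q := by rw [hbc]; simp
        refine ⟨?_, this⟩
        by_contra hk
        exact (hqpos k hk).ne' (this ▸ hbk)
      · exfalso
        have e : b k = (1 - c) * p k + c * q k := by
          rw [hbc]; simp; ring
        rw [hbk] at e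
        have hpk := hp.1 k
        have hqk := hq.1 k
        rcases eq_or_ne k i with rfl | hk
        · have := mul_pos hc0 (hqpos k hij)
          rw [hpi] at e
          linarith
        · have := mul_pos (sub_pos.2 hc1) (hppos k hk)
          have := mul_nonneg hc0.le hqk
          linarith
  have hT0 : ∀ k, k ≠ i → k ≠ j → T k = 0 := by
    intro k hki hkj
    by_contra h
    obtain ⟨b, hb, hBb, hbk, -⟩ := (hT k).1 h
    rcases facet k b hb hBb hbk with h | h
    exacts [hki h.1, hkj h.1]
  have hTi : T i ≠ 0 ↔ 0 < f p := by
    rw [hT i]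
    constructor
    · rintro ⟨b, hb, hBb, hbk, hfb⟩
      rcases facet i b hb hBb hbk with h | h
      · rwa [← h.2]
      · exact absurd h.1 hij
    · exact fun h => ⟨p, hp, hBp, hpi, h⟩
  have hTj : T j ≠ 0 ↔ 0 < f q := by
    rw [hT j]
    constructor
    · rintro ⟨b, hb, hBb, hbk, hfb⟩
      rcases facet j b hb hBb hbk with h | h
      · exact absurd h.1.symm hij
      · rwa [← h.2]
    · exact fun h => ⟨q, hq, hBq, hqj, h⟩
  have hT'' : T' ≠ 0 ↔ f p * f q < 0 := by
    rw [hT']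
    constructor
    · rintro ⟨b, hb, hBb, hfb⟩
      have hbp : b ≠ p := fun h => hfp (h ▸ hfb)
      obtain ⟨c, hc0, hc1, hbc⟩ := seg b hb hBb hbp
      have e : (1 - c) * f p + c * f q = 0 := by
        rw [← hfb, hbc]; simp; ring
      have : c * (f p * f q) = - ((1 - c) * f p ^ 2) := by linear_combination f p * e
      have h3 : c * (f p * f q) ≤ 0 := by
        rw [this]
        have := mul_nonneg (sub_nonneg.2 hc1) (sq_nonneg (f p))
        linarith
      have h4 : f p * f q ≠ 0 := mul_ne_zero hfp hfq
      have h5 : f p * f q ≤ 0 := by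
        by_contra! h
        have := mul_pos hc0 h
        linarith
      exact lt_of_le_of_ne h5 h4
    · intro h
      have hne : f p - f q ≠ 0 := by
        intro h'
        have : f p = f q := sub_eq_zero.1 h'
        rw [this] at h
        nlinarith
      obtain ⟨c, hc0, hc1, hc⟩ : ∃ c : ℝ, 0 ≤ c ∧ c ≤ 1 ∧ (1 - c) * f p + c * f q = 0 := by
        refine ⟨f p / (f p - f q), ?_, ?_, by field_simp; ring⟩
        · rcases lt_or_gt_of_ne hfp with h' | h'
          · exact div_nonneg_of_nonpos h'.le (by nlinarith)
          · exact div_nonneg h'.le (by nlinarith)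
        · rcases lt_or_gt_of_ne hfp with h' | h'
          · rw [div_le_one_of_neg (by nlinarith)]; nlinarith
          · rw [div_le_one (by nlinarith)]; nlinarith
      refine ⟨(1 - c) • p + c • q, convex_stdSimplex ℝ ι hp hq (by linarith) hc0 (by ring), ?_, ?_⟩
      · simp [hBp, hBq]
      · simpa using hc
  have hsum : ∑ k, T k = T i + T j := by
    rw [← Finset.sum_pair hij]
    symm
    refine Finset.sum_subset (Finset.subset_univ _) fun k _ hk => ?_
    simp only [Finset.mem_insert, Finset.mem_singleton, not_or] at hk
    exact hT0 k hk.1 hk.2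
  rw [hsum]
  have conv : ∀ a b c : ZMod 2, (c ≠ 0 ↔ ((a ≠ 0 ∧ b = 0) ∨ (a = 0 ∧ b ≠ 0))) → a + b = c := by
    decide
  apply conv
  rw [hT'', mul_neg_iff]
  have hTi0 : T i = 0 ↔ f p < 0 := by
    rw [← not_iff_not, ← ne_eq, hTi, not_lt]
    exact ⟨le_of_lt, fun h => lt_of_le_of_ne h hfp.symm⟩
  have hTj0 : T j = 0 ↔ f q < 0 := by
    rw [← not_iff_not, ← ne_eq, hTj, not_lt]
    exact ⟨le_of_lt, fun h => lt_of_le_of_ne h hfq.symm⟩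
  rw [hTi, hTj, hTi0, hTj0]

end Facets

end ListCochain

namespace ListCochain

lemma cobd_ofFn {α : Type*} {k : ℕ} (f : List α → ZMod 2) (y : Fin (k + 1) → α) :
    cobd f (List.ofFn y) = ∑ i : Fin (k + 1), f (List.ofFn fun j => y (i.succAbove j)) := by
  induction k generalizing f with
  | zero => simp [cobd_singleton]
  | succ k ih =>
    rw [List.ofFn_succ, cobd_cons, ih, Fin.sum_univ_succ (n := k + 1)]
    congr 1
    refine Finset.sum_congr rfl fun i _ => ?_
    rw [List.ofFn_succ]
    simp

lemma ofFn_succAbove_sublist {α : Type*} {k : ℕ} (y : Fin (k + 1) → α) (i : Fin (k + 1)) :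
    (List.ofFn fun j => y (i.succAbove j)).Sublist (List.ofFn y) := by
  induction k with
  | zero => simp
  | succ k ih =>
    rw [List.ofFn_succ (f := y)]
    refine Fin.cases ?_ (fun i => ?_) i
    · simp
    · rw [List.ofFn_succ]
      simpa using ih (fun j => y j.succ) i

section Hull

variable {ι : Type*} {n : ℕ} (z : ι → Fin n → ℝ)

/-- The convex hull of the points labelled by a list. -/
def hull (L : List ι) : Set (Fin n → ℝ) := convexHull ℝ (z '' {a | a ∈ L})

variable {z}

lemma hull_mono {L L' : List ι} (h : L ⊆ L') : hull z L ⊆ hull z L' :=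
  convexHull_mono (Set.image_mono h)

lemma mem_hull_ofFn {k : ℕ} {y : Fin k → ι} {x : Fin n → ℝ} :
    x ∈ hull z (List.ofFn y) ↔ ∃ a ∈ stdSimplex ℝ (Fin k), ∑ i, a i • z (y i) = x := by
  have : z '' {a | a ∈ List.ofFn y} = Set.range (z ∘ y) := by
    ext; simp [List.mem_ofFn]
  let T : (Fin k → ℝ) →ₗ[ℝ] (Fin n → ℝ) := ∑ i, (LinearMap.proj i).smulRight (z (y i))
  have hT : ∀ a, T a = ∑ i, a i • z (y i) := fun a => by simp [T]
  have hrange : Set.range (z ∘ y) =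
      T '' Set.range fun i : Fin k => (Pi.single i 1 : Fin k → ℝ) := by
    rw [← Set.range_comp]
    congr 1
    funext i
    simp [hT, Pi.single_apply]
  rw [hull, this, hrange, ← LinearMap.image_convexHull, convexHull_rangle_single_eq_stdSimplex]
  simp only [Set.mem_image, hT]

lemma mem_hull_succAbove {k : ℕ} {y : Fin (k + 1) → ι} {x : Fin n → ℝ} (i : Fin (k + 1)) :
    x ∈ hull z (List.ofFn fun j => y (i.succAbove j)) ↔
      ∃ a ∈ stdSimplex ℝ (Fin (k + 1)), a i = 0 ∧ ∑ i, a i • z (y i) = x := by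
  rw [mem_hull_ofFn]
  constructor
  · rintro ⟨a, ha, h⟩
    refine ⟨i.insertNth 0 a, ⟨fun j => ?_, ?_⟩, by simp, ?_⟩
    · refine i.succAboveCases ?_ (fun j => ?_) j
      · simp
      · simpa using ha.1 j
    · rw [Fin.sum_univ_succAbove _ i]; simpa using ha.2
    · rw [Fin.sum_univ_succAbove _ i]; simpa using h
  · rintro ⟨a, ha, hai, h⟩
    refine ⟨fun j => a (i.succAbove j), ⟨fun j => ha.1 _, ?_⟩, ?_⟩
    · have := ha.2
      rwa [Fin.sum_univ_succAbove _ i, hai, zero_add] at this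
    · rwa [Fin.sum_univ_succAbove _ i, hai, zero_smul, zero_add] at h

variable (z)

open Classical in
/-- The indicator of the lists whose hull meets the span of the first `r` basis vectors. -/
noncomputable def meets (r : ℕ) (L : List ι) : ZMod 2 :=
  if ∃ x ∈ hull z L, ∀ j : Fin n, r ≤ j → x j = 0 then 1 else 0

open Classical in
/-- The indicator of the lists whose hull meets the open half of the span of the first `r + 1`
basis vectors where the coordinate `r` is positive. -/
noncomputable def meetsPos (r : Fin n) (L : List ι) : ZMod 2 :=
  if ∃ x ∈ hull z L, 0 < x r ∧ ∀ j : Fin n, r < j → x j = 0 then 1 else 0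

variable {z}

lemma meets_ne_zero {r : ℕ} {L : List ι} :
    meets z r L ≠ 0 ↔ ∃ x ∈ hull z L, ∀ j : Fin n, r ≤ j → x j = 0 := by
  unfold meets; split_ifs with h <;> simp [h]

lemma meetsPos_ne_zero {r : Fin n} {L : List ι} :
    meetsPos z r L ≠ 0 ↔ ∃ x ∈ hull z L, 0 < x r ∧ ∀ j : Fin n, r < j → x j = 0 := by
  unfold meetsPos; split_ifs with h <;> simp [h]

lemma eq_one_of_ne_zero {a : ZMod 2} (h : a ≠ 0) : a = 1 := by
  revert a; decide

lemma meets_last {L : List ι} (hL : L ≠ []) : meets z n L = 1 := by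
  refine eq_one_of_ne_zero (meets_ne_zero.2 ?_)
  obtain ⟨a, ha⟩ := List.exists_mem_of_ne_nil L hL
  exact ⟨z a, subset_convexHull ℝ _ ⟨a, ha, rfl⟩, fun j hj => absurd j.2 (by omega)⟩

/-- The hull of a list after changing the sign of one coordinate. -/
lemma mem_hull_map {g : ι → ι} {r : Fin n}
    (hg : ∀ a j, z (g a) j = if j = r then -z a j else z a j) {L : List ι} {x : Fin n → ℝ} :
    x ∈ hull z (L.map g) ↔ Function.update x r (-x r) ∈ hull z L := by
  let T : (Fin n → ℝ) →ₗ[ℝ] (Fin n → ℝ) :=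
    LinearMap.pi fun j => if j = r then -LinearMap.proj j else LinearMap.proj j
  have hT : ∀ y, T y = Function.update y r (-y r) := by
    intro y
    ext j
    by_cases h : j = r
    · subst h; simp [T]
    · simp [T, h]
  have hTT : ∀ y, T (T y) = y := by
    intro y
    rw [hT, hT]; simp
  have e : hull z (L.map g) = T '' hull z L := by
    unfold hull
    rw [LinearMap.image_convexHull, Set.image_image]
    congr 1
    ext y
    simp only [Set.mem_image, Set.mem_ofPred_eq, List.mem_map]
    constructor
    · rintro ⟨_, ⟨a, ha, rfl⟩, rfl⟩
      refine ⟨a, ha, ?_⟩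
      ext j
      rw [hg, hT]
      by_cases h : j = r
      · subst h; simp
      · simp [h]
    · rintro ⟨a, ha, rfl⟩
      refine ⟨_, ⟨a, ha, rfl⟩, ?_⟩
      ext j
      rw [hg, hT]
      by_cases h : j = r
      · subst h; simp
      · simp [h]
  rw [e, ← hT]
  constructor
  · rintro ⟨y, hy, rfl⟩
    rwa [hTT]
  · exact fun h => ⟨_, h, hTT x⟩

lemma meets_map {g : ι → ι} {k : Fin n}
    (hg : ∀ a j, z (g a) j = if j = k then -z a j else z a j) (r : ℕ) (L : List ι) :
    meets z r (L.map g) = meets z r L := by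
  unfold meets
  congr 1
  simp only [mem_hull_map hg, eq_iff_iff]
  constructor
  · rintro ⟨x, hx, h⟩
    refine ⟨_, hx, fun j hj => ?_⟩
    by_cases hjk : j = k
    · subst hjk; simp [h j hj]
    · simp [hjk, h j hj]
  · rintro ⟨x, hx, h⟩
    refine ⟨Function.update x k (-x k), by simpa using hx, fun j hj => ?_⟩
    by_cases hjk : j = k
    · subst hjk; simp [h j hj]
    · simp [hjk, h j hj]

lemma meetsPos_map_of_ne {g : ι → ι} {k r : Fin n} (hkr : k ≠ r)
    (hg : ∀ a j, z (g a) j = if j = k then -z a j else z a j) (L : List ι) :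
    meetsPos z r (L.map g) = meetsPos z r L := by
  unfold meetsPos
  congr 1
  simp only [mem_hull_map hg, eq_iff_iff]
  constructor
  · rintro ⟨x, hx, h0, h⟩
    refine ⟨_, hx, by simpa [hkr.symm] using h0, fun j hj => ?_⟩
    by_cases hjk : j = k
    · subst hjk; simp [h j hj]
    · simp [hjk, h j hj]
  · rintro ⟨x, hx, h0, h⟩
    refine ⟨Function.update x k (-x k), by simpa using hx, by simpa [hkr.symm] using h0,
      fun j hj => ?_⟩
    by_cases hjk : j = k
    · subst hjk; simp [h j hj]
    · simp [hjk, h j hj]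

lemma meetsPos_add_map {g : ι → ι} {r : Fin n}
    (hg : ∀ a j, z (g a) j = if j = r then -z a j else z a j) {L : List ι}
    (hL : meets z r L = 0) :
    meetsPos z r L + meetsPos z r (L.map g) = meets z (r + 1) L := by
  have conv : ∀ a b c : ZMod 2, ¬ (a ≠ 0 ∧ b ≠ 0) → (c ≠ 0 ↔ (a ≠ 0 ∨ b ≠ 0)) → a + b = c := by
    decide
  have hL' : ¬ ∃ x ∈ hull z L, ∀ j : Fin n, (r : ℕ) ≤ j → x j = 0 := by
    rw [← meets_ne_zero]; simpa using hL
  have hneg : meetsPos z r (L.map g) ≠ 0 ↔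
      ∃ x ∈ hull z L, x r < 0 ∧ ∀ j : Fin n, r < j → x j = 0 := by
    rw [meetsPos_ne_zero]
    simp only [mem_hull_map hg]
    constructor
    · rintro ⟨x, hx, h0, h⟩
      exact ⟨_, hx, by simpa using h0, fun j hj => by simp [hj.ne', h j hj]⟩
    · rintro ⟨x, hx, h0, h⟩
      exact ⟨Function.update x r (-x r), by simpa using hx, by simpa using h0,
        fun j hj => by simp [hj.ne', h j hj]⟩
  apply conv
  · rintro ⟨ha, hb⟩
    obtain ⟨x, hx, hx0, hxj⟩ := meetsPos_ne_zero.1 ha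
    obtain ⟨y, hy, hy0, hyj⟩ := hneg.1 hb
    refine hL' ⟨(-y r / (x r - y r)) • x + (x r / (x r - y r)) • y,
      convex_convexHull ℝ _ hx hy (div_nonneg (by linarith) (by linarith))
        (div_nonneg (by linarith) (by linarith)) ?_, fun j hj => ?_⟩
    · rw [← add_div, div_eq_one_iff_eq (by linarith)]; ring
    · rcases hj.eq_or_lt with hj | hj
      · obtain rfl : r = j := Fin.ext hj
        simp only [Pi.add_apply, Pi.smul_apply, smul_eq_mul]
        ring
      · simp [hxj j hj, hyj j hj]
  · rw [hneg, meetsPos_ne_zero, meets_ne_zero]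
    constructor
    · rintro ⟨x, hx, h⟩
      rcases lt_trichotomy (x r) 0 with h0 | h0 | h0
      · exact Or.inr ⟨x, hx, h0, fun j hj => h j hj⟩
      · refine absurd ⟨x, hx, fun j hj => ?_⟩ hL'
        rcases hj.eq_or_lt with hj | hj
        · obtain rfl : r = j := Fin.ext hj
          exact h0
        · exact h j hj
      · exact Or.inl ⟨x, hx, h0, fun j hj => h j hj⟩
    · rintro (⟨x, hx, -, h⟩ | ⟨x, hx, -, h⟩)
      all_goals exact ⟨x, hx, fun j hj => h j hj⟩

lemma cobd_meetsPos {r : Fin n} {L : List ι} (hlen : L.length = n - r + 1)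
    (hL : ∀ L' : List ι, L'.Sublist L → L'.length = n - r → meets z r L' = 0)
    (hL' : ∀ L' : List ι, L'.Sublist L → L'.length + 1 = n - r → meets z (r + 1) L' = 0) :
    cobd (meetsPos z r) L = meets z r L := by
  obtain ⟨N, hN⟩ : ∃ N, n - r = N + 1 := ⟨n - r - 1, by omega⟩
  rw [hN] at hlen hL hL'
  obtain ⟨y, rfl⟩ : ∃ y : Fin (N + 2) → ι, L = List.ofFn y :=
    ⟨fun i => L.get (i.cast hlen.symm), List.ext_get (by simp [hlen])
      fun _ _ _ => by simp [-List.ofFn_succ]⟩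
  rw [cobd_ofFn]
  let B : (Fin (N + 2) → ℝ) →ₗ[ℝ] ({j : Fin n // r < j} → ℝ) :=
    LinearMap.pi fun j => ∑ i, z (y i) j • LinearMap.proj i
  let f : (Fin (N + 2) → ℝ) →ₗ[ℝ] ℝ := ∑ i, z (y i) r • LinearMap.proj i
  have hB : ∀ a, B a = 0 ↔ ∀ j : Fin n, r < j → (∑ i, a i • z (y i)) j = 0 := by
    intro a
    simp [B, funext_iff, mul_comm]
  have hf : ∀ a, f a = (∑ i, a i • z (y i)) r := by
    intro a
    simp [f, mul_comm]
  have hcomb : ∀ a, B a = 0 → f a = 0 → ∀ j : Fin n, (r : ℕ) ≤ j → (∑ i, a i • z (y i)) j = 0 := by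
    intro a ha hfa j hj
    rcases hj.eq_or_lt with hj | hj
    · obtain rfl : r = j := Fin.ext hj
      rw [← hf, hfa]
    · exact (hB a).1 ha j hj
  refine card_facets_eq B f ?_ ?_ ?_ _ _ ?_ ?_
  · rw [Module.finrank_fintype_fun_eq_card, Fintype.card_fin, Fintype.card_subtype]
    have : (Finset.univ.filter fun j : Fin n => r < j) = Finset.Ioi r := by
      ext; simp
    rw [this, Fin.card_Ioi]
    omega
  · intro a ha hBa hfa i hai
    refine absurd (hL (List.ofFn fun j => y (i.succAbove j)) ?_ (by simp)) ?_
    · exact ofFn_succAbove_sublist y i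
    · exact meets_ne_zero.2 ⟨_, (mem_hull_succAbove i).2 ⟨a, ha, hai, rfl⟩, hcomb a hBa hfa⟩
  · intro a ha hBa i j hij hai haj
    obtain ⟨j, rfl⟩ := Fin.exists_succAbove_eq hij.symm
    refine absurd (hL' (List.ofFn fun k => y (i.succAbove (j.succAbove k))) ?_ (by simp)) ?_
    · exact (ofFn_succAbove_sublist (fun k => y (i.succAbove k)) j).trans
        (ofFn_succAbove_sublist y i)
    · refine meets_ne_zero.2 ⟨_, (mem_hull_succAbove (y := fun k => y (i.succAbove k)) j).2
        ⟨fun k => a (i.succAbove k), ⟨fun k => ha.1 _, ?_⟩, haj, rfl⟩, fun k hk => ?_⟩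
      · have := ha.2
        rwa [Fin.sum_univ_succAbove _ i, hai, zero_add] at this
      · have := (hB a).1 hBa k hk
        rwa [Fin.sum_univ_succAbove _ i, hai, zero_smul, zero_add] at this
  · intro i
    rw [meetsPos_ne_zero]
    constructor
    · rintro ⟨x, hx, h0, h⟩
      obtain ⟨a, ha, hai, rfl⟩ := (mem_hull_succAbove i).1 hx
      exact ⟨a, ha, (hB a).2 h, hai, by rwa [hf]⟩
    · rintro ⟨a, ha, hBa, hai, hfa⟩
      exact ⟨_, (mem_hull_succAbove i).2 ⟨a, ha, hai, rfl⟩, by rwa [← hf], (hB a).1 hBa⟩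
  · rw [meets_ne_zero]
    constructor
    · rintro ⟨x, hx, h⟩
      obtain ⟨a, ha, rfl⟩ := mem_hull_ofFn.1 hx
      exact ⟨a, ha, (hB a).2 fun j hj => h j (le_of_lt hj), by rw [hf]; exact h r le_rfl⟩
    · rintro ⟨a, ha, hBa, hfa⟩
      exact ⟨_, mem_hull_ofFn.2 ⟨a, ha, rfl⟩, hcomb a hBa hfa⟩

end Hull

end ListCochain

namespace ListCochain

section Generic

/-- Finitely many nonzero polynomials have a common non-root near any point. -/
lemma exists_eval_ne_zero_near {σ ι : Type*} [Finite σ] [Finite ι] (p : ι → MvPolynomial σ ℝ)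
    (hp : ∀ a, p a ≠ 0) (t : σ → ℝ) {δ : ℝ} (hδ : 0 < δ) :
    ∃ z : σ → ℝ, (∀ i, |z i - t i| < δ) ∧ ∀ a, MvPolynomial.eval z (p a) ≠ 0 := by
  have := Fintype.ofFinite ι
  by_contra! h
  refine Finset.prod_ne_zero_iff.2 (fun a (_ : a ∈ Finset.univ) => hp a) ?_
  refine MvPolynomial.funext_set (fun i => Set.Ioo (t i - δ) (t i + δ))
    (fun i => Set.Ioo_infinite (by linarith)) fun z hz => ?_
  obtain ⟨a, ha⟩ := h z fun i => by
    have := hz i (Set.mem_univ i)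
    rw [Set.mem_Ioo] at this
    rw [abs_lt]
    constructor <;> linarith
  rw [map_prod, map_zero]
  exact Finset.prod_eq_zero (Finset.mem_univ a) ha

/-- Near any matrix there is one all of whose minors are nonzero, for any choice of the signs of
the entries. -/
lemma exists_generic_matrix {I : Type*} [Finite I] {N : ℕ} (t : I → Fin N → ℝ) {δ : ℝ}
    (hδ : 0 < δ) :
    ∃ z : I → Fin N → ℝ, (∀ i j, |z i j - t i j| < δ) ∧
      ∀ (k : ℕ) (a : Fin k ↪ I) (c : Fin k ↪ Fin N) (e : Fin k → Fin k → ℤˣ),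
        (Matrix.of fun i j => ((e i j : ℤ) : ℝ) * z (a i) (c j)).det ≠ 0 := by
  classical
  let p : (Σ k : Fin (N + 1), (Fin k ↪ I) × (Fin k ↪ Fin N) × (Fin k → Fin k → ℤˣ)) →
      MvPolynomial (I × Fin N) ℝ := fun q =>
    (Matrix.of fun i j => MvPolynomial.C (((q.2.2.2 i j : ℤ) : ℝ)) *
      MvPolynomial.X (q.2.1 i, q.2.2.1 j)).det
  have heval : ∀ q z, MvPolynomial.eval z (p q) =
      (Matrix.of fun i j => ((q.2.2.2 i j : ℤ) : ℝ) * z (q.2.1 i, q.2.2.1 j)).det := by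
    intro q z
    rw [RingHom.map_det]
    congr 1
    ext i j
    simp
  obtain ⟨z, hz, hz'⟩ := exists_eval_ne_zero_near p (fun q hq => by
    have h := heval q fun y => if ∃ i, q.2.1 i = y.1 ∧ q.2.2.1 i = y.2 then 1 else 0
    rw [hq, map_zero] at h
    have e : (Matrix.of fun i j => ((q.2.2.2 i j : ℤ) : ℝ) *
        (if ∃ i', q.2.1 i' = q.2.1 i ∧ q.2.2.1 i' = q.2.2.1 j then (1 : ℝ) else 0)) =
        Matrix.diagonal fun i => ((q.2.2.2 i i : ℤ) : ℝ) := by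
      ext i j
      rw [Matrix.diagonal_apply]
      by_cases hij : i = j
      · subst hij
        simp
      · simp [hij]
    rw [e, Matrix.det_diagonal] at h
    exact Finset.prod_ne_zero_iff.2 (fun i _ => by simp) h.symm) (fun y => t y.1 y.2) hδ
  refine ⟨fun i j => z (i, j), fun i j => hz (i, j), fun k a c e => ?_⟩
  have hk : k ≤ N := by simpa using Fintype.card_le_of_embedding c
  have := hz' ⟨⟨k, by omega⟩, a, c, e⟩
  rwa [heval] at this

/-- Points in general position near given ones: subspaces of dimension at most `d` contain at most
`d` of them. -/
lemma exists_generic_points {X : Type*} [Fintype X] {d : ℕ} (t : X → Fin (d + 1) → ℝ) {δ : ℝ}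
    (hδ : 0 < δ) :
    ∃ pos : X → Fin (d + 1) → ℝ, (∀ x j, |pos x j - t x j| < δ) ∧
      ∀ U : Submodule ℝ (Fin (d + 1) → ℝ), Module.finrank ℝ U ≤ d →
        ∀ P : Finset X, (∀ x ∈ P, pos x ∈ U) → P.card ≤ d := by
  obtain ⟨z, hz, hz'⟩ := exists_generic_matrix t hδ
  refine ⟨z, hz, fun U hU P hP => ?_⟩
  by_contra! hc
  obtain ⟨P', hP', hcard⟩ := Finset.exists_subset_card_eq (show d + 1 ≤ P.card from hc)
  have e := P'.equivFinOfCardEq hcard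
  have hdet := hz' (d + 1) (e.symm.toEmbedding.trans (Function.Embedding.subtype _))
    (Function.Embedding.refl _) (fun _ _ => 1)
  have hli := Matrix.linearIndependent_rows_of_isUnit
    ((Matrix.isUnit_iff_isUnit_det _).2 (isUnit_iff_ne_zero.2 hdet))
  have hsub : ∀ i, (fun i => z (e.symm i)) i ∈ U := fun i => hP _ (hP' (e.symm i).2)
  have hli' : LinearIndependent ℝ fun i : Fin (d + 1) => (⟨z (e.symm i), hsub i⟩ : U) := by
    refine LinearIndependent.of_comp U.subtype ?_
    have hrow : (Matrix.of fun i j => (((1 : ℤˣ) : ℤ) : ℝ) *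
        z ((e.symm.toEmbedding.trans (Function.Embedding.subtype _)) i)
          ((Function.Embedding.refl _) j)).row =
        U.subtype ∘ fun i : Fin (d + 1) => (⟨z (e.symm i), hsub i⟩ : U) := by
      ext i j
      simp [Matrix.row]
    rwa [hrow] at hli
  have := hli'.fintype_card_le_finrank
  rw [Fintype.card_fin] at this
  omega

end Generic

section Lift

variable {n d : ℕ}

lemma exists_odd_units (A : Type*) [AddCommGroup A] [LinearOrder A] [IsOrderedAddMonoid A] :
    ∃ s : A → ℤˣ, ∀ x, x ≠ 0 → s (-x) = -s x := by
  refine ⟨fun x => if 0 < x then 1 else -1, fun x hx => ?_⟩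
  rcases lt_or_gt_of_ne hx with h | h
  · simp [h, lt_asymm h]
  · simp [h, lt_asymm h]

/-- An odd choice of signs on the sphere. -/
lemma L1Sphere.exists_odd_sign (d : ℕ) :
    ∃ s : L1Sphere d → ℤˣ, ∀ w, s (L1Sphere.antipode w) = -s w := by
  obtain ⟨s, hs⟩ := exists_odd_units (Lex (Fin (d + 1) → ℝ))
  refine ⟨fun w => s (toLex w.1), fun w => hs (toLex w.1) fun h => ?_⟩
  have h1 := w.2
  have h2 : w.1 = 0 := h
  simp [h2] at h1

lemma L1Sphere.antipode_antipode (w : L1Sphere d) :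
    L1Sphere.antipode (L1Sphere.antipode w) = w := by
  ext1; simp

lemma L1Sphere.le_dist_antipode (w : L1Sphere d) :
    1 / (d + 1 : ℝ) ≤ dist w (L1Sphere.antipode w) := by
  by_contra! h
  have h1 : ∀ i, |w.1 i| < 1 / (d + 1 : ℝ) := by
    intro i
    refine lt_of_le_of_lt ?_ h
    rw [Subtype.dist_eq]
    refine le_trans ?_ (dist_le_pi_dist _ _ i)
    rw [L1Sphere.coe_antipode, Real.dist_eq, Pi.neg_apply, sub_neg_eq_add, ← two_mul, abs_mul]
    norm_num
    linarith [abs_nonneg (w.1 i)]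
  have h2 : ∑ i, |w.1 i| < ∑ i : Fin (d + 1), 1 / (d + 1 : ℝ) :=
    Finset.sum_lt_sum_of_nonempty Finset.univ_nonempty fun i _ => h1 i
  rw [w.2] at h2
  simp at h2
  rw [mul_inv_cancel₀ (by positivity)] at h2
  exact lt_irrefl _ h2

/-- The points whose lists have no unexpected convex dependencies: hulls of at most `n - r` points
miss the span of the first `r` basis vectors. -/
lemma exists_generic_lift {X : Type*} [Finite X] (S : Set (Frame n d)) (hS : S.Finite)
    (t : L1Sphere d → X → ℝ) (ht : ∀ w x, t (L1Sphere.antipode w) x = -t w x)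
    {δ : ℝ} (hδ : 0 < δ) :
    ∃ z : Frame n d × X → Fin n → ℝ,
      (∀ v x j k, z (Frame.flip k v, x) j = if j = k then -z (v, x) j else z (v, x) j) ∧
      (∀ v ∈ S, ∀ x j, |z (v, x) j - t (v j) x| < δ) ∧
      ∀ (L : List (Frame n d × X)) (r : ℕ), (∀ a ∈ L, a.1 ∈ S) →
        (∀ a ∈ L, ∀ b ∈ L, dist a.1 b.1 < 1 / (d + 1 : ℝ)) → L.length ≤ n - r →
        meets z r L = 0 := by
  classical
  obtain ⟨s, hs⟩ := L1Sphere.exists_odd_sign d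
  let rep : L1Sphere d → L1Sphere d := fun w => if s w = 1 then w else L1Sphere.antipode w
  have hrep : ∀ w, rep (L1Sphere.antipode w) = rep w := by
    intro w
    rcases Int.units_eq_one_or (s w) with h | h <;>
      simp [rep, hs, h, L1Sphere.antipode_antipode]
  have hrep_eq : ∀ w w', rep w = rep w' → w = w' ∨ w = L1Sphere.antipode w' := by
    intro w w' h
    by_cases h1 : s w = 1 <;> by_cases h2 : s w' = 1 <;>
      simp only [rep, h1, h2, if_true, if_false] at h
    · exact Or.inl h
    · exact Or.inr h
    · right; rw [← h, L1Sphere.antipode_antipode]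
    · left; rw [← L1Sphere.antipode_antipode w, h, L1Sphere.antipode_antipode]
  let R : Frame n d × X → Frame n d × X := fun a => (fun j => rep (a.1 j), a.2)
  have hRflip : ∀ v x k, R (Frame.flip k v, x) = R (v, x) := by
    intro v x k
    ext1
    · funext j
      by_cases h : j = k
      · subst h; simp [R, Frame.flip, mapEntry, hrep]
      · simp [R, Frame.flip, mapEntry, h]
    · rfl
  let I := {a // a ∈ R '' (S ×ˢ Set.univ)}
  have : Finite I := ((hS.prod Set.finite_univ).image R).to_subtype
  let sg : Frame n d × X → Fin n → ℝ := fun a j => ((s (a.1 j) : ℤ) : ℝ)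
  have htR : ∀ w x, t w x = ((s w : ℤ) : ℝ) * t (rep w) x := by
    intro w x
    rcases Int.units_eq_one_or (s w) with h | h <;> simp [rep, h, ht]
  obtain ⟨z0, hz0, hgen⟩ := exists_generic_matrix (fun (a : I) j => t (a.1.1 j) a.1.2) hδ
  let z : Frame n d × X → Fin n → ℝ := fun a j =>
    sg a j * if h : R a ∈ R '' (S ×ˢ Set.univ) then z0 ⟨R a, h⟩ j else 0
  refine ⟨z, ?_, ?_, ?_⟩
  · intro v x j k
    simp only [z, hRflip]
    have hsg : sg (Frame.flip k v, x) j = if j = k then -sg (v, x) j else sg (v, x) j := by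
      by_cases h : j = k
      · subst h
        simp [sg, Frame.flip, mapEntry, hs]
      · simp [sg, Frame.flip, mapEntry, h]
    rw [hsg]
    split_ifs <;> ring
  · intro v hv x j
    have h : R (v, x) ∈ R '' (S ×ˢ Set.univ) := ⟨(v, x), by simp [hv], rfl⟩
    have h1 : |sg (v, x) j| = 1 := by
      rcases Int.units_eq_one_or (s (v j)) with h | h <;> simp [sg, h]
    rw [htR]
    simp only [z, dif_pos h]
    rw [show ((s (v j) : ℤ) : ℝ) = sg (v, x) j from rfl, ← mul_sub, abs_mul, h1, one_mul]
    exact hz0 ⟨_, h⟩ j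
  · intro L r hLS hLd hlen
    by_contra hne
    obtain ⟨x, hx, hx0⟩ := meets_ne_zero.1 hne
    have hRinj : ∀ a ∈ L, ∀ b ∈ L, R a = R b → a = b := by
      intro a ha b hb h
      refine Prod.ext (funext fun j => ?_) (Prod.ext_iff.1 h).2
      refine (hrep_eq _ _ (congrFun (Prod.ext_iff.1 h).1 j)).resolve_right fun h1 => ?_
      have h2 := (dist_le_pi_dist b.1 a.1 j).trans_lt (hLd b hb a ha)
      rw [h1] at h2
      exact (L1Sphere.le_dist_antipode _).not_gt h2
    have hmem : ∀ a ∈ L, R a ∈ R '' (S ×ˢ Set.univ) := fun a ha => ⟨a, by simp [hLS a ha], rfl⟩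
    obtain ⟨k, y, hy⟩ : ∃ k, ∃ y : Fin k → Frame n d × X, L.dedup = List.ofFn y :=
      ⟨_, L.dedup.get, (List.ofFn_get _).symm⟩
    have hyL : ∀ i, y i ∈ L := fun i => by
      rw [← List.mem_dedup, hy, List.mem_ofFn']
      exact ⟨i, rfl⟩
    have hyinj : Function.Injective y := by
      rw [← List.nodup_ofFn, ← hy]
      exact L.nodup_dedup
    have hk : k ≤ n - r := by
      refine le_trans ?_ hlen
      have := (L.dedup_sublist).length_le
      rwa [hy, List.length_ofFn] at this
    have hx' : x ∈ hull z (List.ofFn y) := by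
      rw [← hy]
      exact hull_mono (fun a ha => List.mem_dedup.2 ha) hx
    obtain ⟨a, ha, rfl⟩ := mem_hull_ofFn.1 hx'
    have hdet := hgen k ⟨fun i => ⟨R (y i), hmem _ (hyL i)⟩, fun i i' h =>
        hyinj (hRinj _ (hyL i) _ (hyL i') (congrArg Subtype.val h))⟩
      ⟨fun j => ⟨r + j, by omega⟩, fun j j' h => by simpa [Fin.ext_iff] using h⟩
      (fun i j => s ((y i).1 ⟨r + j, by omega⟩))
    have ha0 := Matrix.eq_zero_of_vecMul_eq_zero hdet (v := a) (by
      ext j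
      have := hx0 ⟨r + j, by omega⟩ (by simp)
      rw [Finset.sum_apply] at this
      rw [Matrix.vecMul, dotProduct, Pi.zero_apply, ← this]
      refine Finset.sum_congr rfl fun i _ => ?_
      simp only [Pi.smul_apply, smul_eq_mul, z, dif_pos (hmem _ (hyL i))]
      rfl)
    have := ha.2
    simp [ha0] at this

end Lift

end ListCochain

namespace ListCochain

lemma add_self_zmod_two (a : ZMod 2) : a + a = 0 := by
  revert a; decide

lemma cup_eq_zero_left {α : Type*} {r : ℕ} {h f : List α → ZMod 2} {l : List α}
    (hh : ∀ l', l'.Sublist l → l'.length = r + 1 → h l' = 0) : cup r h f l = 0 := by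
  by_contra H
  obtain ⟨⟨l', h1, h2, h3⟩, -⟩ := exists_of_cup_ne_zero H
  exact h3 (hh l' h1 h2)

lemma cup_eq_zero_right {α : Type*} {r : ℕ} {h f : List α → ZMod 2} {l : List α}
    (hf : ∀ l', l'.Sublist l → l'.length + r = l.length → f l' = 0) : cup r h f l = 0 := by
  by_contra H
  obtain ⟨-, l', h1, h2, h3⟩ := exists_of_cup_ne_zero H
  exact h3 (hf l' h1 h2)

lemma cup_zero_of_singletons {α : Type*} {h f : List α → ZMod 2} {l : List α} {s : ZMod 2}
    (hl : l ≠ []) (hs : ∀ a ∈ l, h [a] = s) : cup 0 h f l = s * f l := by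
  cases l with
  | nil => exact absurd rfl hl
  | cons a l => simp [cup, hs a]

lemma sum_lower {n : ℕ} (b : Fin n → ℕ) (j : Fin n) (hj : 1 ≤ b j) :
    ∑ i, lower b j i + 1 = ∑ i, b i := by
  unfold lower
  rw [Finset.sum_update_of_mem (Finset.mem_univ j),
    ← Finset.add_sum_erase _ _ (Finset.mem_univ j), Finset.sdiff_singleton_eq_erase]
  omega

lemma lower_le {n : ℕ} (b : Fin n → ℕ) (j i : Fin n) : lower b j i ≤ b i := by
  unfold lower
  by_cases h : i = j
  · subst h; simp
  · simp [h]

/-- A family of chains on which `n` commuting symmetries act like the antipodal maps on products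
of spheres. The simplices of the chains satisfy the predicate `Q`. -/
structure ChainSystem {V : Type*} {n : ℕ} (D : ℕ) (g : Fin n → V → V) (Q : List V → Prop)
    (c : (Fin n → ℕ) → List (List V)) : Prop where
  eq_nil : ∀ b j, b j = 0 → c b = []
  length_add : ∀ b, (∀ j, b j ≤ D) → ∀ l ∈ c b, l.length + n = 1 + ∑ j, b j
  prop : ∀ b, (∀ j, b j ≤ D) → ∀ l ∈ c b, Q l
  prop_subset : ∀ l l', l' ⊆ l → Q l → Q l'
  eval_cobd : ∀ b, (∀ j, 1 ≤ b j) → (∀ j, b j ≤ D) → ∀ f : List V → ZMod 2, f [] = 0 →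
    eval (c b) (cobd f) = ∑ j, eval (c (lower b j)) (fun l => f l + f (l.map (g j)))

/-- An invariant cocycle pairing nontrivially with the chain of multidegree `b`, such that each
simplex of its support contains, for every `(r, h)` in `H`, an `r`-simplex of the support of `h`. -/
structure DetectingCocycle {V : Type*} {n : ℕ} (g : Fin n → V → V) (Q : List V → Prop)
    (c : (Fin n → ℕ) → List (List V)) (b : Fin n → ℕ) (H : Set (ℕ × (List V → ZMod 2)))
    (f : List V → ZMod 2) : Prop where
  map_eq : ∀ j l, f (l.map (g j)) = f l
  cobd_eq_zero : ∀ l, Q l → l.length + n = 2 + ∑ j, b j → cobd f l = 0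
  eval_eq_one : eval (c b) f = 1
  exists_sublist : ∀ l, f l ≠ 0 → ∀ h ∈ H,
    ∃ l', l'.Sublist l ∧ l'.length = h.1 + 1 ∧ h.2 l' ≠ 0

namespace ChainSystem

variable {V : Type*} {n D : ℕ} {g : Fin n → V → V} {Q : List V → Prop}
  {c : (Fin n → ℕ) → List (List V)}

lemma eval_cup_cobd (hc : ChainSystem D g Q c) {b : Fin n → ℕ}
    (hb : ∀ j, 1 ≤ b j) (hbD : ∀ j, b j ≤ D) {p q : ℕ}
    (hpq : p + q + n + 1 = ∑ j, b j) {f : List V → ZMod 2} (hf : ∀ j l, f (l.map (g j)) = f l)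
    (hf' : ∀ l, Q l → l.length = q + 2 → cobd f l = 0) (h : List V → ZMod 2) :
    eval (c b) (cup (p + 1) (cobd h) f) =
      ∑ j, eval (c (lower b j)) (cup p (fun l => h l + h (l.map (g j))) f) := by
  have e : eval (c b) (cup (p + 1) (cobd h) f) = eval (c b) (cobd (cup p h f)) := by
    refine eval_congr fun l hl => ?_
    have hlen := hc.length_add b hbD l hl
    rw [cobd_cup _ _ _ _ (by omega), cup_eq_zero_right (h := h), add_zero]
    exact fun l' hl' hlen' => hf' l' (hc.prop_subset _ _ hl'.subset (hc.prop b hbD l hl)) (by omega)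
  rw [e, hc.eval_cobd b hb hbD _ (cup_nil _ _ _)]
  refine Finset.sum_congr rfl fun j _ => eval_congr fun l _ => ?_
  rw [cup_map, cup_add_left]
  simp only [hf]

lemma eval_cup_cobd_of_invariant (hc : ChainSystem D g Q c) {b : Fin n → ℕ}
    (hb : ∀ j, 1 ≤ b j) (hbD : ∀ j, b j ≤ D)
    {p q : ℕ} (hpq : p + q + n + 1 = ∑ j, b j) {f : List V → ZMod 2}
    (hf : ∀ j l, f (l.map (g j)) = f l)
    (hf' : ∀ l, Q l → l.length = q + 2 → cobd f l = 0) {h : List V → ZMod 2}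
    (hh : ∀ j l, h (l.map (g j)) = h l) :
    eval (c b) (cup (p + 1) (cobd h) f) = 0 := by
  rw [hc.eval_cup_cobd hb hbD hpq hf hf']
  refine Finset.sum_eq_zero fun j _ => eval_eq_zero fun l _ => cup_eq_zero_left fun l' _ _ => ?_
  rw [hh, add_self_zmod_two]

/-- Cupping with the cocycle associated with a sign that changes under two of the symmetries. -/
lemma eval_cup_sign (hc : ChainSystem D g Q c) {b : Fin n → ℕ}
    (hb : ∀ j, 1 ≤ b j) (hbD : ∀ j, b j ≤ D)
    {q : ℕ} (hq : q + n + 1 = ∑ j, b j) {f : List V → ZMod 2}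
    (hf : ∀ j l, f (l.map (g j)) = f l)
    (hf' : ∀ l, Q l → l.length = q + 2 → cobd f l = 0) {h : List V → ZMod 2} {j k : Fin n}
    (hjk : j ≠ k) (hh : ∀ i v, h [g i v] = h [v] + if i = j ∨ i = k then 1 else 0) :
    eval (c b) (cup 1 (cobd h) f) = eval (c (lower b j)) f + eval (c (lower b k)) f := by
  rw [hc.eval_cup_cobd (p := 0) (q := q) hb hbD (by omega) hf hf']
  have key : ∀ i, eval (c (lower b i)) (cup 0 (fun l => h l + h (l.map (g i))) f) =
      (if i = j ∨ i = k then 1 else 0) * eval (c (lower b i)) f := by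
    intro i
    rw [← eval_mul_left]
    refine eval_congr fun l hl => ?_
    have h1 := hc.length_add _ (fun j => (lower_le b i j).trans (hbD j)) l hl
    have h2 := sum_lower b i (hb i)
    refine cup_zero_of_singletons (by rintro rfl; simp at h1; omega) fun v _ => ?_
    simp only [List.map_cons, List.map_nil]
    rw [hh, ← add_assoc, add_self_zmod_two, zero_add]
  simp only [key]
  rw [← Finset.sum_subset (Finset.subset_univ {j, k}), Finset.sum_pair hjk]
  · simp
  · intro i _ hi
    rw [Finset.mem_insert, Finset.mem_singleton] at hi
    simp [hi]

lemma detectingCocycle_cup (hc : ChainSystem D g Q c) {b b' : Fin n → ℕ}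
    {H : Set (ℕ × (List V → ZMod 2))} {f h : List V → ZMod 2}
    (hf : DetectingCocycle g Q c b' H f) {r : ℕ} (hb' : ∀ j, 1 ≤ b' j)
    (hbb : ∑ j, b j = ∑ j, b' j + r) (hh : ∀ j l, h (l.map (g j)) = h l)
    (hh' : ∀ l, Q l → l.length = r + 2 → cobd h l = 0)
    (he : eval (c b) (cup r h f) = eval (c b') f) :
    DetectingCocycle g Q c b (insert (r, h) H) (cup r h f) where
  map_eq j l := by
    rw [cup_map]
    simp only [hh, hf.map_eq]
  cobd_eq_zero l hl hlen := by
    have h1 : n ≤ ∑ j, b' j := by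
      simpa using Finset.sum_le_sum fun j (_ : j ∈ Finset.univ) => hb' j
    rw [cobd_cup _ _ _ _ (by omega), cup_eq_zero_left, cup_eq_zero_right, add_zero]
    · exact fun l' hl' hlen' => hf.cobd_eq_zero l' (hc.prop_subset _ _ hl'.subset hl) (by omega)
    · exact fun l' hl' hlen' => hh' l' (hc.prop_subset _ _ hl'.subset hl) hlen'
  eval_eq_one := by rw [he, hf.eval_eq_one]
  exists_sublist l hl h' hh' := by
    obtain ⟨⟨l₁, h1, h2, h3⟩, l₂, h4, -, h5⟩ := exists_of_cup_ne_zero hl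
    rcases Set.mem_insert_iff.1 hh' with rfl | hh'
    · exact ⟨l₁, h1, h2, h3⟩
    · obtain ⟨l', h6, h7, h8⟩ := hf.exists_sublist l₂ h5 h' hh'
      exact ⟨l', h6.trans h4, h7, h8⟩

lemma detectingCocycle_one {v : V} (hv : c (fun _ => 1) = [[v]]) :
    DetectingCocycle g Q c (fun _ => 1) ∅ fun _ => 1 where
  map_eq _ _ := rfl
  cobd_eq_zero l _ hlen := by
    obtain ⟨a, b, rfl⟩ := List.length_eq_two.1 (show l.length = 2 by simp at hlen; omega)
    rw [cobd_pair, add_self_zmod_two]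
  eval_eq_one := by simp [hv]
  exists_sublist := by simp

/-- The multidegree reached after cupping with the cocycles of all pairs in `E`. -/
lemma exists_detectingCocycle_of_signs (hc : ChainSystem D g Q c) {v : V}
    (hv : c (fun _ => 1) = [[v]]) (hn : n ≤ D)
    {s : Fin n → Fin n → List V → ZMod 2}
    (hs : ∀ j k, j < k → ∀ i v, s j k [g i v] = s j k [v] + if i = j ∨ i = k then 1 else 0)
    (hs' : ∀ j k i l, cobd (s j k) (l.map (g i)) = cobd (s j k) l)
    (E : Finset (Fin n × Fin n)) (hE : ∀ e ∈ E, e.1 < e.2) :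
    ∃ f, DetectingCocycle g Q c (fun k => 1 + (E.filter fun e => e.2 = k).card)
      {h | ∃ e ∈ E, h = (1, cobd (s e.1 e.2))} f := by
  classical
  induction E using Finset.induction_on_min_value
    (fun e : Fin n × Fin n => e.1) with
  | empty => exact ⟨_, by simpa using detectingCocycle_one hv⟩
  | insert e E he hmin ih =>
    obtain ⟨f, hf⟩ := ih fun e' he' => hE e' (Finset.mem_insert_of_mem he')
    obtain ⟨j, k⟩ := e
    have hjk : j < k := hE _ (Finset.mem_insert_self _ _)
    set b' : Fin n → ℕ := fun k => 1 + (E.filter fun e => e.2 = k).card with hb'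
    set b : Fin n → ℕ := fun i => 1 + ((insert (j, k) E).filter fun e => e.2 = i).card with hb
    have hbk : b = Function.update b' k (b' k + 1) := by
      funext i
      by_cases hi : i = k
      · subst hi
        simp [hb, hb', Finset.filter_insert, he]
        omega
      · simp [hb, hb', Finset.filter_insert, hi, Ne.symm hi]
    have hbD : ∀ i, b i ≤ D := by
      intro i
      have h1 : ((insert (j, k) E).filter fun e => e.2 = i).card ≤ (Finset.Iio i).card := by
        refine Finset.card_le_card_of_injOn Prod.fst ?_ ?_
        · intro e he
          have he := Finset.mem_filter.1 he
          simpa [← he.2] using hE e he.1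
        · intro e he e' he' h
          have he := Finset.mem_filter.1 he
          have he' := Finset.mem_filter.1 he'
          exact Prod.ext h (he.2.trans he'.2.symm)
      rw [Fin.card_Iio] at h1
      have := i.2
      simp only [hb]
      omega
    have hbj : b j = 1 := by
      have : ((insert (j, k) E).filter fun e => e.2 = j) = ∅ := by
        refine Finset.filter_eq_empty_iff.2 fun e he h => ?_
        have h1 := hE e he
        rcases Finset.mem_insert.1 he with rfl | he
        · exact hjk.ne' h
        · exact (hmin e he).not_gt (h ▸ h1)
      simp [hb, this]
    have hlow : lower b k = b' := by
      rw [hbk]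
      unfold lower
      simp
    have hsum : ∑ i, b i = ∑ i, b' i + 1 := by
      rw [← sum_lower b k (by simp [hb]), hlow]
    have hn' : n ≤ ∑ j, b' j := by
      simpa using Finset.sum_le_sum fun j (_ : j ∈ Finset.univ) =>
        (show 1 ≤ b' j by simp [hb'])
    refine ⟨cup 1 (cobd (s j k)) f, ?_⟩
    have := hc.detectingCocycle_cup (b := b) hf (fun j => by simp [hb']) hsum (hs' j k)
      (fun l _ _ => cobd_cobd _ _) (by
        rw [hc.eval_cup_sign (q := ∑ i, b' i - n) (fun i => by simp [hb]) hbD (by omega) hf.map_eq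
          (fun l hl hlen => hf.cobd_eq_zero l hl (by omega)) hjk.ne (hs j k hjk),
          hc.eq_nil (lower b j) j (by simp [lower, hbj]), hlow, eval_nil, zero_add])
    convert this using 1
    ext h
    simp

end ChainSystem

end ListCochain

namespace ListCochain

lemma meets_map_comp {ι κ : Type*} {n : ℕ} (z : κ → Fin n → ℝ) (f : ι → κ) (r : ℕ) (l : List ι) :
    meets z r (l.map f) = meets (fun a => z (f a)) r l := by
  have : hull z (l.map f) = hull (fun a => z (f a)) l := by
    unfold hull
    congr 1
    ext x
    simp
  unfold meets
  rw [this]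

/-- In general position, the number of facets of an `n + 1`-simplex hitting the origin is even. -/
lemma cobd_meets_eq_zero {ι : Type*} {n : ℕ} (hn : 1 ≤ n) {z : ι → Fin n → ℝ} {L : List ι}
    (hgen : ∀ L' : List ι, L'.Sublist L → ∀ r, L'.length ≤ n - r → meets z r L' = 0)
    (hlen : L.length = n + 2) : cobd (meets z 0) L = 0 := by
  rw [← cobd_cobd (meetsPos z ⟨0, hn⟩) L]
  refine cobd_congr fun L' hL' => (cobd_meetsPos (r := ⟨0, hn⟩) ?_ ?_ ?_).symm
  · have := length_of_mem_faces hL'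
    simp
    omega
  · exact fun L'' h h' => hgen _ (h.trans (sublist_of_mem_faces hL')) _ h'.le
  · exact fun L'' h h' => hgen _ (h.trans (sublist_of_mem_faces hL')) _ (by omega)

namespace ChainSystem

variable {V : Type*} {n D : ℕ} {g : Fin n → V → V} {Q : List V → Prop}
  {c : (Fin n → ℕ) → List (List V)}

lemma cobd_meetsPos_eq (hc : ChainSystem D g Q c) {y : V → Fin n → ℝ}
    (hgen : ∀ l r, Q l → l.length ≤ n - r → meets y r l = 0) (r : Fin n) {l : List V}
    (hl : Q l) (hlen : l.length = n - r + 1) : cobd (meetsPos y r) l = meets y r l :=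
  cobd_meetsPos hlen
    (fun l' hl' h => hgen l' r (hc.prop_subset _ _ hl'.subset hl) h.le)
    (fun l' hl' h => hgen l' _ (hc.prop_subset _ _ hl'.subset hl) (by omega))

lemma eval_cup_meets_step (hc : ChainSystem D g Q c) {y : V → Fin n → ℝ}
    (hy : ∀ v j k, y (g k v) j = if j = k then -y v j else y v j)
    (hgen : ∀ l r, Q l → l.length ≤ n - r → meets y r l = 0) (r : Fin n)
    {b : Fin n → ℕ} (hb : ∀ j, 1 ≤ b j) (hbD : ∀ j, b j ≤ D)
    {q : ℕ} (hq : n - r + q + n = ∑ j, b j) {f : List V → ZMod 2}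
    (hf : ∀ j l, f (l.map (g j)) = f l)
    (hf' : ∀ l, Q l → l.length = q + 2 → cobd f l = 0) :
    eval (c b) (cup (n - r) (meets y r) f) =
      eval (c (lower b r)) (cup (n - (r + 1)) (meets y (r + 1)) f) := by
  have hr : n - r = n - (r + 1) + 1 := by omega
  have e : eval (c b) (cup (n - r) (meets y r) f) =
      eval (c b) (cup (n - (r + 1) + 1) (cobd (meetsPos y r)) f) := by
    rw [← hr]
    refine eval_congr fun l hl => cup_congr (fun l' hl' hlen => ?_) fun _ _ _ => rfl
    exact (hc.cobd_meetsPos_eq hgen r (hc.prop_subset _ _ hl'.subset (hc.prop b hbD l hl))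
      hlen).symm
  rw [e, hc.eval_cup_cobd (q := q) hb hbD (by omega) hf hf', Finset.sum_eq_single r]
  · refine eval_congr fun l hl => cup_congr (fun l' hl' hlen => ?_) fun _ _ _ => rfl
    refine meetsPos_add_map (fun a j => hy a j r) (hgen _ _ ?_ (by omega))
    exact hc.prop_subset _ _ hl'.subset (hc.prop _ (fun j => (lower_le b r j).trans (hbD j)) l hl)
  · intro k _ hk
    refine eval_eq_zero fun l _ => cup_eq_zero_left fun l' _ _ => ?_
    rw [meetsPos_map_of_ne hk (fun a j => hy a j k), add_self_zmod_two]
  · simp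

lemma eval_cup_meets (hc : ChainSystem D g Q c) {y : V → Fin n → ℝ}
    (hy : ∀ v j k, y (g k v) j = if j = k then -y v j else y v j)
    (hgen : ∀ l r, Q l → l.length ≤ n - r → meets y r l = 0)
    {b : Fin n → ℕ} (hb : ∀ j, 1 ≤ b j) (hbD : ∀ j, b j + 1 ≤ D)
    {q : ℕ} (hq : q + n = ∑ j, b j) {f : List V → ZMod 2}
    (hf : ∀ j l, f (l.map (g j)) = f l)
    (hf' : ∀ l, Q l → l.length = q + 2 → cobd f l = 0) :
    eval (c fun j => b j + 1) (cup n (meets y 0) f) = eval (c b) f := by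
  have key : ∀ r ≤ n, eval (c fun j => b j + 1) (cup n (meets y 0) f) =
      eval (c fun j => if (j : ℕ) < r then b j else b j + 1) (cup (n - r) (meets y r) f) ∧
      ∑ j : Fin n, (if (j : ℕ) < r then b j else b j + 1) = n - r + q + n := by
    intro r hr
    induction r with
    | zero => simp [Finset.sum_add_distrib, ← hq]; omega
    | succ r ih =>
      obtain ⟨ih, hsum⟩ := ih (by omega)
      set b' : Fin n → ℕ := fun j => if (j : ℕ) < r then b j else b j + 1 with hb'
      have h1 : ∀ j, 1 ≤ b' j := fun j => by
        simp only [hb']; split_ifs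
        · exact hb j
        · omega
      have h2 : ∀ j, b' j ≤ D := fun j => by
        have := hbD j
        simp only [hb']; split_ifs <;> omega
      have e : lower b' ⟨r, hr⟩ = fun j : Fin n => if (j : ℕ) < r + 1 then b j else b j + 1 := by
        funext j
        unfold lower
        by_cases hj : j = ⟨r, hr⟩
        · subst hj
          simp [hb']
        · have : (j : ℕ) ≠ r := fun h => hj (Fin.ext h)
          rw [Function.update_of_ne hj]
          simp only [hb']
          split_ifs <;> omega
      have hsum' := sum_lower b' ⟨r, hr⟩ (h1 _)
      rw [hsum, e] at hsum'
      beta_reduce at hsum'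
      refine ⟨?_, by omega⟩
      rw [ih, ← e]
      exact hc.eval_cup_meets_step hy hgen ⟨r, hr⟩ h1 h2 hsum.symm hf hf'
  rw [(key n le_rfl).1]
  have e : (fun j : Fin n => if (j : ℕ) < n then b j else b j + 1) = b := by
    funext j; simp
  rw [e, Nat.sub_self]
  refine eval_congr fun l hl => ?_
  have h1 := hc.length_add b (fun j => (Nat.le_succ _).trans (hbD j)) l hl
  rw [cup_zero_of_singletons (s := 1), one_mul]
  · rintro rfl
    simp at h1; omega
  · intro a _
    exact meets_last (by simp)

lemma detectingCocycle_cup_meets (hc : ChainSystem D g Q c) (hn : 1 ≤ n) {y : V → Fin n → ℝ}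
    (hy : ∀ v j k, y (g k v) j = if j = k then -y v j else y v j)
    (hgen : ∀ l r, Q l → l.length ≤ n - r → meets y r l = 0)
    {b : Fin n → ℕ} (hb : ∀ j, 1 ≤ b j) (hbD : ∀ j, b j + 1 ≤ D) {f G : List V → ZMod 2}
    {H : Set (ℕ × (List V → ZMod 2))} (hf : DetectingCocycle g Q c b H f)
    (hG : ∀ j l, G (l.map (g j)) = G l) :
    DetectingCocycle g Q c (fun j => b j + 1) (insert (n, fun l => meets y 0 l + cobd G l) H)
      (cup n (fun l => meets y 0 l + cobd G l) f) := by
  have hsum : ∑ j, (b j + 1) = ∑ j, b j + n := by simp [Finset.sum_add_distrib]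
  have hnb : n ≤ ∑ j, b j := by
    simpa using Finset.sum_le_sum fun j (_ : j ∈ Finset.univ) => hb j
  have hf' : ∀ l, Q l → l.length = ∑ j, b j - n + 2 → cobd f l = 0 :=
    fun l hl hlen => hf.cobd_eq_zero l hl (by omega)
  refine hc.detectingCocycle_cup hf hb hsum ?_ ?_ ?_
  · intro j l
    rw [meets_map (fun a i => hy a i j), cobd_map]
    simp only [hG]
  · intro l hl hlen
    rw [cobd_add, cobd_cobd, add_zero, cobd_meets_eq_zero hn
      (fun l' hl' r h => hgen l' r (hc.prop_subset _ _ hl'.subset hl) h) hlen]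
  · have e : eval (c fun j => b j + 1) (cup n (cobd G) f) = 0 := by
      obtain ⟨p, rfl⟩ : ∃ p, n = p + 1 := ⟨n - 1, by omega⟩
      exact hc.eval_cup_cobd_of_invariant (fun j => by omega) hbD
        (q := ∑ j, b j - (p + 1)) (by omega) hf.map_eq hf' hG
    have e' : eval (c fun j => b j + 1) (cup n (fun l => meets y 0 l + cobd G l) f) =
        eval (c fun j => b j + 1) (cup n (meets y 0) f) +
          eval (c fun j => b j + 1) (cup n (cobd G) f) := by
      rw [← eval_add]
      exact eval_congr fun l _ => cup_add_left _ _ _ _ _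
    rw [e', e, add_zero]
    exact hc.eval_cup_meets hy hgen hb hbD (q := ∑ j, b j - n) (by omega) hf.map_eq hf'

/-- Existence of a simplex detecting all the given cocycles simultaneously. -/
theorem exists_detecting_simplex (hc : ChainSystem D g Q c) (hn : 1 ≤ n) {v : V}
    (hv : c (fun _ => 1) = [[v]]) {t : ℕ} (hnt : n + t ≤ D)
    {s : Fin n → Fin n → List V → ZMod 2}
    (hs : ∀ j k, j < k → ∀ i v, s j k [g i v] = s j k [v] + if i = j ∨ i = k then 1 else 0)
    (hs' : ∀ j k i l, cobd (s j k) (l.map (g i)) = cobd (s j k) l)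
    {y : Fin t → V → Fin n → ℝ}
    (hy : ∀ i v j k, y i (g k v) j = if j = k then -y i v j else y i v j)
    (hgen : ∀ i l r, Q l → l.length ≤ n - r → meets (y i) r l = 0) {G : Fin t → List V → ZMod 2}
    (hG : ∀ i j l, G i (l.map (g j)) = G i l) :
    ∃ l, Q l ∧ (∀ j k, j < k → ∃ l', l'.Sublist l ∧ l'.length = 2 ∧ cobd (s j k) l' ≠ 0) ∧
      ∀ i, ∃ l', l'.Sublist l ∧ l'.length = n + 1 ∧ meets (y i) 0 l' + cobd (G i) l' ≠ 0 := by
  classical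
  let E : Finset (Fin n × Fin n) := Finset.univ.filter fun e => e.1 < e.2
  obtain ⟨f₀, hf₀⟩ := hc.exists_detectingCocycle_of_signs hv (by omega) hs hs' E (by simp [E])
  set b : Fin n → ℕ := fun k => 1 + (E.filter fun e => e.2 = k).card with hb
  have hbn : ∀ k, b k ≤ n := by
    intro k
    have h1 : (E.filter fun e => e.2 = k).card ≤ (Finset.Iio k).card := by
      refine Finset.card_le_card_of_injOn Prod.fst ?_ ?_
      · intro e he
        have he := Finset.mem_filter.1 he
        have := (Finset.mem_filter.1 he.1).2
        simpa [← he.2] using this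
      · intro e he e' he' h
        have he := Finset.mem_filter.1 he
        have he' := Finset.mem_filter.1 he'
        exact Prod.ext h (he.2.trans he'.2.symm)
    rw [Fin.card_Iio] at h1
    have := k.2
    simp only [hb]
    omega
  have key : ∀ u ≤ t, ∃ f, DetectingCocycle g Q c (fun k => b k + u)
      ({h | ∃ e ∈ E, h = (1, cobd (s e.1 e.2))} ∪
        {h | ∃ i : Fin t, (i : ℕ) < u ∧ h = (n, fun l => meets (y i) 0 l + cobd (G i) l)}) f := by
    intro u hu
    induction u with
    | zero => exact ⟨f₀, by simpa using hf₀⟩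
    | succ u ih =>
      obtain ⟨f, hf⟩ := ih (by omega)
      have := hc.detectingCocycle_cup_meets hn (hy ⟨u, hu⟩) (hgen ⟨u, hu⟩)
        (fun j => by simp only [hb]; omega) (fun j => by have := hbn j; omega) hf (hG ⟨u, hu⟩)
      refine ⟨_, this.map_eq, this.cobd_eq_zero, this.eval_eq_one, fun l hl h hh => ?_⟩
      refine this.exists_sublist l hl h ?_
      rcases hh with hh | ⟨i, hi, rfl⟩
      · exact Or.inr (Or.inl hh)
      · rcases Nat.lt_succ_iff_lt_or_eq.1 hi with hi | hi
        · exact Or.inr (Or.inr ⟨i, hi, rfl⟩)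
        · obtain rfl : i = ⟨u, hu⟩ := Fin.ext hi
          exact Or.inl rfl
  obtain ⟨f, hf⟩ := key t le_rfl
  have hne : eval (c fun k => b k + t) f ≠ 0 := by rw [hf.eval_eq_one]; decide
  obtain ⟨l, hl, hfl⟩ := exists_ne_zero_of_eval_ne_zero hne
  refine ⟨l, hc.prop _ (fun j => by have := hbn j; omega) l hl, fun j k hjk => ?_, fun i => ?_⟩
  · exact hf.exists_sublist l hfl _ (Or.inl ⟨(j, k), by simpa [E] using hjk, rfl⟩)
  · exact hf.exists_sublist l hfl _ (Or.inr ⟨i, i.2, rfl⟩)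

end ChainSystem

end ListCochain

namespace ListCochain

/-- Approximate solutions of finitely many systems can be made exact simultaneously. -/
lemma exists_exact_of_approx {K Y A : Type*} [TopologicalSpace K] [CompactSpace K]
    [TopologicalSpace Y] [CompactSpace Y] [Finite A] (f : A → K × Y → ℝ)
    (hf : ∀ a, Continuous (f a)) :
    ∃ δ > 0, ∀ v, ∃ v', ∀ a, (∃ y, f a (v, y) < δ) → ∃ y, f a (v', y) ≤ 0 := by
  have := Fintype.ofFinite A
  have h1 : ∀ v' a, ∃ η > 0, ∀ᶠ v in nhds v', (∃ y, f a (v, y) < η) → ∃ y, f a (v', y) ≤ 0 := by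
    intro v' a
    by_cases hex : ∃ y, f a (v', y) ≤ 0
    · exact ⟨1, one_pos, Filter.Eventually.of_forall fun _ _ => hex⟩
    push Not at hex
    obtain ⟨η, hη, hmin⟩ : ∃ η > 0, ∀ y, η < f a (v', y) := by
      rcases isEmpty_or_nonempty Y with hY | hY
      · exact ⟨1, one_pos, fun y => hY.elim y⟩
      · obtain ⟨y₀, -, hy₀⟩ := isCompact_univ.exists_isMinOn Set.univ_nonempty
          (((hf a).comp (Continuous.prodMk_right v')).continuousOn)
        refine ⟨f a (v', y₀) / 2, half_pos (hex y₀), fun y => ?_⟩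
        have h2 : f a (v', y₀) ≤ f a (v', y) := hy₀ (Set.mem_univ y)
        linarith [hex y₀]
    refine ⟨η, hη, ?_⟩
    have := isCompact_univ.eventually_forall_of_forall_eventually (x₀ := v')
      (P := fun v (y : Y) => η < f a (v, y))
      fun y _ => (hf a).continuousAt.eventually (lt_mem_nhds (hmin y))
    filter_upwards [this] with v hv ⟨y, hy⟩
    exact absurd hy (hv y (Set.mem_univ y)).not_gt
  choose η hη hη' using h1
  obtain ⟨t, -, ht⟩ := isCompact_univ.elim_nhds_subcover
    (fun v' => {v | ∀ a, (∃ y, f a (v, y) < η v' a) → ∃ y, f a (v', y) ≤ 0})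
    fun v' _ => Filter.eventually_all.2 (hη' v')
  obtain ⟨δ, hδ, hδ'⟩ : ∃ δ > 0, ∀ v' ∈ t, ∀ a, δ ≤ η v' a := by
    rcases (t ×ˢ (Finset.univ : Finset A)).eq_empty_or_nonempty with h | h
    · refine ⟨1, one_pos, fun v' hv' a => ?_⟩
      have : (v', a) ∈ t ×ˢ (Finset.univ : Finset A) := by simp [hv']
      simp [h] at this
    · obtain ⟨q, -, hq⟩ := Finset.exists_min_image _ (fun q : K × A => η q.1 q.2) h
      exact ⟨_, hη q.1 q.2, fun v' hv' a => hq (v', a) (by simp [hv'])⟩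
  refine ⟨δ, hδ, fun v => ?_⟩
  obtain ⟨v', hv', hv⟩ := Set.mem_iUnion₂.1 (ht (Set.mem_univ v))
  exact ⟨v', fun a ⟨y, hy⟩ => hv a ⟨y, hy.trans_le (hδ' v' hv' a)⟩⟩

instance L1Sphere.compactSpace (d : ℕ) : CompactSpace (L1Sphere d) := by
  refine isCompact_iff_compactSpace.1 (Metric.isCompact_of_isClosed_isBounded ?_ ?_)
  · exact isClosed_eq (by fun_prop) continuous_const
  · refine (Metric.isBounded_closedBall (x := 0) (r := 1)).subset fun w hw => ?_
    rw [mem_closedBall_zero_iff]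
    refine (pi_norm_le_iff_of_nonneg zero_le_one).2 fun i => ?_
    rw [← show ∑ i, |w i| = 1 from hw, Real.norm_eq_abs]
    exact Finset.single_le_sum (f := fun i => |w i|) (fun i _ => abs_nonneg _) (Finset.mem_univ i)

lemma exists_exact_frame {X : Type*} [Fintype X] [Nonempty X] (n : ℕ) {d : ℕ}
    (pos : X → Fin (d + 1) → ℝ) :
    ∃ δ > 0, ∀ v : Frame n d, (∀ j k, j ≠ k → |(v j).1 ⬝ᵥ (v k).1| < δ) →
      ∃ v' : Frame n d, (∀ j k, j ≠ k → (v' j).1 ⬝ᵥ (v' k).1 = 0) ∧ ∀ T : Finset X,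
        (∃ a ∈ stdSimplex ℝ X, (∀ x ∉ T, a x = 0) ∧
          ∀ j, |∑ x, a x * ((v j).1 ⬝ᵥ pos x)| < δ) →
        ∃ a ∈ stdSimplex ℝ X, (∀ x ∉ T, a x = 0) ∧
          ∀ j, ∑ x, a x * ((v' j).1 ⬝ᵥ pos x) = 0 := by
  classical
  have : CompactSpace (stdSimplex ℝ X) := isCompact_iff_compactSpace.1 (isCompact_stdSimplex ℝ X)
  let f : Option (Finset X) → Frame n d × stdSimplex ℝ X → ℝ := fun T q =>
    match T with
    | none => ∑ j, ∑ k, if j = k then 0 else |(q.1 j).1 ⬝ᵥ (q.1 k).1|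
    | some T => ∑ j, |∑ x, q.2.1 x * ((q.1 j).1 ⬝ᵥ pos x)| + ∑ x ∈ Tᶜ, |q.2.1 x|
  have hf : ∀ T, Continuous (f T) := by
    have h1 : ∀ (j : Fin n) i, Continuous fun q : Frame n d × stdSimplex ℝ X => (q.1 j).1 i :=
      fun j i => (continuous_apply i).comp
        (continuous_subtype_val.comp ((continuous_apply j).comp continuous_fst))
    have h2 : ∀ x, Continuous fun q : Frame n d × stdSimplex ℝ X => q.2.1 x :=
      fun x => (continuous_apply x).comp (continuous_subtype_val.comp continuous_snd)
    rintro (_ | T)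
    · refine continuous_finsetSum _ fun j _ => continuous_finsetSum _ fun k _ => ?_
      split_ifs
      · exact continuous_const
      · exact (continuous_finsetSum _ fun i _ => (h1 j i).mul (h1 k i)).abs
    · refine (continuous_finsetSum _ fun j _ => (continuous_finsetSum _ fun x _ =>
        (h2 x).mul (continuous_finsetSum _ fun i _ => (h1 j i).mul continuous_const)).abs).add
        (continuous_finsetSum _ fun x _ => (h2 x).abs)
  obtain ⟨δ, hδ, h⟩ := exists_exact_of_approx f hf
  have hlt : ∀ (k : ℕ) {a : ℝ}, a ≤ k * (δ / (k + 1)) → a < δ := by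
    intro k a ha
    refine ha.trans_lt ?_
    rw [mul_div_assoc', div_lt_iff₀ (by positivity)]
    nlinarith
  have hmono : δ / ((n * n : ℕ) + 1) ≤ δ / (n + 1) := by
    refine div_le_div_of_nonneg_left hδ.le (by positivity) ?_
    have : n ≤ n * n := Nat.le_mul_self n
    have : (n : ℝ) ≤ (n * n : ℕ) := by exact_mod_cast this
    linarith
  refine ⟨δ / ((n * n : ℕ) + 1), by positivity, fun v hv => ?_⟩
  obtain ⟨v', hv'⟩ := h v
  have hnn : ∀ j k, 0 ≤ if j = k then 0 else |(v' j).1 ⬝ᵥ (v' k).1| := fun j k => by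
    split_ifs
    · exact le_rfl
    · exact abs_nonneg _
  refine ⟨v', fun j k hjk => ?_, fun T ⟨a, ha, haT, hav⟩ => ?_⟩
  · obtain ⟨x⟩ := ‹Nonempty X›
    obtain ⟨y, hy⟩ := hv' none ⟨⟨_, single_mem_stdSimplex ℝ x⟩, hlt (n * n) (by
      calc ∑ j, ∑ k, (if j = k then 0 else |(v j).1 ⬝ᵥ (v k).1|)
          ≤ ∑ j : Fin n, ∑ k : Fin n, δ / ((n * n : ℕ) + 1) := by
            refine Finset.sum_le_sum fun j _ => Finset.sum_le_sum fun k _ => ?_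
            split_ifs with h
            · positivity
            · exact (hv j k h).le
        _ = _ := by simp; ring)⟩
    have h0 := (Finset.sum_eq_zero_iff_of_nonneg fun j _ =>
      Finset.sum_nonneg fun k _ => hnn j k).1 (le_antisymm hy
        (Finset.sum_nonneg fun j _ => Finset.sum_nonneg fun k _ => hnn j k)) j (Finset.mem_univ j)
    have h1 := (Finset.sum_eq_zero_iff_of_nonneg fun k _ => hnn j k).1 h0 k (Finset.mem_univ k)
    rwa [if_neg hjk, abs_eq_zero] at h1
  · obtain ⟨y, hy⟩ := hv' (some T) ⟨⟨a, ha⟩, hlt n (by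
      have e : ∑ x ∈ Tᶜ, |a x| = 0 :=
        Finset.sum_eq_zero fun x hx => by rw [haT x (Finset.mem_compl.1 hx), abs_zero]
      calc ∑ j, |∑ x, a x * ((v j).1 ⬝ᵥ pos x)| + ∑ x ∈ Tᶜ, |a x|
          = ∑ j, |∑ x, a x * ((v j).1 ⬝ᵥ pos x)| := by rw [e, add_zero]
        _ ≤ ∑ j : Fin n, δ / (n + 1) :=
          Finset.sum_le_sum fun j _ => (hav j).le.trans hmono
        _ = _ := by simp)⟩
    have h1 : 0 ≤ ∑ j, |∑ x, y.1 x * ((v' j).1 ⬝ᵥ pos x)| :=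
      Finset.sum_nonneg fun j _ => abs_nonneg _
    have h2 : 0 ≤ ∑ x ∈ Tᶜ, |y.1 x| := Finset.sum_nonneg fun j _ => abs_nonneg _
    have hy : ∑ j, |∑ x, y.1 x * ((v' j).1 ⬝ᵥ pos x)| + ∑ x ∈ Tᶜ, |y.1 x| ≤ 0 := hy
    refine ⟨y.1, y.2, fun x hx => ?_, fun j => ?_⟩
    · exact abs_eq_zero.1 ((Finset.sum_eq_zero_iff_of_nonneg fun x _ => abs_nonneg _).1
        (le_antisymm (by linarith) h2) x (Finset.mem_compl.2 hx))
    · exact abs_eq_zero.1 ((Finset.sum_eq_zero_iff_of_nonneg fun x _ => abs_nonneg _).1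
        (le_antisymm (by linarith) h1) j (Finset.mem_univ j))

end ListCochain

namespace ListCochain

lemma abs_dotProduct_le {k : ℕ} (w p : Fin k → ℝ) {M : ℝ} (hM : ∀ i, |p i| ≤ M) :
    |w ⬝ᵥ p| ≤ (∑ i, |w i|) * M := by
  rw [Finset.sum_mul]
  refine (Finset.abs_sum_le_sum_abs _ _).trans (Finset.sum_le_sum fun i _ => ?_)
  rw [abs_mul]
  exact mul_le_mul_of_nonneg_left (hM i) (abs_nonneg _)

lemma Frame.abs_sub_le_dist {n d : ℕ} (v v' : Frame n d) (j : Fin n) (i : Fin (d + 1)) :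
    |(v j).1 i - (v' j).1 i| ≤ dist v v' := by
  rw [← Real.dist_eq]
  refine (dist_le_pi_dist (v j).1 (v' j).1 i).trans ?_
  rw [← Subtype.dist_eq]
  exact dist_le_pi_dist v v' j

lemma Frame.abs_dotProduct_sub_le {n d : ℕ} (v v' : Frame n d) (j : Fin n) (p : Fin (d + 1) → ℝ) :
    |(v j).1 ⬝ᵥ p - (v' j).1 ⬝ᵥ p| ≤ (∑ i, |p i|) * dist v v' := by
  rw [← sub_dotProduct, dotProduct_comm]
  exact abs_dotProduct_le _ _ fun i => Frame.abs_sub_le_dist v v' j i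

lemma Frame.abs_dotProduct_self_sub_le {n d : ℕ} (v v' : Frame n d) (j k : Fin n) :
    |(v j).1 ⬝ᵥ (v k).1 - (v' j).1 ⬝ᵥ (v' k).1| ≤ 2 * dist v v' := by
  have h1 := Frame.abs_dotProduct_sub_le v v' j (v k).1
  have h2 := Frame.abs_dotProduct_sub_le v v' k (v' j).1
  rw [(v k).2] at h1
  rw [(v' j).2, dotProduct_comm, dotProduct_comm _ (v' j).1] at h2
  have := abs_sub_le ((v j).1 ⬝ᵥ (v k).1) ((v' j).1 ⬝ᵥ (v k).1) ((v' j).1 ⬝ᵥ (v' k).1)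
  linarith

/-- The sign of the inner product of two vectors of a frame, with ties broken oddly. -/
lemma Frame.exists_sign {n d : ℕ} (j k : Fin n) (hjk : j ≠ k) :
    ∃ σ : Frame n d → ZMod 2,
      (∀ i v, σ (Frame.flip i v) = σ v + if i = j ∨ i = k then 1 else 0) ∧
      ∀ v v', σ v ≠ σ v' → ((v j).1 ⬝ᵥ (v k).1) * ((v' j).1 ⬝ᵥ (v' k).1) ≤ 0 := by
  obtain ⟨s, hs⟩ := L1Sphere.exists_odd_sign d
  let ς : L1Sphere d → ZMod 2 := fun w => if s w = 1 then 0 else 1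
  have hς : ∀ w, ς (L1Sphere.antipode w) = ς w + 1 := by
    intro w
    rcases Int.units_eq_one_or (s w) with h | h <;> simp [ς, hs, h]; decide
  refine ⟨fun v => if 0 < (v j).1 ⬝ᵥ (v k).1 then 0 else if (v j).1 ⬝ᵥ (v k).1 < 0 then 1 else
    ς (v j) + ς (v k), fun i v => ?_, fun v v' h => ?_⟩
  · beta_reduce
    by_cases hij : i = j
    · subst hij
      have h1 : Frame.flip i v i = L1Sphere.antipode (v i) := by simp [Frame.flip, mapEntry]
      have h2 : Frame.flip i v k = v k := by simp [Frame.flip, mapEntry, hjk.symm]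
      rw [h1, h2, L1Sphere.coe_antipode, neg_dotProduct, hς]
      rcases lt_trichotomy ((v i).1 ⬝ᵥ (v k).1) 0 with h | h | h
      · simp [h, h.not_gt, add_self_zmod_two]
      · simp [h]; ring
      · simp [h, h.not_gt]
    · have h1 : Frame.flip i v j = v j := by simp [Frame.flip, mapEntry, Ne.symm hij]
      rw [h1]
      by_cases hik : i = k
      · subst hik
        have h2 : Frame.flip i v i = L1Sphere.antipode (v i) := by simp [Frame.flip, mapEntry]
        rw [h2, L1Sphere.coe_antipode, dotProduct_neg, hς]
        rcases lt_trichotomy ((v j).1 ⬝ᵥ (v i).1) 0 with h | h | h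
        · simp [h, h.not_gt, add_self_zmod_two]
        · simp [h]; ring
        · simp [h, h.not_gt]
      · have h2 : Frame.flip i v k = v k := by simp [Frame.flip, mapEntry, Ne.symm hik]
        simp [h2, hij, hik]
  · by_contra! hpos
    refine h ?_
    rcases pos_and_pos_or_neg_and_neg_of_mul_pos hpos with ⟨h1, h2⟩ | ⟨h1, h2⟩
    · simp [h1, h2]
    · simp [h1, h2, h1.not_gt, h2.not_gt]

/-- If the hull of a list of labelled points contains the origin, then the labels satisfy the same
convex dependency up to the distance between the points and the positions of the labels. -/
lemma exists_approx_of_meets {ι X : Type*} [Fintype X] [DecidableEq X] {n : ℕ}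
    {z : ι → Fin n → ℝ} {L : List ι} (hL : meets z 0 L ≠ 0) (f : ι → X) (t : X → Fin n → ℝ)
    {η : ℝ} (ht : ∀ a ∈ L, ∀ j, |z a j - t (f a) j| ≤ η) :
    ∃ a ∈ stdSimplex ℝ X, (∀ x ∉ (L.map f).toFinset, a x = 0) ∧
      ∀ j, |∑ x, a x * t x j| ≤ η := by
  obtain ⟨x, hx, hx0⟩ := meets_ne_zero.1 hL
  obtain ⟨k, y, rfl⟩ : ∃ k, ∃ y : Fin k → ι, L = List.ofFn y :=
    ⟨_, L.get, (List.ofFn_get _).symm⟩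
  obtain ⟨b, hb, rfl⟩ := mem_hull_ofFn.1 hx
  refine ⟨fun x => ∑ i ∈ Finset.univ.filter fun i => f (y i) = x, b i,
    ⟨fun x => Finset.sum_nonneg fun i _ => hb.1 i, ?_⟩, fun x hx => ?_, fun j => ?_⟩
  · rw [Finset.sum_fiberwise, hb.2]
  · refine Finset.sum_eq_zero fun i hi => absurd ?_ hx
    rw [List.mem_toFinset, List.mem_map]
    exact ⟨y i, List.mem_ofFn.2 ⟨i, rfl⟩, (Finset.mem_filter.1 hi).2⟩
  · have e : ∑ x, (∑ i ∈ Finset.univ.filter fun i => f (y i) = x, b i) * t x j =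
        ∑ i, b i * t (f (y i)) j := by
      rw [← Finset.sum_fiberwise Finset.univ (fun i => f (y i)) fun i => b i * t (f (y i)) j]
      refine Finset.sum_congr rfl fun x _ => ?_
      rw [Finset.sum_mul]
      refine Finset.sum_congr rfl fun i hi => ?_
      rw [(Finset.mem_filter.1 hi).2]
    have h0 : ∑ i, b i * z (y i) j = 0 := by
      have := hx0 j (Nat.zero_le _)
      rw [Finset.sum_apply] at this
      simpa using this
    rw [e, ← sub_zero (∑ i, b i * t (f (y i)) j), ← h0, ← Finset.sum_sub_distrib]
    calc |∑ i, (b i * t (f (y i)) j - b i * z (y i) j)|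
        ≤ ∑ i, |b i * t (f (y i)) j - b i * z (y i) j| := Finset.abs_sum_le_sum_abs _ _
      _ ≤ ∑ i, b i * η := by
          refine Finset.sum_le_sum fun i _ => ?_
          rw [← mul_sub, abs_mul, abs_of_nonneg (hb.1 i), abs_sub_comm]
          exact mul_le_mul_of_nonneg_left (ht _ (List.mem_ofFn.2 ⟨i, rfl⟩) j) (hb.1 i)
      _ = η := by rw [← Finset.sum_mul, hb.2, one_mul]

/-- The vectors annihilated by a frame. -/
def Frame.ker {n d : ℕ} (v : Frame n d) : Submodule ℝ (Fin (d + 1) → ℝ) where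
  carrier := {p | ∀ j, (v j).1 ⬝ᵥ p = 0}
  add_mem' {p q} hp hq j := by rw [dotProduct_add, hp j, hq j, add_zero]
  zero_mem' j := dotProduct_zero _
  smul_mem' a p hp j := by rw [dotProduct_smul, hp j, smul_zero]

lemma Frame.mem_ker {n d : ℕ} {v : Frame n d} {p : Fin (d + 1) → ℝ} :
    p ∈ Frame.ker v ↔ ∀ j, (v j).1 ⬝ᵥ p = 0 := Iff.rfl

lemma L1Sphere.dotProduct_self_ne_zero {d : ℕ} (w : L1Sphere d) : w.1 ⬝ᵥ w.1 ≠ 0 := by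
  intro h
  have h1 := w.2
  rw [dotProduct_self_eq_zero.1 h] at h1
  simp at h1

lemma Frame.linearIndependent {n d : ℕ} {v : Frame n d}
    (hv : ∀ j k, j ≠ k → (v j).1 ⬝ᵥ (v k).1 = 0) : LinearIndependent ℝ fun j => (v j).1 := by
  rw [Fintype.linearIndependent_iff]
  intro a ha k
  have h1 : (∑ j, a j • (v j).1) ⬝ᵥ (v k).1 = 0 := by rw [ha, zero_dotProduct]
  rw [sum_dotProduct, Finset.sum_eq_single k] at h1
  · rw [smul_dotProduct, smul_eq_mul] at h1
    exact (mul_eq_zero.1 h1).resolve_right (L1Sphere.dotProduct_self_ne_zero (v k))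
  · intro j _ hj
    rw [smul_dotProduct, hv j k hj, smul_zero]
  · simp

lemma Frame.finrank_ker {n d : ℕ} {v : Frame n d}
    (hv : ∀ j k, j ≠ k → (v j).1 ⬝ᵥ (v k).1 = 0) : Module.finrank ℝ (Frame.ker v) + n = d + 1 := by
  let A : Matrix (Fin n) (Fin (d + 1)) ℝ := Matrix.of fun j => (v j).1
  have hker : Frame.ker v = LinearMap.ker A.mulVecLin := by
    ext p
    rw [Frame.mem_ker, LinearMap.mem_ker, Matrix.mulVecLin_apply, funext_iff]
    rfl
  have h := LinearMap.finrank_range_add_finrank_ker A.mulVecLin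
  rw [← hker, ← Matrix.rank, Module.finrank_fintype_fun_eq_card, Fintype.card_fin,
    LinearIndependent.rank_matrix (M := A) (Frame.linearIndependent hv), Fintype.card_fin] at h
  omega

end ListCochain

namespace ListCochain

lemma cobd_shuffle_meets {V X : Type*} {n : ℕ} (hn : 1 ≤ n) {z : V × X → Fin n → ℝ}
    {s : List V} {T : List X}
    (hgen : ∀ L r, (∀ a ∈ L, a.1 ∈ s) → L.length ≤ n - r → meets z r L = 0)
    (hlen : s.length + T.length = n + 3) :
    cobd (shuffle (meets z 0) s) T = cobd (fun s' => shuffle (meets z 0) s' T) s := by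
  rcases eq_or_ne s [] with rfl | hs
  · rw [cobd_nil]
    exact (cobd_congr fun T' _ => shuffle_nil_left _ _).trans (cobd_zero _)
  rcases eq_or_ne T [] with rfl | hT
  · rw [cobd_nil]
    exact ((cobd_congr fun s' _ => shuffle_nil_right _ _).trans (cobd_zero _)).symm
  have h := shuffle_cobd (meets z 0) s T hs hT (Or.inl (by omega))
  have h0 : shuffle (cobd (meets z 0)) s T = 0 := by
    refine eval_eq_zero fun L hL => ?_
    have hL' := mem_staircases hL
    exact cobd_meets_eq_zero hn
      (fun L' hL'' r => hgen L' r fun a ha => (hL'.2 a (hL''.subset ha)).1) (by omega)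
  rw [h0] at h
  exact (CharTwo.add_eq_zero.1 h.symm).symm

section Approx

variable {X : Type*} [Fintype X] [DecidableEq X] {n d : ℕ} {pos : X → Fin (d + 1) → ℝ}
  {z : Frame n d × X → Fin n → ℝ} {η M : ℝ}

lemma Frame.exists_approx_of_meets {L : List (Frame n d × X)} (hL : meets z 0 L ≠ 0)
    {v : Frame n d} (hM : ∀ x, ∑ i, |pos x i| ≤ M)
    (hz : ∀ a ∈ L, ∀ j, |z a j - (a.1 j).1 ⬝ᵥ pos a.2| ≤ η) (hv : ∀ a ∈ L, dist a.1 v ≤ η) :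
    ∃ a ∈ stdSimplex ℝ X, (∀ x ∉ (L.map Prod.snd).toFinset, a x = 0) ∧
      ∀ j, |∑ x, a x * ((v j).1 ⬝ᵥ pos x)| ≤ η + M * η := by
  refine ListCochain.exists_approx_of_meets hL Prod.snd (fun x j => (v j).1 ⬝ᵥ pos x)
    fun a ha j => ?_
  have h1 := hz a ha j
  have h2 := Frame.abs_dotProduct_sub_le a.1 v j (pos a.2)
  have h3 : (∑ i, |pos a.2 i|) * dist a.1 v ≤ M * η :=
    mul_le_mul (hM _) (hv a ha) dist_nonneg
      ((Finset.sum_nonneg fun i _ => abs_nonneg _).trans (hM a.2))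
  have h4 := abs_sub_le (z a j) ((a.1 j).1 ⬝ᵥ pos a.2) ((v j).1 ⬝ᵥ pos a.2)
  linarith

lemma Frame.depMod_of_sum_eq_zero {v : Frame n d} {T : List X} {a : X → ℝ}
    (ha : a ∈ stdSimplex ℝ X) (haT : ∀ x ∉ T.toFinset, a x = 0)
    (h : ∀ j, ∑ x, a x * ((v j).1 ⬝ᵥ pos x) = 0) : DepMod pos (Frame.ker v) T := by
  refine depMod_of_sum_mem (a := a) (fun j => ?_) ?_
  · rw [dotProduct_sum, ← h j]
    simp only [dotProduct_smul, smul_eq_mul]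
    exact Finset.sum_subset (Finset.subset_univ _) fun x _ hx => by rw [haT x hx, zero_mul]
  · by_contra! h0
    have : ∑ x, a x = 0 := Finset.sum_eq_zero fun x _ => by
      by_cases hx : x ∈ T
      · exact h0 x hx
      · exact haT x (by simpa using hx)
    rw [ha.2] at this
    exact one_ne_zero this

lemma nrm_shuffle_le {P : Finset X}
    (hpos : ∀ U : Submodule ℝ (Fin (d + 1) → ℝ), Module.finrank ℝ U ≤ d →
      ∀ P : Finset X, (∀ x ∈ P, pos x ∈ U) → P.card ≤ d)
    {δ : ℝ} {v v' : Frame n d} (hv' : ∀ j k, j ≠ k → (v' j).1 ⬝ᵥ (v' k).1 = 0)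
    (hexact : ∀ T : Finset X, (∃ a ∈ stdSimplex ℝ X, (∀ x ∉ T, a x = 0) ∧
        ∀ j, |∑ x, a x * ((v j).1 ⬝ᵥ pos x)| < δ) →
      ∃ a ∈ stdSimplex ℝ X, (∀ x ∉ T, a x = 0) ∧ ∀ j, ∑ x, a x * ((v' j).1 ⬝ᵥ pos x) = 0)
    (hM : ∀ x, ∑ i, |pos x i| ≤ M) {s : List (Frame n d)}
    (hz : ∀ u ∈ s, ∀ x j, |z (u, x) j - (u j).1 ⬝ᵥ pos x| ≤ η) (hv : ∀ u ∈ s, dist u v ≤ η)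
    (hη : η + M * η < δ) {k : ℕ} (hk : k ≤ n) :
    nrm P k (shuffle (meets z 0) s) ≤ k * d / P.card := by
  classical
  have hker := Frame.finrank_ker hv'
  refine nrm_le_of_depMod (U := Frame.ker v') (pos := pos) (fun U hU => ?_) k (by omega) ?_
  · exact hpos U hU _ fun x hx => (Finset.mem_filter.1 hx).2
  · intro T _ _ hT
    obtain ⟨L, hL, hLm⟩ : ∃ L ∈ staircases s T, meets z 0 L ≠ 0 := by
      by_contra! h
      exact hT (eval_eq_zero h)
    have hL' := (mem_staircases hL).2
    obtain ⟨a, ha, haT, ha'⟩ := Frame.exists_approx_of_meets hLm hM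
      (fun b hb j => hz b.1 (hL' b hb).1 b.2 j) fun b hb => hv b.1 (hL' b hb).1
    have hsub : ∀ x ∈ (L.map Prod.snd).toFinset, x ∈ T.toFinset := by
      intro x hx
      obtain ⟨b, hb, rfl⟩ := List.mem_map.1 (List.mem_toFinset.1 hx)
      exact List.mem_toFinset.2 (hL' b hb).2
    obtain ⟨a', ha1, ha2, ha3⟩ := hexact T.toFinset
      ⟨a, ha, fun x hx => haT x (mt (hsub x) hx), fun j => (ha' j).trans_lt hη⟩
    exact Frame.depMod_of_sum_eq_zero ha1 ha2 ha3

end Approx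

end ListCochain

namespace ListCochain

/-- The cochain with the given values on vertices and zero on all other lists. -/
def vertexCochain {V : Type*} (σ : V → ZMod 2) : List V → ZMod 2
  | [v] => σ v
  | _ => 0

lemma vertexCochain_of_length_ne_one {V : Type*} (σ : V → ZMod 2) {l : List V}
    (h : l.length ≠ 1) : vertexCochain σ l = 0 := by
  match l with
  | [] => rfl
  | [_] => simp at h
  | _ :: _ :: _ => rfl

lemma cobd_vertexCochain_map {V : Type*} {σ : V → ZMod 2} {g : V → V} {e : ZMod 2}
    (h : ∀ v, σ (g v) = σ v + e) (l : List V) :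
    cobd (vertexCochain σ) (l.map g) = cobd (vertexCochain σ) l := by
  by_cases hl : l.length = 2
  · obtain ⟨a, b, rfl⟩ := List.length_eq_two.1 hl
    simp only [List.map_cons, List.map_nil, cobd_pair]
    change σ (g _) + σ (g _) = σ _ + σ _
    rw [h, h, add_add_add_comm, add_self_zmod_two, add_zero]
  · have h0 : ∀ l : List V, l.length ≠ 2 → cobd (vertexCochain σ) l = 0 := fun l hl =>
      (cobd_congr fun l' hl' => vertexCochain_of_length_ne_one σ (by
        have := length_of_mem_faces hl'
        omega)).trans (cobd_zero _)
    rw [h0 l hl, h0 _ (by simpa using hl)]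

lemma abs_lt_of_mul_nonpos {x y a : ℝ} (h : x * y ≤ 0) (hxy : |x - y| < a) : |x| < a := by
  rcases abs_cases (x - y) with h1 | h1 <;> rcases abs_cases x with h2 | h2 <;>
    by_contra! <;> nlinarith

/-- A fine chain on which some pair of vertices has inner products of different signs consists of
nearly orthogonal pairs. -/
lemma Frame.abs_dotProduct_lt_of_sign_change {n d : ℕ} {η : ℝ} {l : List (Frame n d)} {j k : Fin n}
    (hl : ∀ x ∈ l, ∀ y ∈ l, dist x y < η) {u u' v : Frame n d} (hu : u ∈ l) (hu' : u' ∈ l)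
    (hv : v ∈ l) (h : ((u j).1 ⬝ᵥ (u k).1) * ((u' j).1 ⬝ᵥ (u' k).1) ≤ 0) :
    |(v j).1 ⬝ᵥ (v k).1| < 4 * η := by
  have h1 := abs_lt_of_mul_nonpos h ((Frame.abs_dotProduct_self_sub_le u u' j k).trans_lt
    (mul_lt_mul_of_pos_left (hl u hu u' hu') two_pos))
  have h2 := Frame.abs_dotProduct_self_sub_le v u j k
  have h3 := hl v hv u hu
  have h4 := abs_sub_abs_le_abs_sub ((v j).1 ⬝ᵥ (v k).1) ((u j).1 ⬝ᵥ (u k).1)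
  linarith

end ListCochain

namespace ListCochain

/-- Nearly orthogonal frames that are nearly annihilated by many simplices of each of the sets. -/
theorem exists_heavy_frames {X : Type*} [Fintype X] [DecidableEq X] [Nonempty X] {n m d : ℕ}
    (hn : 1 ≤ n) (hnm : n + m = d) {pos : X → Fin (d + 1) → ℝ}
    (hpos : ∀ U : Submodule ℝ (Fin (d + 1) → ℝ), Module.finrank ℝ U ≤ d →
      ∀ P : Finset X, (∀ x ∈ P, pos x ∈ U) → P.card ≤ d)
    {P : Fin (m + 1) → Finset X} (hP : ∀ i, (P i).Nonempty) {c₀ κ δ : ℝ}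
    (hκ : ∀ i, n * d / (P i).card ≤ κ)
    (hnum : n.factorial * (c₀ + (n - 1) * κ) < 2 * ((1 - κ) / (n + 1)) * (1 - (1 - κ) / (n + 1)))
    (hδ : 0 < δ) :
    ∃ v₀ : Frame n d, (∀ j k, j ≠ k → |(v₀ j).1 ⬝ᵥ (v₀ k).1| < δ) ∧
      ∀ i, ∃ α : List X → ZMod 2, c₀ < nrm (P i) (n + 1) α ∧
        ∀ T : List X, T.length = n + 1 → α T ≠ 0 → T.Nodup ∧
          ∃ a ∈ stdSimplex ℝ X, (∀ x ∉ T.toFinset, a x = 0) ∧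
            ∀ j, |∑ x, a x * ((v₀ j).1 ⬝ᵥ pos x)| < δ := by
  obtain ⟨δ₁, hδ₁, hexact⟩ := exists_exact_frame n pos
  set M : ℝ := ∑ x, ∑ i, |pos x i| with hM_def
  have hM0 : 0 ≤ M := Finset.sum_nonneg fun x _ => Finset.sum_nonneg fun i _ => abs_nonneg _
  have hM : ∀ x, ∑ i, |pos x i| ≤ M := fun x =>
    Finset.single_le_sum (f := fun x => ∑ i, |pos x i|)
      (fun x _ => Finset.sum_nonneg fun i _ => abs_nonneg _) (Finset.mem_univ x)
  obtain ⟨η, hη0, hηd, hη4, hηM⟩ : ∃ η : ℝ, 0 < η ∧ η ≤ 1 / (d + 1 : ℝ) ∧ 4 * η ≤ min δ δ₁ ∧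
      η + M * η < min δ δ₁ := by
    have hμ : 0 < min δ δ₁ := lt_min hδ hδ₁
    have h1 : 0 < min δ δ₁ / (4 * (M + 1)) := by positivity
    have h2 : min δ δ₁ / (4 * (M + 1)) * (4 * (M + 1)) = min δ δ₁ :=
      div_mul_cancel₀ _ (by positivity)
    refine ⟨min (1 / (d + 1 : ℝ)) (min δ δ₁ / (4 * (M + 1))), lt_min (by positivity) h1,
      min_le_left _ _, ?_, ?_⟩ <;>
    have h3 := min_le_right (1 / (d + 1 : ℝ)) (min δ δ₁ / (4 * (M + 1))) <;> nlinarith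
  have hηM' := hηM.trans_le (min_le_right _ _)
  obtain ⟨c, ⟨v, hv⟩, hc0, hc1, hc2⟩ := Frame.exists_fine_chains n d hη0
  let S : Set (Frame n d) := {v | ∃ b : Fin n → ℕ, (∀ j, b j ≤ d + 1) ∧ ∃ l ∈ c b, v ∈ l}
  have hS : S.Finite := by
    have hB : {b : Fin n → ℕ | ∀ j, b j ≤ d + 1}.Finite := Set.finite_Iic fun _ => d + 1
    refine (hB.biUnion fun b _ => (c b).flatten.finite_toSet).subset ?_
    rintro v ⟨b, hb, l, hl, hvl⟩
    exact Set.mem_biUnion hb (List.mem_flatten.2 ⟨l, hl, hvl⟩)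
  obtain ⟨z, hz1, hz2, hz3⟩ := exists_generic_lift S hS (fun w x => w.1 ⬝ᵥ pos x)
    (fun w x => by rw [L1Sphere.coe_antipode, neg_dotProduct]) hη0
  let Q : List (Frame n d) → Prop := fun l =>
    (∀ v ∈ l, v ∈ S) ∧ ∀ x ∈ l, ∀ y ∈ l, dist x y < η
  have hQsub : ∀ l l', l' ⊆ l → Q l → Q l' := fun l l' h hl =>
    ⟨fun v hv => hl.1 v (h hv), fun x hx y hy => hl.2 x (h hx) y (h hy)⟩
  have hcs : ChainSystem (d + 1) Frame.flip Q c :=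
    ⟨hc0, fun b hb l hl => (hc1 b hb l hl).1,
      fun b hb l hl => ⟨fun v hv => ⟨b, hb, l, hl, hv⟩, (hc1 b hb l hl).2⟩, hQsub, hc2⟩
  have hgen : ∀ s, Q s → ∀ (L : List (Frame n d × X)) (r : ℕ), (∀ a ∈ L, a.1 ∈ s) →
      L.length ≤ n - r → meets z r L = 0 := fun s hs L r hL =>
    hz3 L r (fun a ha => hs.1 _ (hL a ha))
      fun a ha b hb => (hs.2 _ (hL a ha) _ (hL b hb)).trans_le hηd
  let F : List (Frame n d) → List X → ZMod 2 := shuffle (meets z 0)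
  have hFmap : ∀ k s, F (s.map (Frame.flip k)) = F s := by
    intro k s
    funext T
    change shuffle _ _ _ = _
    rw [shuffle_map_left]
    refine eval_congr fun L _ => ?_
    refine meets_map (k := k) (fun a j => ?_) 0 L
    exact hz1 a.1 a.2 j k
  have hfill : ∀ i, ∃ G : List (Frame n d) → List X → ZMod 2,
      (∀ g, (∀ s, F (s.map g) = F s) → ∀ s, G (s.map g) = G s) ∧
      ∀ s, (Q s ∧ (∀ v ∈ s, ∀ j k, j ≠ k → |(v j).1 ⬝ᵥ (v k).1| < δ₁) ∧
        ∀ v ∈ s, nrm (P i) (n + 1) (F [v]) ≤ c₀) → s.length = n + 1 →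
        ∀ p ∈ P i, F s [p] = cobd (fun s' => G s' [p]) s := by
    intro i
    refine exists_equivariant_filling (hP i) hn F _ ?_ (fun T => shuffle_nil_left _ _) ?_
      (le_trans (by positivity) (hκ i)) ?_ ?_ hnum
    · intro s hs s' hs'
      have h := (sublist_of_mem_faces hs').subset
      exact ⟨hQsub _ _ h hs.1, fun v hv => hs.2.1 v (h hv), fun v hv => hs.2.2 v (h hv)⟩
    · exact fun s T hs hlen _ => cobd_shuffle_meets hn (hgen s hs.1) hlen
    · intro s hs hlen
      obtain ⟨v, rfl⟩ := List.length_eq_one_iff.1 hlen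
      exact hs.2.2 v (by simp)
    · intro s hs k hk hkn hlen
      obtain ⟨v, hv⟩ := List.exists_mem_of_length_pos (l := s) (by omega)
      obtain ⟨v', hv', hT⟩ := hexact v (hs.2.1 v hv)
      refine (nrm_shuffle_le hpos hv' hT hM (fun u hu x j => (hz2 u (hs.1.1 u hu) x j).le)
        (fun u hu => (hs.1.2 u hu v hv).le) hηM' (k := n - k + 1) (by omega)).trans
        (le_trans ?_ (hκ i))
      gcongr
      omega
  choose G hG1 hG2 using hfill
  choose p hp using hP
  have hsign : ∀ j k, ∃ σ : Frame n d → ZMod 2,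
      (∀ i, ∃ e, ∀ v, σ (Frame.flip i v) = σ v + e) ∧ (j ≠ k →
        (∀ i v, σ (Frame.flip i v) = σ v + if i = j ∨ i = k then 1 else 0) ∧
        ∀ v v', σ v ≠ σ v' → ((v j).1 ⬝ᵥ (v k).1) * ((v' j).1 ⬝ᵥ (v' k).1) ≤ 0) := by
    intro j k
    by_cases hjk : j = k
    · exact ⟨fun _ => 0, fun _ => ⟨0, fun _ => rfl⟩, absurd hjk⟩
    · obtain ⟨σ, h1, h2⟩ := Frame.exists_sign (d := d) j k hjk
      exact ⟨σ, fun i => ⟨_, h1 i⟩, fun _ => ⟨h1, h2⟩⟩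
  choose σ hσ1 hσ2 using hsign
  obtain ⟨l, hl, hl1, hl2⟩ := hcs.exists_detecting_simplex hn hv (t := m + 1) (by omega)
    (s := fun j k => vertexCochain (σ j k)) (fun j k hjk i v => (hσ2 j k hjk.ne).1 i v)
    (fun j k i => cobd_vertexCochain_map (hσ1 j k i).choose_spec)
    (y := fun i v => z (v, p i)) (fun i v j k => hz1 v (p i) j k)
    (fun i l r hl hlr => by
      rw [← meets_map_comp z (fun v => (v, p i))]
      refine hgen l hl _ r (fun a ha => ?_) (by simpa using hlr)
      obtain ⟨v, hv, rfl⟩ := List.mem_map.1 ha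
      exact hv)
    (G := fun i l => G i l [p i])
    (fun i j l => by rw [hG1 i (Frame.flip j) (hFmap j)])
  have horth : ∀ v ∈ l, ∀ j k, j ≠ k → |(v j).1 ⬝ᵥ (v k).1| < min δ δ₁ := by
    have key : ∀ v ∈ l, ∀ j k, j < k → |(v j).1 ⬝ᵥ (v k).1| < min δ δ₁ := by
      intro v hv j k hjk
      obtain ⟨l', hl', hlen, hne⟩ := hl1 j k hjk
      obtain ⟨u, u', rfl⟩ := List.length_eq_two.1 hlen
      rw [cobd_pair] at hne
      have hne' : σ j k u ≠ σ j k u' := by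
        intro h
        refine hne ?_
        change σ j k u' + σ j k u = 0
        rw [h, add_self_zmod_two]
      exact (Frame.abs_dotProduct_lt_of_sign_change hl.2 (hl'.subset (by simp))
        (hl'.subset (by simp)) hv ((hσ2 j k hjk.ne).2 u u' hne')).trans_le hη4
    intro v hv j k hjk
    rcases hjk.lt_or_gt with h | h
    · exact key v hv j k h
    · rw [dotProduct_comm]
      exact key v hv k j h
  obtain ⟨v₀, hv₀⟩ : ∃ v, v ∈ l := by
    obtain ⟨l', hl', hlen, -⟩ := hl2 0
    obtain ⟨v, hv⟩ := List.exists_mem_of_length_pos (l := l') (by omega)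
    exact ⟨v, hl'.subset hv⟩
  refine ⟨v₀, fun j k hjk => (horth v₀ hv₀ j k hjk).trans_le (min_le_left _ _), fun i => ?_⟩
  obtain ⟨v, hvl, hvi⟩ : ∃ v ∈ l, c₀ < nrm (P i) (n + 1) (F [v]) := by
    by_contra! hlight
    obtain ⟨l', hl', hlen, hne⟩ := hl2 i
    have h := hG2 i l' ⟨hQsub _ _ hl'.subset hl, fun v hv j k hjk =>
      (horth v (hl'.subset hv) j k hjk).trans_le (min_le_right _ _),
      fun v hv => hlight v (hl'.subset hv)⟩ hlen (p i) (hp i)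
    have h' : F l' [p i] = meets (fun v => z (v, p i)) 0 l' := by
      change shuffle _ _ _ = _
      rw [shuffle_singleton_right _ _ _ (List.ne_nil_of_length_pos (by omega)), meets_map_comp]
    rw [← h, h', add_self_zmod_two] at hne
    exact hne rfl
  refine ⟨F [v], hvi, fun T hT hne => ?_⟩
  change shuffle _ _ _ ≠ 0 at hne
  rw [shuffle_singleton_left _ _ _ (List.ne_nil_of_length_pos (by omega))] at hne
  have hmem : ∀ T : List X, ∀ a ∈ T.map (Prod.mk v), a.1 = v := by
    intro T a ha
    obtain ⟨x, -, rfl⟩ := List.mem_map.1 ha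
    rfl
  constructor
  · by_contra hnd
    have hlen : T.dedup.length ≤ n := by
      have h1 := T.dedup_sublist.length_le
      have h2 : T.dedup.length ≠ T.length := fun h =>
        hnd (List.dedup_eq_self.1 (T.dedup_sublist.eq_of_length h))
      omega
    obtain ⟨x, hx, hx0⟩ := meets_ne_zero.1 hne
    refine absurd (hgen l hl (T.dedup.map (Prod.mk v)) 0 (fun a ha => ?_) (by simpa using hlen))
      (meets_ne_zero.2 ⟨x, hull_mono (fun a ha => ?_) hx, hx0⟩)
    · rw [hmem _ a ha]
      exact hvl
    · obtain ⟨y, hy, rfl⟩ := List.mem_map.1 ha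
      exact List.mem_map_of_mem (List.mem_dedup.2 hy)
  · obtain ⟨a, ha, haT, ha'⟩ := Frame.exists_approx_of_meets (v := v₀) hne hM
      (fun b hb j => by
        obtain ⟨b1, b2⟩ := b
        exact (hz2 b1 (hl.1 _ (by rw [show b1 = v from hmem _ _ hb]; exact hvl)) b2 j).le)
      fun b hb => by rw [hmem _ b hb]; exact (hl.2 v hvl v₀ hv₀).le
    refine ⟨a, ha, fun x hx => haT x ?_, fun j => ((ha' j).trans_lt hηM).trans_le (min_le_left _ _)⟩
    simpa [List.map_map, Function.comp_def] using hx

end ListCochain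

namespace ListCochain

/-! ### Flats cut out by frames -/

/-- The homogeneous coordinates of a point. -/
def homogenize {d : ℕ} (x : EuclideanSpace ℝ (Fin d)) : Fin (d + 1) → ℝ := Matrix.vecCons 1 ⇑x

lemma dotProduct_homogenize {d : ℕ} (w : Fin (d + 1) → ℝ) (x : EuclideanSpace ℝ (Fin d)) :
    w ⬝ᵥ homogenize x = w 0 + Matrix.vecTail w ⬝ᵥ ⇑x := by
  rw [homogenize, Matrix.dotProduct_cons, mul_one]
  rfl

lemma homogenize_sum {X : Type*} [Fintype X] {d : ℕ} {a : X → ℝ} (ha : ∑ x, a x = 1)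
    (q : X → EuclideanSpace ℝ (Fin d)) :
    homogenize (∑ x, a x • q x) = ∑ x, a x • homogenize (q x) := by
  funext i
  refine Fin.cases ?_ (fun i => ?_) i
  · simp [homogenize, ha]
  · simp [homogenize]

/-- The affine subspace of the points whose homogeneous coordinates are annihilated by a frame. -/
def Frame.flat {n d : ℕ} (v : Frame n d) : AffineSubspace ℝ (EuclideanSpace ℝ (Fin d)) where
  carrier := {x | ∀ j, (v j).1 ⬝ᵥ homogenize x = 0}
  smul_vsub_vadd_mem' c p₁ p₂ p₃ h₁ h₂ h₃ j := by
    have h₁ := h₁ j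
    have h₂ := h₂ j
    have h₃ := h₃ j
    rw [dotProduct_homogenize] at h₁ h₂ h₃ ⊢
    simp only [vsub_eq_sub, vadd_eq_add, WithLp.ofLp_add,
      WithLp.ofLp_smul, WithLp.ofLp_sub, dotProduct_add, dotProduct_smul, dotProduct_sub,
      smul_eq_mul]
    linear_combination c * h₁ - c * h₂ + h₃

lemma Frame.mem_flat {n d : ℕ} {v : Frame n d} {x : EuclideanSpace ℝ (Fin d)} :
    x ∈ Frame.flat v ↔ ∀ j, (v j).1 ⬝ᵥ homogenize x = 0 := Iff.rfl

lemma Frame.finrank_direction_flat {n d : ℕ} {v : Frame n d}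
    (hv : ∀ j k, j ≠ k → (v j).1 ⬝ᵥ (v k).1 = 0) {q : EuclideanSpace ℝ (Fin d)}
    (hq : q ∈ Frame.flat v) : Module.finrank ℝ (Frame.flat v).direction + n = d := by
  let A : Matrix (Fin n) (Fin d) ℝ := Matrix.of fun j => Matrix.vecTail (v j).1
  have hA : LinearIndependent ℝ A.row := by
    rw [Fintype.linearIndependent_iff]
    intro a ha
    refine Fintype.linearIndependent_iff.1 (Frame.linearIndependent hv) a ?_
    have htail : Matrix.vecTail (∑ j, a j • (v j).1) = 0 := by
      rw [← ha]
      funext i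
      simp [Matrix.vecTail, A]
    have h0 : (∑ j, a j • (v j).1) ⬝ᵥ homogenize q = 0 := by
      rw [sum_dotProduct]
      exact Finset.sum_eq_zero fun j _ => by rw [smul_dotProduct, hq j, smul_zero]
    rw [dotProduct_homogenize, htail, zero_dotProduct, add_zero] at h0
    funext i
    refine Fin.cases h0 (fun i => ?_) i
    exact congrFun htail i
  let e := (WithLp.linearEquiv 2 ℝ (Fin d → ℝ))
  have hker : (Frame.flat v).direction = LinearMap.ker (A.mulVecLin ∘ₗ e.toLinearMap) := by
    ext x
    rw [← AffineSubspace.vadd_mem_iff_mem_direction _ hq, LinearMap.mem_ker, Frame.mem_flat,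
      funext_iff]
    refine forall_congr' fun j => ?_
    have h := hq j
    rw [dotProduct_homogenize] at h ⊢
    rw [vadd_eq_add, WithLp.ofLp_add, dotProduct_add]
    change _ ↔ Matrix.vecTail (v j).1 ⬝ᵥ x.ofLp = 0
    constructor <;> intro h' <;> linarith
  have h := LinearMap.finrank_range_add_finrank_ker (A.mulVecLin ∘ₗ e.toLinearMap)
  rw [← hker, LinearEquiv.range_comp, ← Matrix.rank, LinearIndependent.rank_matrix hA,
    Fintype.card_fin, finrank_euclideanSpace_fin, add_comm] at h
  exact h

lemma Frame.convexHull_inter_flat_nonempty {X : Type*} [Fintype X] {n d : ℕ} {v : Frame n d}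
    {q : X → EuclideanSpace ℝ (Fin d)} {T : Finset X} {a : X → ℝ} (ha : a ∈ stdSimplex ℝ X)
    (haT : ∀ x ∉ T, a x = 0) (h : ∀ j, ∑ x, a x * ((v j).1 ⬝ᵥ homogenize (q x)) = 0) :
    (convexHull ℝ (q '' T) ∩ Frame.flat v).Nonempty := by
  refine ⟨∑ x, a x • q x, ?_, fun j => ?_⟩
  · have hsum : ∑ x ∈ T, a x = 1 := by
      rw [← ha.2]
      exact Finset.sum_subset (Finset.subset_univ _) fun x _ hx => haT x hx
    rw [← Finset.sum_subset (Finset.subset_univ T) fun x _ hx => by rw [haT x hx, zero_smul]]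
    exact (convex_convexHull ℝ _).sum_mem (fun x _ => ha.1 x) hsum fun x hx =>
      subset_convexHull ℝ _ ⟨x, hx, rfl⟩
  · rw [homogenize_sum ha.2, dotProduct_sum, ← h j]
    simp only [dotProduct_smul, smul_eq_mul]

/-! ### The constant -/

lemma exists_smallness {n : ℕ} {ε : ℝ} (hε : 0 < ε) :
    ∃ κ : ℝ, 0 < κ ∧ n.factorial * (2 * n / ((n + 1).factorial * (n + 1)) - ε + (n - 1) * κ)
      < 2 * ((1 - κ) / (n + 1)) * (1 - (1 - κ) / (n + 1)) := by
  have hn : (n : ℝ) + 1 ≠ 0 := by positivity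
  have hf : (0 : ℝ) < n.factorial := by exact_mod_cast n.factorial_pos
  have h0 : n.factorial * (2 * n / ((n + 1).factorial * (n + 1)) - ε + (n - 1) * 0)
      < 2 * ((1 - (0 : ℝ)) / (n + 1)) * (1 - (1 - 0) / (n + 1)) := by
    have h1 : (n.factorial : ℝ) * (2 * n / ((n + 1).factorial * (n + 1)))
        = 2 * (1 / (n + 1)) * (1 - 1 / (n + 1)) := by
      rw [Nat.factorial_succ]
      push_cast
      field_simp
      ring
    have h2 := mul_pos hf hε
    simp only [sub_zero, mul_zero, add_zero]
    rw [← h1]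
    linarith
  have hev := ContinuousAt.eventually_lt
    (f := fun κ : ℝ => n.factorial * (2 * n / ((n + 1).factorial * (n + 1)) - ε + (n - 1) * κ))
    (g := fun κ : ℝ => 2 * ((1 - κ) / (n + 1)) * (1 - (1 - κ) / (n + 1))) (x₀ := 0)
    (by fun_prop) (by fun_prop) h0
  obtain ⟨κ, hκ, hκ0⟩ := ((hev.filter_mono nhdsWithin_le_nhds).and
    (self_mem_nhdsWithin (s := Set.Ioi (0 : ℝ)))).exists
  exact ⟨κ, hκ0, hκ⟩

end ListCochain

namespace ListCochain

lemma abs_sum_mul_lt_of_close {X : Type*} [Fintype X] {d : ℕ} {a : X → ℝ}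
    (ha : a ∈ stdSimplex ℝ X) {pos pos' : X → Fin (d + 1) → ℝ} {δ : ℝ}
    (hpos : ∀ x i, |pos x i - pos' x i| < δ / 2) (w : L1Sphere d)
    (h : |∑ x, a x * (w.1 ⬝ᵥ pos x)| < δ / 2) : |∑ x, a x * (w.1 ⬝ᵥ pos' x)| < δ := by
  have h1 : |∑ x, a x * (w.1 ⬝ᵥ pos x) - ∑ x, a x * (w.1 ⬝ᵥ pos' x)| ≤ δ / 2 := by
    rw [← Finset.sum_sub_distrib]
    calc |∑ x, (a x * (w.1 ⬝ᵥ pos x) - a x * (w.1 ⬝ᵥ pos' x))|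
        ≤ ∑ x, |a x * (w.1 ⬝ᵥ pos x) - a x * (w.1 ⬝ᵥ pos' x)| := Finset.abs_sum_le_sum_abs _ _
      _ ≤ ∑ x, a x * (δ / 2) := by
          refine Finset.sum_le_sum fun x _ => ?_
          rw [← mul_sub, abs_mul, abs_of_nonneg (ha.1 x), ← dotProduct_sub]
          refine mul_le_mul_of_nonneg_left ?_ (ha.1 x)
          have := abs_dotProduct_le w.1 (pos x - pos' x) fun i => (hpos x i).le
          rwa [w.2, one_mul] at this
      _ = δ / 2 := by rw [← Finset.sum_mul, ha.2, one_mul]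
  have h2 := abs_sub_abs_le_abs_sub (∑ x, a x * (w.1 ⬝ᵥ pos' x)) (∑ x, a x * (w.1 ⬝ᵥ pos x))
  rw [abs_sub_comm] at h2
  linarith

/-- A flat meeting many simplices of each of the sets, for a family of points indexed by a finite
type. -/
theorem exists_heavy_flat {X : Type*} [Fintype X] [DecidableEq X] [Nonempty X] {n m d : ℕ}
    (hn : 1 ≤ n) (hnm : n + m = d) (q : X → EuclideanSpace ℝ (Fin d))
    {P : Fin (m + 1) → Finset X} (hP : ∀ i, n + 1 ≤ (P i).card) {c₀ κ : ℝ} (hc₀ : 0 < c₀)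
    (hκ : ∀ i, n * d / (P i).card ≤ κ)
    (hnum : n.factorial * (c₀ + (n - 1) * κ)
      < 2 * ((1 - κ) / (n + 1)) * (1 - (1 - κ) / (n + 1))) :
    ∃ L : AffineSubspace ℝ (EuclideanSpace ℝ (Fin d)),
      (L : Set (EuclideanSpace ℝ (Fin d))).Nonempty ∧
      Module.finrank ℝ L.direction = m ∧ ∀ i, ∃ S : Finset (Finset X),
        c₀ * (P i).card.choose (n + 1) ≤ S.card ∧ ∀ T ∈ S, T ⊆ P i ∧ T.card = n + 1 ∧
          (convexHull ℝ (q '' T) ∩ L).Nonempty := by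
  classical
  obtain ⟨δ, hδ, hexact⟩ := exists_exact_frame n fun x => homogenize (q x)
  obtain ⟨pos, hclose, hpos⟩ := exists_generic_points (fun x => homogenize (q x)) (half_pos hδ)
  obtain ⟨v₀, hv₀, hheavy⟩ := exists_heavy_frames hn hnm hpos
    (fun i => Finset.card_pos.1 (by have := hP i; omega)) hκ hnum (half_pos hδ)
  obtain ⟨v, hv, hT⟩ := hexact v₀ fun j k hjk => (hv₀ j k hjk).trans (half_lt_self hδ)
  have hS : ∀ i, ∃ S : Finset (Finset X),
      c₀ * (P i).card.choose (n + 1) ≤ S.card ∧ ∀ T ∈ S, T ⊆ P i ∧ T.card = n + 1 ∧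
        (convexHull ℝ (q '' T) ∩ Frame.flat v).Nonempty := by
    intro i
    obtain ⟨α, hα, hα'⟩ := hheavy i
    let S : Finset (Finset X) := Finset.univ.filter fun T => T ⊆ P i ∧ T.card = n + 1 ∧
        (convexHull ℝ (q '' T) ∩ Frame.flat v).Nonempty
    refine ⟨S, (mul_le_mul_of_nonneg_right hα.le (Nat.cast_nonneg _)).trans
      (nrm_mul_choose_le (n + 1) (fun T hT => (Finset.mem_filter.1 hT).2.2.1) ?_),
      fun T hT => (Finset.mem_filter.1 hT).2⟩
    intro l hl hlP hne
    obtain ⟨hnd, a, ha, hal, ha'⟩ := hα' l hl hne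
    obtain ⟨b, hb, hbl, hb'⟩ := hT l.toFinset ⟨a, ha, hal, fun j =>
      abs_sum_mul_lt_of_close ha hclose (v₀ j) (ha' j)⟩
    refine ⟨hnd, Finset.mem_filter.2 ⟨Finset.mem_univ _, fun x hx => hlP x (by simpa using hx), ?_,
      Frame.convexHull_inter_flat_nonempty hb hbl hb'⟩⟩
    rw [List.toFinset_card_of_nodup hnd, hl]
  obtain ⟨x, hx⟩ : (Frame.flat v : Set (EuclideanSpace ℝ (Fin d))).Nonempty := by
    obtain ⟨S, hcard, hmem⟩ := hS 0
    have h1 : (0 : ℝ) < (P 0).card.choose (n + 1) := by exact_mod_cast Nat.choose_pos (hP 0)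
    have h2 : 0 < S.card := by exact_mod_cast (mul_pos hc₀ h1).trans_le hcard
    obtain ⟨T, hT⟩ := Finset.card_pos.1 h2
    exact (hmem T hT).2.2.mono Set.inter_subset_right
  refine ⟨Frame.flat v, ⟨x, hx⟩, ?_, hS⟩
  have := Frame.finrank_direction_flat hv hx
  omega

end ListCochain

open ListCochain in
/-- **Transversal version of the heavily covered point theorem.**
For every `d ≥ 1`, every `m` with `0 ≤ m ≤ d-1`, and every `ε > 0` there is `N₀` such
that: for any finite point sets `P₀, …, P_m` in `ℝ^d`, each of cardinality at least `N₀`,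
there is an `m`-dimensional affine subspace `L` of `ℝ^d` such that for every `i`, at least
`(2(d-m)/((d-m+1)!(d-m+1)) - ε) · C(|P_i|, d-m+1)` of the `(d-m+1)`-element subsets of
`P_i` have convex hull meeting `L`. -/
theorem transversal_heavily_covered (d m : ℕ) (hd : 1 ≤ d) (hm : m ≤ d - 1)
    (ε : ℝ) (hε : 0 < ε) :
    ∃ N₀ : ℕ, ∀ P : Fin (m + 1) → Finset (EuclideanSpace ℝ (Fin d)),
      (∀ i, N₀ ≤ (P i).card) →
      ∃ L : AffineSubspace ℝ (EuclideanSpace ℝ (Fin d)),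
        (L : Set (EuclideanSpace ℝ (Fin d))).Nonempty ∧
        Module.finrank ℝ L.direction = m ∧
        ∀ i : Fin (m + 1),
          ((2 * ((d - m : ℕ) : ℝ)) /
              ((Nat.factorial (d - m + 1) : ℝ) * (((d - m : ℕ) : ℝ) + 1)) - ε) *
              (((P i).card.choose (d - m + 1)) : ℝ) ≤
            (({T : Finset (EuclideanSpace ℝ (Fin d)) | T ⊆ P i ∧ T.card = d - m + 1 ∧
                (convexHull ℝ (T : Set (EuclideanSpace ℝ (Fin d))) ∩
                  (L : Set (EuclideanSpace ℝ (Fin d)))).Nonempty}).ncard : ℝ) := by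
  classical
  obtain ⟨n, hn⟩ : ∃ n, d - m = n := ⟨_, rfl⟩
  rw [hn]
  have hn1 : 1 ≤ n := by omega
  set c : ℝ := 2 * n / ((n + 1).factorial * (n + 1)) with hc
  have hc0 : 0 < c := by
    have h1 : (0 : ℝ) < n := by exact_mod_cast hn1
    have h2 : (0 : ℝ) < (n + 1).factorial := by exact_mod_cast Nat.factorial_pos _
    positivity
  have hε' : 0 < min ε (c / 2) := lt_min hε (half_pos hc0)
  obtain ⟨κ, hκ, hnum⟩ := exists_smallness (n := n) hε'
  obtain ⟨N, hN⟩ := exists_nat_ge (n * d / κ)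
  refine ⟨max N (n + 1), fun P hP => ?_⟩
  have hmem : ∀ i, ∀ x ∈ P i, x ∈ Finset.univ.biUnion P := fun i x hx =>
    Finset.mem_biUnion.2 ⟨i, Finset.mem_univ _, hx⟩
  let X := {x // x ∈ Finset.univ.biUnion P}
  let P' : Fin (m + 1) → Finset X := fun i => (P i).subtype _
  have hcard : ∀ i, (P' i).card = (P i).card := fun i => by
    rw [Finset.card_subtype, Finset.filter_true_of_mem (hmem i)]
  have hle : ∀ i, n + 1 ≤ (P' i).card := fun i =>
    (le_max_right _ _).trans ((hP i).trans_eq (hcard i).symm)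
  have : Nonempty X := (Finset.card_pos.1 (Nat.succ_pos n |>.trans_le (hle 0))).to_type
  have hκ' : ∀ i, n * d / ((P' i).card : ℝ) ≤ κ := by
    intro i
    rw [hcard]
    have h1 : N ≤ (P i).card := (le_max_left _ _).trans (hP i)
    have h2 : (0 : ℝ) < (P i).card := by
      exact_mod_cast (Nat.succ_pos n).trans_le ((le_max_right _ _).trans (hP i))
    rw [div_le_iff₀ h2, ← div_le_iff₀' hκ]
    exact hN.trans (by exact_mod_cast h1)
  obtain ⟨L, hL, hdim, hS⟩ := exists_heavy_flat (κ := κ) hn1 (show n + m = d by omega)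
    (Subtype.val : X → _) hle (c₀ := c - min ε (c / 2))
    (by linarith [min_le_right ε (c / 2)]) hκ' hnum
  refine ⟨L, hL, hdim, fun i => ?_⟩
  obtain ⟨S, hScard, hSmem⟩ := hS i
  rw [hcard i] at hScard
  refine (mul_le_mul_of_nonneg_right (sub_le_sub_left (min_le_left ε (c / 2)) c)
    (Nat.cast_nonneg _)).trans (hScard.trans ?_)
  rw [← Finset.card_map (Finset.mapEmbedding (Function.Embedding.subtype _)).toEmbedding,
    ← Set.ncard_coe_finset, Nat.cast_le]
  refine Set.ncard_le_ncard ?_ ((P i).powerset.finite_toSet.subset fun T hT =>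
    Finset.mem_coe.2 (Finset.mem_powerset.2 hT.1))
  intro T hT
  obtain ⟨T', hT', rfl⟩ := Finset.mem_map.1 hT
  obtain ⟨h1, h2, h3⟩ := hSmem T' hT'
  rw [RelEmbedding.coe_toEmbedding, Finset.mapEmbedding_apply]
  refine ⟨fun x hx => ?_, by rw [Finset.card_map, h2], by rw [Finset.coe_map]; exact h3⟩
  obtain ⟨y, hy, rfl⟩ := Finset.mem_map.1 hx
  exact Finset.mem_subtype.1 (h1 hy)
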